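/- Let π be a set of primes with 2 ∈ π, and let G be a finite π-separable group. Let χ ∈ Irr(G) be π'-special. If χ(1) > 1, then χ^o is not in I_π(G). -/

import Mathlib

open scoped Classical

noncomputable section

/-- All prime divisors of `n` belong to the set of primes `σ`. -/
def IsPiNumber (σ : Set ℕ) (n : ℕ) : Prop :=
  ∀ q : ℕ, q.Prime → q ∣ n → q ∈ σ

/-- `g` is a `σ`-element: its order is a `σ`-number. -/
def IsPiElt (σ : Set ℕ) {G : Type} [Group G] (g : G) : Prop :=
  IsPiNumber σ (orderOf g)

/-- The `p`-part of a natural number. -/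
def pPart (p n : ℕ) : ℕ := p ^ (n.factorization p)

/-- `χ` is the character of a finite-dimensional complex representation of `G`. -/
def IsCharacter (G : Type) [Group G] (χ : G → ℂ) : Prop :=
  ∃ V : FDRep ℂ G, ∀ g, χ g = V.character g

/-- `χ` is an irreducible (ordinary, complex) character of `G`: a nonzero character
which is not the sum of two nonzero characters. -/
def IsIrrChar (G : Type) [Group G] (χ : G → ℂ) : Prop :=
  IsCharacter G χ ∧ χ ≠ 0 ∧
    ¬ ∃ χ₁ χ₂ : G → ℂ, IsCharacter G χ₁ ∧ χ₁ ≠ 0 ∧ IsCharacter G χ₂ ∧ χ₂ ≠ 0 ∧ χ = χ₁ + χ₂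

/-- Restriction of a class function on `G` to a subgroup `H`. -/
def resChar {G : Type} [Group G] (H : Subgroup G) (χ : G → ℂ) : ↥H → ℂ :=
  fun h => χ (h : G)

/-- Restriction of a class function between nested subgroups. -/
def resCharLe {G : Type} [Group G] {K H : Subgroup G} (hKH : K ≤ H) (χ : ↥H → ℂ) : ↥K → ℂ :=
  fun k => χ ⟨(k : G), hKH k.2⟩

/-- The induced class function from a subgroup `H` of `G`, given by the usual
induction formula. -/
def indChar {G : Type} [Group G] [Fintype G] (H : Subgroup G) (ψ : ↥H → ℂ) : G → ℂ :=
  fun g => (Nat.card ↥H : ℂ)⁻¹ *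
    ∑ x : G, if h : x * g * x⁻¹ ∈ H then ψ ⟨x * g * x⁻¹, h⟩ else 0

/-- Induction of a class function between nested subgroups. -/
def indCharLe {G : Type} [Group G] [Fintype G] {K H : Subgroup G} (_ : K ≤ H)
    (ψ : ↥K → ℂ) : ↥H → ℂ :=
  fun x => (Nat.card ↥K : ℂ)⁻¹ *
    ∑ y : ↥H, if h : (y : G) * (x : G) * (y : G)⁻¹ ∈ K then ψ ⟨(y : G) * (x : G) * (y : G)⁻¹, h⟩ else 0

/-- `θ` is an irreducible constituent of the class function `χ`. -/
def IsConstituent {G : Type} [Group G] (θ χ : G → ℂ) : Prop :=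
  IsIrrChar G θ ∧ ∃ ξ : G → ℂ, (ξ = 0 ∨ IsCharacter G ξ) ∧ χ = θ + ξ

/-- The restriction `χ^o` of a class function to the `σ`-elements of `G`
(extended by zero elsewhere). -/
def piRestrict (σ : Set ℕ) {G : Type} [Group G] (χ : G → ℂ) : G → ℂ :=
  fun g => if IsPiElt σ g then χ g else 0

/-- `φ` is a `σ`-partial character of `G`: the restriction to the `σ`-elements of an
ordinary character. -/
def IsPartialChar (σ : Set ℕ) (G : Type) [Group G] (φ : G → ℂ) : Prop :=
  ∃ χ : G → ℂ, IsCharacter G χ ∧ χ ≠ 0 ∧ φ = piRestrict σ χ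

/-- `φ ∈ I_σ(G)`: an irreducible `σ`-partial character, i.e. one which is not the
sum of two `σ`-partial characters. -/
def IsIPiChar (σ : Set ℕ) (G : Type) [Group G] (φ : G → ℂ) : Prop :=
  IsPartialChar σ G φ ∧
    ¬ ∃ φ₁ φ₂ : G → ℂ, IsPartialChar σ G φ₁ ∧ IsPartialChar σ G φ₂ ∧ φ = φ₁ + φ₂

/-- `φ ∈ IBr(G)` (at the prime `p`): irreducible Brauer characters are the irreducible
`p'`-partial characters, where the `p`-regular elements are the `{p}ᶜ`-elements. -/
def IsIBrChar (p : ℕ) (G : Type) [Group G] (φ : G → ℂ) : Prop :=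
  IsIPiChar ({p}ᶜ) G φ

/-- The restriction `χ^o` of `χ` to the `p`-regular elements of `G`. -/
def brRestrict (p : ℕ) {G : Type} [Group G] (χ : G → ℂ) : G → ℂ :=
  piRestrict ({p}ᶜ) χ

/-- `χ` is a lift of the `σ`-partial character `φ`. -/
def IsLiftOfPi (σ : Set ℕ) (G : Type) [Group G] (χ φ : G → ℂ) : Prop :=
  IsIrrChar G χ ∧ piRestrict σ χ = φ

/-- `χ` is a lift: `χ` is irreducible and `χ^o` is an irreducible `σ`-partial character. -/
def IsLiftPi (σ : Set ℕ) (G : Type) [Group G] (χ : G → ℂ) : Prop :=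
  IsIrrChar G χ ∧ IsIPiChar σ G (piRestrict σ χ)

/-- `H` is a subnormal subgroup of `G`. -/
def IsSubnormalSubgroup {G : Type} [Group G] (H : Subgroup G) : Prop :=
  ∃ (n : ℕ) (c : Fin (n + 1) → Subgroup G),
    c 0 = H ∧ c (Fin.last n) = ⊤ ∧
    ∀ i : Fin n, c i.castSucc ≤ c i.succ ∧ ((c i.castSucc).subgroupOf (c i.succ)).Normal

/-- The determinantal order `o(det θ)` of `θ` is a `σ`-number. -/
def HasPiDetOrder (σ : Set ℕ) (G : Type) [Group G] (θ : G → ℂ) : Prop :=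
  ∃ V : FDRep ℂ G, (∀ g, θ g = V.character g) ∧
    IsPiNumber σ (orderOf (fun g : G => LinearMap.det (V.ρ g)))

/-- `χ` is a `σ`-special character of `G`: `χ` is irreducible, `χ(1)` is a `σ`-number,
and for every subnormal subgroup `M` of `G`, every irreducible constituent of `χ_M`
has determinantal order a `σ`-number. -/
def IsPiSpecial (σ : Set ℕ) (G : Type) [Group G] (χ : G → ℂ) : Prop :=
  IsIrrChar G χ ∧ (∃ n : ℕ, χ 1 = (n : ℂ) ∧ IsPiNumber σ n) ∧
    ∀ M : Subgroup G, IsSubnormalSubgroup M →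
      ∀ θ : ↥M → ℂ, IsConstituent θ (resChar M χ) → HasPiDetOrder σ ↥M θ

/-- `χ` is `σ`-factored: `χ = αβ` with `α` `σ`-special and `β` `σ'`-special. -/
def IsPiFactored (σ : Set ℕ) (G : Type) [Group G] (χ : G → ℂ) : Prop :=
  ∃ α β : G → ℂ, IsPiSpecial σ G α ∧ IsPiSpecial σᶜ G β ∧ χ = α * β

/-- `G` is `σ`-separable: it has a subnormal series each of whose factors is a
`σ`-group or a `σ'`-group (equivalently, every composition factor is a `σ`-group or a
`σ'`-group). -/
def IsPiSeparable (σ : Set ℕ) (G : Type) [Group G] : Prop :=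
  ∃ (n : ℕ) (c : Fin (n + 1) → Subgroup G),
    c 0 = ⊥ ∧ c (Fin.last n) = ⊤ ∧
    ∀ i : Fin n, c i.castSucc ≤ c i.succ ∧ ((c i.castSucc).subgroupOf (c i.succ)).Normal ∧
      (IsPiNumber σ (Nat.card (↥(c i.succ) ⧸ (c i.castSucc).subgroupOf (c i.succ))) ∨
        IsPiNumber σᶜ (Nat.card (↥(c i.succ) ⧸ (c i.castSucc).subgroupOf (c i.succ))))

/-- `G` is `p`-solvable: every composition factor is a `p`-group or a `p'`-group. -/
def IsPSolvable (p : ℕ) (G : Type) [Group G] : Prop :=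
  IsPiSeparable {p} G

/-- The character `δ` of the subgroup `Q` is invariant under (conjugation by the
elements of) the subgroup `S`. -/
def InvariantUnder {G : Type} [Group G] (Q : Subgroup G) (δ : ↥Q → ℂ) (S : Subgroup G) : Prop :=
  ∀ g ∈ S, ∀ x : ↥Q, ∀ h : g * (x : G) * g⁻¹ ∈ Q, δ ⟨g * (x : G) * g⁻¹, h⟩ = δ x

/-- `(Q, δ)` is a vertex pair for `χ ∈ Irr(G)` (at the prime `p`): `Q` is a `p`-subgroup
of `G`, `δ ∈ Irr(Q)`, and there are a subgroup `U ≤ G` and an irreducible character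
`ψ = αβ` of `U` with `α` `p'`-special and `β` `p`-special, such that `ψ^G = χ`, `Q` is a
Sylow `p`-subgroup of `U`, and `β_Q = δ`. -/
def IsVertexPair (p : ℕ) {G : Type} [Group G] [Fintype G] (χ : G → ℂ)
    (Q : Subgroup G) (δ : ↥Q → ℂ) : Prop :=
  IsPGroup p ↥Q ∧ IsIrrChar ↥Q δ ∧
    ∃ (U : Subgroup G) (hQU : Q ≤ U) (α β : ↥U → ℂ),
      IsPiSpecial ({p}ᶜ) ↥U α ∧ IsPiSpecial {p} ↥U β ∧
      IsIrrChar ↥U (α * β) ∧ indChar U (α * β) = χ ∧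
      ¬ p ∣ (Q.subgroupOf U).index ∧
      ∀ x : ↥Q, δ x = β ⟨(x : G), hQU x.2⟩

/-- `(Q, δ)` is a generalized `σ`-vertex for `χ ∈ Irr(G)`: there are `U ≤ G` and an
irreducible `ψ = αβ ∈ Irr(U)` with `α` `σ`-special and `β` `σ'`-special such that
`ψ^G = χ`, `Q` is a Hall `σ'`-subgroup of `U` and `δ = β_Q`. -/
def IsGenPiVertex (σ : Set ℕ) {G : Type} [Group G] [Fintype G] (χ : G → ℂ)
    (Q : Subgroup G) (δ : ↥Q → ℂ) : Prop :=
  ∃ (U : Subgroup G) (hQU : Q ≤ U) (α β : ↥U → ℂ),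
    IsPiSpecial σ ↥U α ∧ IsPiSpecial σᶜ ↥U β ∧
    IsIrrChar ↥U (α * β) ∧ indChar U (α * β) = χ ∧
    IsPiNumber σᶜ (Nat.card ↥Q) ∧ IsPiNumber σ ((Q.subgroupOf U).index) ∧
    ∀ x : ↥Q, δ x = β ⟨(x : G), hQU x.2⟩

/-- The pair `(Q₂, δ₂)` is the conjugate of the pair `(Q₁, δ₁)` by the element `g`. -/
def IsConjPair {G : Type} [Group G] (g : G)
    (Q₁ : Subgroup G) (δ₁ : ↥Q₁ → ℂ) (Q₂ : Subgroup G) (δ₂ : ↥Q₂ → ℂ) : Prop :=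
  Q₂ = Subgroup.map (MulAut.conj g).toMonoidHom Q₁ ∧
    ∀ x : ↥Q₁, ∀ h : g * (x : G) * g⁻¹ ∈ Q₂, δ₂ ⟨g * (x : G) * g⁻¹, h⟩ = δ₁ x

/-- `Q` is a vertex (subgroup) of the irreducible `σ`-partial character `φ` of `G`:
`Q` is a Hall `σ'`-subgroup of a subgroup `U ≤ G` possessing an irreducible `σ`-partial
character `κ` of `σ`-degree with `κ^G = φ`. -/
def IsVertexSubgroup (σ : Set ℕ) {G : Type} [Group G] [Fintype G] (φ : G → ℂ)
    (Q : Subgroup G) : Prop :=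
  ∃ (U : Subgroup G) (κ : ↥U → ℂ), Q ≤ U ∧
    IsPiNumber σᶜ (Nat.card ↥Q) ∧ IsPiNumber σ ((Q.subgroupOf U).index) ∧
    IsIPiChar σ ↥U κ ∧ (∃ n : ℕ, κ 1 = (n : ℂ) ∧ IsPiNumber σ n) ∧
    indChar U κ = φ

/-- `θ ∈ I_σ(M)` is an irreducible constituent of the restriction `φ_M`. -/
def IsIPiConstituent (σ : Set ℕ) {G : Type} [Group G] (M : Subgroup G)
    (θ : ↥M → ℂ) (φ : G → ℂ) : Prop :=
  IsIPiChar σ ↥M θ ∧ ∃ ξ : ↥M → ℂ, (ξ = 0 ∨ IsPartialChar σ ↥M ξ) ∧ resChar M φ = θ + ξ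

set_option linter.unusedSectionVars false

/-- The average of a function on a finite type. -/
def avg {α : Type*} {E : Type*} [AddCommGroup E] [Module ℂ E] (f : α → E) : E :=
  (Nat.card α : ℂ)⁻¹ • ∑ᶠ a, f a

section Avg

variable {α β : Type*} [Finite α] [Finite β] {E F : Type*} [AddCommGroup E] [Module ℂ E]
  [AddCommGroup F] [Module ℂ F]

theorem avg_eq_sum {α E : Type*} [Fintype α] [AddCommGroup E] [Module ℂ E] (f : α → E) :
    avg f = (Fintype.card α : ℂ)⁻¹ • ∑ a, f a := by
  rw [avg, finsum_eq_sum_of_fintype, Nat.card_eq_fintype_card]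

theorem avg_comp_equiv {α β E : Type*} [AddCommGroup E] [Module ℂ E] (e : α ≃ β) (f : β → E) :
    avg (fun a => f (e a)) = avg f := by
  rw [avg, avg, Nat.card_congr e, finsum_comp_equiv e]

theorem avg_add (f g : α → E) : avg (fun a => f a + g a) = avg f + avg g := by
  have := Fintype.ofFinite α
  simp only [avg_eq_sum, Finset.sum_add_distrib, smul_add]

theorem map_avg (L : E →ₗ[ℂ] F) (f : α → E) : L (avg f) = avg (fun a => L (f a)) := by
  have := Fintype.ofFinite α
  simp only [avg_eq_sum, map_smul, map_sum]

theorem avg_smul (c : ℂ) (f : α → E) : avg (fun a => c • f a) = c • avg f :=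
  (map_avg (c • LinearMap.id) f).symm

theorem avg_mul_left (c : ℂ) (f : α → ℂ) : avg (fun a => c * f a) = c * avg f :=
  avg_smul c f

theorem avg_mul_right (c : ℂ) (f : α → ℂ) : avg (fun a => f a * c) = avg f * c := by
  simp only [mul_comm _ c, avg_mul_left]

theorem avg_sub (f g : α → E) : avg (fun a => f a - g a) = avg f - avg g := by
  have := Fintype.ofFinite α
  simp only [avg_eq_sum, Finset.sum_sub_distrib, smul_sub]

theorem avg_sum {ι : Type*} (s : Finset ι) (f : ι → α → E) :
    avg (fun a => ∑ i ∈ s, f i a) = ∑ i ∈ s, avg (f i) := by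
  have := Fintype.ofFinite α
  simp only [avg_eq_sum, ← Finset.smul_sum]
  rw [Finset.sum_comm]

theorem card_ne_zero_complex (α : Type*) [Finite α] [Nonempty α] : (Nat.card α : ℂ) ≠ 0 :=
  Nat.cast_ne_zero.2 Nat.card_pos.ne'

theorem avg_const [Nonempty α] (c : E) : avg (fun _ : α => c) = c := by
  have := Fintype.ofFinite α
  have h : (Fintype.card α : ℂ) ≠ 0 := Nat.cast_ne_zero.2 Fintype.card_ne_zero
  rw [avg_eq_sum, Finset.sum_const, Finset.card_univ, ← Nat.cast_smul_eq_nsmul ℂ, smul_smul,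
    inv_mul_cancel₀ h, one_smul]

theorem avg_comm (f : α → β → E) : avg (fun a => avg (fun b => f a b)) =
    avg (fun b => avg (fun a => f a b)) := by
  have := Fintype.ofFinite α
  have := Fintype.ofFinite β
  simp only [avg_eq_sum, ← Finset.smul_sum]
  rw [Finset.sum_comm, smul_comm]

theorem avg_prod (f : α × β → E) : avg f = avg (fun a => avg (fun b => f (a, b))) := by
  have := Fintype.ofFinite α
  have := Fintype.ofFinite β
  simp only [avg_eq_sum, ← Finset.smul_sum, smul_smul, Fintype.card_prod]
  rw [Fintype.sum_prod_type]
  push_cast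
  rw [mul_inv]

theorem avg_comp_of_card_fiber (q : α → β) (m : ℕ) (hm : m ≠ 0)
    (h : ∀ b, Nat.card {a // q a = b} = m) (f : β → E) : avg (fun a => f (q a)) = avg f := by
  have := Fintype.ofFinite α
  have := Fintype.ofFinite β
  have e := Equiv.sigmaFiberEquiv q
  have hc : Fintype.card α = Fintype.card β * m := by
    rw [← Fintype.card_congr (Equiv.sigmaFiberEquiv q), Fintype.card_sigma]
    simp [← Nat.card_eq_fintype_card, h]
  have hs : ∑ a, f (q a) = (m : ℂ) • ∑ b, f b := by
    rw [← (Equiv.sigmaFiberEquiv q).sum_comp, Fintype.sum_sigma, Finset.smul_sum]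
    refine Finset.sum_congr rfl fun b _ => ?_
    rw [Finset.sum_congr rfl (g := fun _ => f b) fun a _ => by
      rw [Equiv.sigmaFiberEquiv_apply, a.2], Finset.sum_const,
      Finset.card_univ, ← Nat.card_eq_fintype_card, h, Nat.cast_smul_eq_nsmul]
  have hm' : (m : ℂ) ≠ 0 := Nat.cast_ne_zero.2 hm
  rw [avg_eq_sum, avg_eq_sum, hs, smul_smul, hc]
  congr 1
  push_cast
  rw [mul_inv, mul_assoc, inv_mul_cancel₀ hm', mul_one]

theorem avg_comp_surjective {A B : Type*} [Group A] [Group B] [Finite A] [Finite B] (q : A →* B)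
    (hq : Function.Surjective q) (f : B → E) : avg (fun a => f (q a)) = avg f := by
  refine avg_comp_of_card_fiber q (Nat.card q.ker) Nat.card_pos.ne' (fun b => ?_) f
  obtain ⟨a, rfl⟩ := hq b
  refine Nat.card_congr ⟨fun x => ⟨a⁻¹ * x, by simp [MonoidHom.mem_ker, x.2]⟩,
    fun k => ⟨a * k, by simp [(MonoidHom.mem_ker).1 k.2]⟩, fun x => by simp, fun k => by simp⟩

theorem avg_mul_left_group {A : Type*} [Group A] (x : A) (f : A → E) :
    avg (fun a => f (x * a)) = avg f := avg_comp_equiv (Equiv.mulLeft x) f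

theorem avg_mul_right_group {A : Type*} [Group A] (x : A) (f : A → E) :
    avg (fun a => f (a * x)) = avg f := avg_comp_equiv (Equiv.mulRight x) f

theorem avg_inv_group {A : Type*} [Group A] (f : A → E) :
    avg (fun a => f a⁻¹) = avg f := avg_comp_equiv (Equiv.inv A) f

theorem avg_conj_group {A : Type*} [Group A] (x : A) (f : A → E) :
    avg (fun a => f (x * a * x⁻¹)) = avg f := avg_comp_equiv (MulAut.conj x).toEquiv f

end Avg

section CharacterBasics

variable {G : Type} [Group G]

theorem isCharacter_character {V : Type} [AddCommGroup V] [Module ℂ V] [FiniteDimensional ℂ V]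
    (ρ : Representation ℂ G V) : IsCharacter G ρ.character :=
  ⟨FDRep.of ρ, fun _ => rfl⟩

/-- Transport of a representation along a linear equivalence. -/
def conjRep {V W : Type*} [AddCommGroup V] [Module ℂ V] [AddCommGroup W] [Module ℂ W]
    (e : V ≃ₗ[ℂ] W) (ρ : Representation ℂ G V) : Representation ℂ G W :=
  (e.conjRingEquiv : Module.End ℂ V →* Module.End ℂ W).comp ρ

theorem conjRep_apply {V W : Type*} [AddCommGroup V] [Module ℂ V] [AddCommGroup W] [Module ℂ W]
    (e : V ≃ₗ[ℂ] W) (ρ : Representation ℂ G V) (g : G) : conjRep e ρ g = e.conj (ρ g) := rfl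

theorem IsCharacter.exists_rep {χ : G → ℂ} (h : IsCharacter G χ) :
    ∃ (d : ℕ) (ρ : Representation ℂ G (Fin d → ℂ)), χ = ρ.character := by
  obtain ⟨V, hV⟩ := h
  refine ⟨_, conjRep (Module.finBasis ℂ V).equivFun V.ρ, funext fun g => ?_⟩
  rw [hV, Representation.character, conjRep_apply, LinearMap.trace_conj']
  rfl

theorem isCharacter_zero : IsCharacter G 0 := by
  have := isCharacter_character (1 : Representation ℂ G (Fin 0 → ℂ))
  convert this using 1
  ext g
  simp [Representation.character, Subsingleton.elim (1 : (Fin 0 → ℂ) →ₗ[ℂ] (Fin 0 → ℂ)) 0]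

theorem isCharacter_one : IsCharacter G 1 := by
  have := isCharacter_character (1 : Representation ℂ G ℂ)
  convert this using 1
  ext g
  simp [Representation.character]

theorem IsCharacter.add {χ ψ : G → ℂ} (hχ : IsCharacter G χ) (hψ : IsCharacter G ψ) :
    IsCharacter G (χ + ψ) := by
  obtain ⟨d, ρ, rfl⟩ := hχ.exists_rep
  obtain ⟨e, σ, rfl⟩ := hψ.exists_rep
  have := isCharacter_character (ρ.prod σ)
  convert this using 1
  ext g
  exact (LinearMap.trace_prodMap' (ρ g) (σ g)).symm

theorem IsCharacter.mul {χ ψ : G → ℂ} (hχ : IsCharacter G χ) (hψ : IsCharacter G ψ) :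
    IsCharacter G (χ * ψ) := by
  obtain ⟨d, ρ, rfl⟩ := hχ.exists_rep
  obtain ⟨e, σ, rfl⟩ := hψ.exists_rep
  rw [← Representation.char_tensor]
  exact isCharacter_character _

theorem IsCharacter.dual {χ : G → ℂ} (hχ : IsCharacter G χ) :
    IsCharacter G (fun g => χ g⁻¹) := by
  obtain ⟨d, ρ, rfl⟩ := hχ.exists_rep
  convert isCharacter_character ρ.dual using 1
  ext g
  rw [Representation.char_dual]

theorem IsCharacter.comp {H : Type} [Group H] {χ : G → ℂ} (hχ : IsCharacter G χ) (f : H →* G) :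
    IsCharacter H (fun h => χ (f h)) := by
  obtain ⟨d, ρ, rfl⟩ := hχ.exists_rep
  exact isCharacter_character (MonoidHom.comp ρ f : Representation ℂ H _)

theorem IsCharacter.sum {ι : Type*} (s : Finset ι) {f : ι → G → ℂ}
    (h : ∀ i ∈ s, IsCharacter G (f i)) : IsCharacter G (∑ i ∈ s, f i) := by
  induction s using Finset.induction_on with
  | empty => simpa using isCharacter_zero
  | insert a s ha ih =>
    rw [Finset.sum_insert ha]
    exact (h a (Finset.mem_insert_self a s)).add
      (ih fun i hi => h i (Finset.mem_insert_of_mem hi))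

theorem IsCharacter.nsmul {χ : G → ℂ} (hχ : IsCharacter G χ) (n : ℕ) :
    IsCharacter G ((n : ℂ) • χ) := by
  have := IsCharacter.sum (Finset.range n) (f := fun _ => χ) fun _ _ => hχ
  rwa [Finset.sum_const, Finset.card_range, ← Nat.cast_smul_eq_nsmul ℂ] at this

theorem IsCharacter.conj {χ : G → ℂ} (hχ : IsCharacter G χ) (g h : G) :
    χ (h * g * h⁻¹) = χ g := by
  obtain ⟨d, ρ, rfl⟩ := hχ.exists_rep
  exact ρ.char_conj g h

theorem IsCharacter.exists_degree {χ : G → ℂ} (hχ : IsCharacter G χ) : ∃ n : ℕ, χ 1 = n := by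
  obtain ⟨d, ρ, rfl⟩ := hχ.exists_rep
  exact ⟨_, ρ.char_one⟩

theorem IsCharacter.eq_zero_of_degree {χ : G → ℂ} (hχ : IsCharacter G χ) (h : χ 1 = 0) :
    χ = 0 := by
  obtain ⟨d, ρ, rfl⟩ := hχ.exists_rep
  rw [ρ.char_one, Nat.cast_eq_zero, Module.finrank_zero_iff] at h
  ext g
  simp [Representation.character, Subsingleton.elim (ρ g) 0]

end CharacterBasics

section InnerProduct

variable {G : Type} [Group G] [Finite G]

/-- The inner product of two complex-valued functions on a finite group. -/
def ip (χ ψ : G → ℂ) : ℂ := avg fun g => χ g * ψ g⁻¹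

theorem ip_character {V W : Type*} [AddCommGroup V] [Module ℂ V] [FiniteDimensional ℂ V]
    [AddCommGroup W] [Module ℂ W] [FiniteDimensional ℂ W]
    (ρ : Representation ℂ G V) (σ : Representation ℂ G W) :
    ip σ.character ρ.character = Module.finrank ℂ (Representation.IntertwiningMap ρ σ) := by
  have := Fintype.ofFinite G
  have : Invertible (Nat.card G : ℂ) := invertibleOfNonzero (card_ne_zero_complex G)
  rw [← Representation.card_inv_mul_sum_char_mul_char_eq_finrank, ip, avg_eq_sum,
    Nat.card_eq_fintype_card, smul_eq_mul]

theorem IsCharacter.ip_nat {χ ψ : G → ℂ} (hχ : IsCharacter G χ) (hψ : IsCharacter G ψ) :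
    ∃ n : ℕ, ip χ ψ = n := by
  obtain ⟨d, ρ, rfl⟩ := hχ.exists_rep
  obtain ⟨e, σ, rfl⟩ := hψ.exists_rep
  exact ⟨_, ip_character σ ρ⟩

theorem ip_add_left (χ ψ η : G → ℂ) : ip (χ + ψ) η = ip χ η + ip ψ η := by
  simp only [ip, Pi.add_apply, add_mul, avg_add]

theorem ip_add_right (χ ψ η : G → ℂ) : ip η (χ + ψ) = ip η χ + ip η ψ := by
  simp only [ip, Pi.add_apply, mul_add, avg_add]

theorem ip_sub_left (χ ψ η : G → ℂ) : ip (χ - ψ) η = ip χ η - ip ψ η := by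
  simp only [ip, Pi.sub_apply, sub_mul, avg_sub]

theorem ip_smul_left (c : ℂ) (χ η : G → ℂ) : ip (c • χ) η = c * ip χ η := by
  simp only [ip, Pi.smul_apply, smul_eq_mul, mul_assoc, avg_mul_left]

theorem ip_sum_left {ι : Type*} (s : Finset ι) (f : ι → G → ℂ) (η : G → ℂ) :
    ip (∑ i ∈ s, f i) η = ∑ i ∈ s, ip (f i) η := by
  simp only [ip, Finset.sum_apply, Finset.sum_mul, avg_sum]

theorem ip_comm (χ ψ : G → ℂ) : ip χ ψ = ip ψ χ := by
  rw [ip, ← avg_inv_group]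
  simp only [inv_inv, mul_comm, ip]

theorem IsCharacter.ip_self_pos {χ : G → ℂ} (hχ : IsCharacter G χ) (h0 : χ ≠ 0) :
    ∃ n : ℕ, 0 < n ∧ ip χ χ = n := by
  obtain ⟨d, ρ, rfl⟩ := hχ.exists_rep
  refine ⟨_, ?_, ip_character ρ ρ⟩
  rw [Nat.pos_iff_ne_zero]
  intro h
  apply h0
  have : FiniteDimensional ℂ (Representation.IntertwiningMap ρ ρ) :=
    Module.Finite.of_injective
      (⟨⟨fun f => f.toLinearMap, fun _ _ => rfl⟩, fun _ _ => rfl⟩ :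
        Representation.IntertwiningMap ρ ρ →ₗ[ℂ] _)
      (Representation.IntertwiningMap.toLinearMap_injective ρ ρ)
  have := Module.finrank_zero_iff.1 h
  have h1 : Representation.IntertwiningMap.id ρ = 0 := Subsingleton.elim _ _
  have h2 : (1 : (Fin d → ℂ) →ₗ[ℂ] (Fin d → ℂ)) = 0 := congrArg (·.toLinearMap) h1
  ext g
  rw [Representation.character, ← mul_one (ρ g), h2]
  simp

section
variable {V : Type} [AddCommGroup V] [Module ℂ V] [FiniteDimensional ℂ V]

theorem character_eq_of_isCompl (ρ : Representation ℂ G V) (A B : Subrepresentation ρ)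
    (h : IsCompl A B) :
    ρ.character = A.toRepresentation.character + B.toRepresentation.character := by
  have h' : IsCompl A.toSubmodule B.toSubmodule := by
    rw [isCompl_iff, disjoint_iff, codisjoint_iff] at h ⊢
    exact ⟨congrArg Subrepresentation.toSubmodule h.1, congrArg Subrepresentation.toSubmodule h.2⟩
  ext g
  have h1 := (Submodule.prodEquivOfIsCompl _ _ h')
  rw [Pi.add_apply, Representation.character, Representation.character, Representation.character,
    ← LinearMap.trace_prodMap', ← LinearMap.trace_conj' _ (Submodule.prodEquivOfIsCompl _ _ h')]
  congr 1
  ext v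
  obtain ⟨w, rfl⟩ := (Submodule.prodEquivOfIsCompl _ _ h').surjective v
  simp [Subrepresentation.toRepresentation, LinearEquiv.conj_apply]

theorem exists_isCompl_of_not_irreducible [Nontrivial V] (ρ : Representation ℂ G V)
    (h : ¬ ρ.IsIrreducible) : ∃ A B : Subrepresentation ρ, IsCompl A B ∧ A.toSubmodule ≠ ⊥ ∧
      B.toSubmodule ≠ ⊥ := by
  have hnt : Nontrivial (Subrepresentation ρ) := ⟨⊥, ⊤, fun h => by
    have : (⊥ : Submodule ℂ V) = ⊤ := congrArg Subrepresentation.toSubmodule h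
    exact bot_ne_top this⟩
  have : ∃ A : Subrepresentation ρ, A ≠ ⊥ ∧ A ≠ ⊤ := by
    by_contra! hc
    exact h ⟨fun A => or_iff_not_imp_left.2 (hc A)⟩
  obtain ⟨A, hA, hA'⟩ := this
  have : NeZero (Nat.card G : ℂ) := ⟨card_ne_zero_complex G⟩
  obtain ⟨B, hB⟩ := exists_isCompl A
  refine ⟨A, B, hB, fun h => hA (Subrepresentation.toSubmodule_injective h), fun h => hA' ?_⟩
  have hB0 : B = ⊥ := Subrepresentation.toSubmodule_injective h
  have := hB.sup_eq_top
  rwa [hB0, sup_bot_eq] at this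

theorem character_ne_zero [Nontrivial V] (ρ : Representation ℂ G V) : ρ.character ≠ 0 := by
  intro h
  have := congrFun h 1
  rw [ρ.char_one, Pi.zero_apply, Nat.cast_eq_zero] at this
  exact Module.finrank_pos.ne' this

theorem nontrivial_of_character_ne_zero (ρ : Representation ℂ G V) (h : ρ.character ≠ 0) :
    Nontrivial V := by
  by_contra hn
  rw [not_nontrivial_iff_subsingleton] at hn
  apply h
  ext g
  simp [Representation.character, Subsingleton.elim (ρ g) 0]

theorem IsIrrChar.isIrreducible {ρ : Representation ℂ G V} (h : IsIrrChar G ρ.character) :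
    ρ.IsIrreducible := by
  have := nontrivial_of_character_ne_zero ρ h.2.1
  by_contra hi
  obtain ⟨A, B, hAB, hA, hB⟩ := exists_isCompl_of_not_irreducible ρ hi
  have := Submodule.nontrivial_iff_ne_bot.2 hA
  have := Submodule.nontrivial_iff_ne_bot.2 hB
  exact h.2.2 ⟨_, _, isCharacter_character _, character_ne_zero A.toRepresentation,
    isCharacter_character _, character_ne_zero B.toRepresentation,
    character_eq_of_isCompl ρ A B hAB⟩

end

theorem IsIrrChar.ip_self {χ : G → ℂ} (h : IsIrrChar G χ) : ip χ χ = 1 := by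
  obtain ⟨d, ρ, rfl⟩ := h.1.exists_rep
  have := h.isIrreducible
  rw [ip_character, Representation.IsIrreducible.finrank_intertwiningMap_self, Nat.cast_one]

theorem isIrrChar_of_ip_self {χ : G → ℂ} (h : IsCharacter G χ) (h1 : ip χ χ = 1) :
    IsIrrChar G χ := by
  refine ⟨h, ?_, ?_⟩
  · rintro rfl
    simp [ip, avg_const] at h1
  · rintro ⟨χ₁, χ₂, hχ₁, h₁, hχ₂, h₂, rfl⟩
    obtain ⟨a, ha, ha'⟩ := hχ₁.ip_self_pos h₁
    obtain ⟨b, hb, hb'⟩ := hχ₂.ip_self_pos h₂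
    obtain ⟨c, hc⟩ := hχ₁.ip_nat hχ₂
    rw [ip_add_left, ip_add_right, ip_add_right, ha', hb', ip_comm χ₂, hc] at h1
    norm_cast at h1
    omega

theorem IsIrrChar.ip_ne {χ ψ : G → ℂ} (hχ : IsIrrChar G χ) (hψ : IsIrrChar G ψ) (h : χ ≠ ψ) :
    ip χ ψ = 0 := by
  obtain ⟨d, ρ, rfl⟩ := hχ.1.exists_rep
  obtain ⟨e, σ, rfl⟩ := hψ.1.exists_rep
  have := hχ.isIrreducible
  have := hψ.isIrreducible
  have := Fintype.ofFinite G
  have : Invertible (Nat.card G : ℂ) := invertibleOfNonzero (card_ne_zero_complex G)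
  have key := Representation.char_orthonormal ρ σ
  rw [if_neg fun ⟨f⟩ => h (Representation.char_iso f).symm] at key
  rw [ip, avg_eq_sum, ← Nat.card_eq_fintype_card, smul_eq_mul, key]

theorem IsCharacter.exists_sum_irr {χ : G → ℂ} (h : IsCharacter G χ) :
    ∃ s : Multiset (G → ℂ), (∀ ψ ∈ s, IsIrrChar G ψ) ∧ χ = s.sum := by
  obtain ⟨n, hn⟩ := h.exists_degree
  induction n using Nat.strong_induction_on generalizing χ with
  | _ n ih =>
    by_cases h0 : χ = 0
    · exact ⟨0, by simp, by simpa using h0⟩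
    by_cases hirr : IsIrrChar G χ
    · exact ⟨{χ}, by simpa using hirr, by simp⟩
    · have : ∃ χ₁ χ₂ : G → ℂ, IsCharacter G χ₁ ∧ χ₁ ≠ 0 ∧ IsCharacter G χ₂ ∧ χ₂ ≠ 0 ∧
          χ = χ₁ + χ₂ := by
        by_contra hc
        exact hirr ⟨h, h0, hc⟩
      obtain ⟨χ₁, χ₂, h1, h1', h2, h2', rfl⟩ := this
      obtain ⟨a, ha⟩ := h1.exists_degree
      obtain ⟨b, hb⟩ := h2.exists_degree
      have ha0 : a ≠ 0 := fun h => h1' (h1.eq_zero_of_degree (by rw [ha, h, Nat.cast_zero]))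
      have hb0 : b ≠ 0 := fun h => h2' (h2.eq_zero_of_degree (by rw [hb, h, Nat.cast_zero]))
      have hab : a + b = n := by
        rw [Pi.add_apply, ha, hb] at hn
        exact_mod_cast hn
      obtain ⟨s, hs, rfl⟩ := ih a (by omega) h1 ha
      obtain ⟨t, ht, rfl⟩ := ih b (by omega) h2 hb
      refine ⟨s + t, fun ψ hψ => ?_, by simp⟩
      rcases Multiset.mem_add.1 hψ with h | h
      exacts [hs _ h, ht _ h]

variable (G) in
/-- The set of irreducible characters. -/
def Irr : Set (G → ℂ) := {χ | IsIrrChar G χ}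

theorem irr_finite : (Irr G).Finite := by
  have : LinearIndependent ℂ (fun χ : Irr G => (χ : G → ℂ)) := by
    rw [linearIndependent_iff']
    intro s c hs i hi
    have := congrArg (fun f => ip f i.1) hs
    simp only [ip_sum_left, ip_smul_left] at this
    rw [Finset.sum_eq_single i] at this
    · rw [IsIrrChar.ip_self i.2, mul_one] at this
      rw [this]
      simp [ip, avg_const]
    · intro j _ hj
      rw [IsIrrChar.ip_ne j.2 i.2 fun h => hj (Subtype.ext h), mul_zero]
    · exact fun h => absurd hi h
  have := this.finite
  exact Set.toFinite _

variable (G) in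
/-- The finset of irreducible characters. -/
def irrFinset : Finset (G → ℂ) := (irr_finite (G := G)).toFinset

@[simp] theorem mem_irrFinset {χ : G → ℂ} : χ ∈ irrFinset G ↔ IsIrrChar G χ := by
  simp [irrFinset, Irr]

/-- A function that is constant on conjugacy classes. -/
def IsClassFun (f : G → ℂ) : Prop := ∀ g h : G, f (h * g * h⁻¹) = f g

theorem IsCharacter.isClassFun {χ : G → ℂ} (h : IsCharacter G χ) : IsClassFun χ :=
  fun g k => h.conj g k

end InnerProduct

theorem rep_mul_inv {G V : Type*} [Group G] [AddCommGroup V] [Module ℂ V]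
    (ρ : Representation ℂ G V) (g : G) : ρ g * ρ g⁻¹ = 1 := by
  rw [← map_mul, mul_inv_cancel, map_one]

theorem rep_inv_mul {G V : Type*} [Group G] [AddCommGroup V] [Module ℂ V]
    (ρ : Representation ℂ G V) (g : G) : ρ g⁻¹ * ρ g = 1 := by
  rw [← map_mul, inv_mul_cancel, map_one]

section Schur

variable {G : Type} [Group G] [Finite G]
variable {V : Type} [AddCommGroup V] [Module ℂ V] [FiniteDimensional ℂ V]

theorem schur_scalar {ρ : Representation ℂ G V} (h : ρ.IsIrreducible) (A : V →ₗ[ℂ] V)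
    (hA : ∀ g, A * ρ g = ρ g * A) : ∃ c : ℂ, A = c • 1 := by
  let f : Representation.IntertwiningMap ρ ρ := ⟨A, fun g => LinearMap.ext fun v => by
    simpa using LinearMap.congr_fun (hA g) v⟩
  obtain ⟨c, hc⟩ :=
    (Representation.IsIrreducible.algebraMap_intertwiningMap_bijective_of_isAlgClosed
      (k := ℂ) (ρ := ρ)).2 f
  refine ⟨c, ?_⟩
  have := congrArg (·.toLinearMap) hc
  change _ = A at this
  rw [← this, Algebra.algebraMap_eq_smul_one]
  rfl

theorem finrank_ne_zero_of_isIrreducible {ρ : Representation ℂ G V} (h : ρ.IsIrreducible) :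
    (Module.finrank ℂ V : ℂ) ≠ 0 := by
  intro h0
  rw [Nat.cast_eq_zero, Module.finrank_zero_iff] at h0
  have : (⊥ : Subrepresentation ρ) = ⊤ :=
    Subrepresentation.toSubmodule_injective (Subsingleton.elim _ _)
  exact bot_ne_top this

theorem avg_mul_left_end {α : Type*} [Finite α] (A : V →ₗ[ℂ] V) (f : α → V →ₗ[ℂ] V) :
    A * avg f = avg fun a => A * f a :=
  map_avg (LinearMap.mulLeft ℂ A) f

theorem avg_mul_right_end {α : Type*} [Finite α] (A : V →ₗ[ℂ] V) (f : α → V →ₗ[ℂ] V) :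
    avg f * A = avg fun a => f a * A :=
  map_avg (LinearMap.mulRight ℂ A) f

theorem trace_avg {α : Type*} [Finite α] (f : α → V →ₗ[ℂ] V) :
    LinearMap.trace ℂ V (avg f) = avg fun a => LinearMap.trace ℂ V (f a) :=
  map_avg (LinearMap.trace ℂ V) f

theorem avg_conj_rep {ρ : Representation ℂ G V} (h : ρ.IsIrreducible) (A : V →ₗ[ℂ] V) :
    avg (fun g => ρ g * A * ρ g⁻¹) = (LinearMap.trace ℂ V A / Module.finrank ℂ V) • 1 := by
  obtain ⟨c, hc⟩ := schur_scalar h (avg (fun g => ρ g * A * ρ g⁻¹)) fun x => by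
    rw [avg_mul_left_end, avg_mul_right_end, ← avg_mul_left_group x]
    congr 1
    ext1 g
    rw [map_mul, mul_inv_rev, map_mul, mul_assoc, mul_assoc (ρ g⁻¹), rep_inv_mul, mul_one]
    simp only [mul_assoc]
  have := congrArg (LinearMap.trace ℂ V) hc
  rw [trace_avg, map_smul, LinearMap.trace_one, smul_eq_mul] at this
  have h2 : ∀ g, LinearMap.trace ℂ V (ρ g * A * ρ g⁻¹) = LinearMap.trace ℂ V A := fun g => by
    rw [LinearMap.trace_mul_comm, ← mul_assoc, rep_inv_mul, one_mul]
  simp only [h2, avg_const] at this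
  rw [hc, this, mul_div_assoc, div_self (finrank_ne_zero_of_isIrreducible h), mul_one]

theorem avg_trace_conj {ρ : Representation ℂ G V} (h : ρ.IsIrreducible) (A B : V →ₗ[ℂ] V) :
    avg (fun g => LinearMap.trace ℂ V (ρ g * A * ρ g⁻¹ * B)) =
      LinearMap.trace ℂ V A * LinearMap.trace ℂ V B / Module.finrank ℂ V := by
  rw [← trace_avg, ← avg_mul_right_end, avg_conj_rep h, smul_mul_assoc, one_mul, map_smul,
    smul_eq_mul]
  ring

theorem avg_trace_mul_trace {ρ : Representation ℂ G V} (h : ρ.IsIrreducible) (A B : V →ₗ[ℂ] V) :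
    avg (fun g => LinearMap.trace ℂ V (ρ g * A) * LinearMap.trace ℂ V (ρ g⁻¹ * B)) =
      LinearMap.trace ℂ V (A * B) / Module.finrank ℂ V := by
  let b := Module.finBasis ℂ V
  have ht : ∀ X : V →ₗ[ℂ] V, LinearMap.trace ℂ V X = ∑ i, b.coord i (X (b i)) := fun X => by
    rw [LinearMap.trace_eq_matrix_trace ℂ b, Matrix.trace]
    simp [LinearMap.toMatrix_apply]
  have key : ∀ i j, avg (fun g => b.coord i ((ρ g * A) (b i)) * b.coord j ((ρ g⁻¹ * B) (b j))) =
      b.coord j (A (b i)) * b.coord i (B (b j)) / Module.finrank ℂ V := by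
    intro i j
    have h1 := avg_conj_rep h (LinearMap.toSpanSingleton ℂ V (A (b i)) ∘ₗ b.coord j)
    have h2 := congrArg (fun X => b.coord i (X (B (b j)))) h1
    have h3 := map_avg ((b.coord i) ∘ₗ (LinearMap.applyₗ (R := ℂ) (B (b j)) :
      (V →ₗ[ℂ] V) →ₗ[ℂ] V)) (fun g => ρ g * (LinearMap.toSpanSingleton ℂ V (A (b i)) ∘ₗ b.coord j) *
        ρ g⁻¹)
    simp only [LinearMap.comp_apply, LinearMap.applyₗ_apply_apply] at h3
    rw [h3] at h2
    have htr : LinearMap.trace ℂ V (LinearMap.toSpanSingleton ℂ V (A (b i)) ∘ₗ b.coord j) =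
        b.coord j (A (b i)) := by
      rw [LinearMap.trace_comp_comm', LinearMap.trace_eq_matrix_trace ℂ (Module.Basis.singleton Unit ℂ)]
      simp [LinearMap.toMatrix_apply, Matrix.trace]
    rw [htr] at h2
    simp only [LinearMap.smul_apply, Module.End.one_apply, map_smul, smul_eq_mul] at h2
    rw [mul_div_right_comm, ← h2]
    congr 1
    ext1 g
    simp [mul_comm]
  have hAB : LinearMap.trace ℂ V (A * B) = ∑ i, ∑ j, b.coord j (A (b i)) * b.coord i (B (b j)) := by
    rw [Finset.sum_comm, ht]
    refine Finset.sum_congr rfl fun j _ => ?_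
    have := b.sum_repr (B (b j))
    rw [Module.End.mul_apply]
    conv_lhs => rw [← this]
    simp only [map_sum, map_smul, smul_eq_mul, mul_comm, Module.Basis.coord_apply]
  rw [hAB, Finset.sum_div]
  simp only [ht, Finset.sum_mul_sum, avg_sum, key, Finset.sum_div]

end Schur

section Completeness

variable {G : Type} [Group G] [Finite G]

theorem isIrrChar_of_isIrreducible {V : Type} [AddCommGroup V] [Module ℂ V]
    [FiniteDimensional ℂ V] {ρ : Representation ℂ G V} (h : ρ.IsIrreducible) :
    IsIrrChar G ρ.character := by
  refine isIrrChar_of_ip_self (isCharacter_character ρ) ?_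
  rw [ip_character, Representation.IsIrreducible.finrank_intertwiningMap_self, Nat.cast_one]

/-- The operator attached to a function on the group in a representation. -/
def opOf {V : Type*} [AddCommGroup V] [Module ℂ V] (f : G → ℂ) (ρ : Representation ℂ G V) :
    V →ₗ[ℂ] V :=
  avg fun g => f g • ρ g⁻¹

theorem trace_opOf {V : Type} [AddCommGroup V] [Module ℂ V] [FiniteDimensional ℂ V] (f : G → ℂ)
    (ρ : Representation ℂ G V) : LinearMap.trace ℂ V (opOf f ρ) = ip f ρ.character := by
  rw [opOf, trace_avg]
  simp [ip, Representation.character]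

theorem opOf_comm {V : Type} [AddCommGroup V] [Module ℂ V] [FiniteDimensional ℂ V] {f : G → ℂ}
    (hf : IsClassFun f) (ρ : Representation ℂ G V) (x : G) : opOf f ρ * ρ x = ρ x * opOf f ρ := by
  rw [opOf, avg_mul_left_end, avg_mul_right_end, ← avg_conj_group x]
  congr 1
  ext1 g
  rw [hf, smul_mul_assoc, mul_smul_comm, ← map_mul, ← map_mul]
  congr 2
  group

theorem opOf_eq_zero_of_isIrreducible {V : Type} [AddCommGroup V] [Module ℂ V]
    [FiniteDimensional ℂ V] {f : G → ℂ} (hf : IsClassFun f) {ρ : Representation ℂ G V}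
    (h : ρ.IsIrreducible) (h0 : ip f ρ.character = 0) : opOf f ρ = 0 := by
  obtain ⟨c, hc⟩ := schur_scalar h (opOf f ρ) (opOf_comm hf ρ)
  have := congrArg (LinearMap.trace ℂ V) hc
  rw [trace_opOf, h0, map_smul, LinearMap.trace_one, smul_eq_mul] at this
  rcases mul_eq_zero.1 this.symm with h | h'
  · rw [hc, h, zero_smul]
  · exact absurd h' (finrank_ne_zero_of_isIrreducible h)

theorem opOf_apply {V : Type} [AddCommGroup V] [Module ℂ V] (f : G → ℂ)
    (ρ : Representation ℂ G V) (v : V) : opOf f ρ v = avg fun g => f g • ρ g⁻¹ v :=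
  map_avg (LinearMap.applyₗ v : (V →ₗ[ℂ] V) →ₗ[ℂ] V) _

theorem opOf_subrepresentation {V : Type} [AddCommGroup V] [Module ℂ V] (f : G → ℂ)
    (ρ : Representation ℂ G V) (A : Subrepresentation ρ) (v : A.toSubmodule) :
    opOf f ρ v = opOf f A.toRepresentation v := by
  rw [opOf_apply, opOf_apply]
  exact (map_avg A.toSubmodule.subtype
    (fun g => f g • (A.toRepresentation g⁻¹ v : A.toSubmodule))).symm

theorem opOf_eq_zero {f : G → ℂ} (hf : IsClassFun f)
    (h : ∀ η, IsIrrChar G η → ip f η = 0) (n : ℕ) : ∀ {V : Type} [AddCommGroup V] [Module ℂ V]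
    [FiniteDimensional ℂ V] (ρ : Representation ℂ G V), Module.finrank ℂ V = n →
    opOf f ρ = 0 := by
  induction n using Nat.strong_induction_on with
  | _ n ih =>
    intro V _ _ _ ρ hn
    by_cases hi : ρ.IsIrreducible
    · exact opOf_eq_zero_of_isIrreducible hf hi (h _ (isIrrChar_of_isIrreducible hi))
    by_cases hV : Nontrivial V
    · obtain ⟨A, B, hAB, hA, hB⟩ := exists_isCompl_of_not_irreducible ρ hi
      have h' : IsCompl A.toSubmodule B.toSubmodule := by
        rw [isCompl_iff, disjoint_iff, codisjoint_iff] at hAB ⊢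
        exact ⟨congrArg Subrepresentation.toSubmodule hAB.1,
          congrArg Subrepresentation.toSubmodule hAB.2⟩
      have hsum := Submodule.finrank_add_eq_of_isCompl h'
      have := Submodule.nontrivial_iff_ne_bot.2 hA
      have := Submodule.nontrivial_iff_ne_bot.2 hB
      have hA' : 0 < Module.finrank ℂ A.toSubmodule := Module.finrank_pos
      have hB' : 0 < Module.finrank ℂ B.toSubmodule := Module.finrank_pos
      have e1 := ih _ (by omega) A.toRepresentation rfl
      have e2 := ih _ (by omega) B.toRepresentation rfl
      ext v
      obtain ⟨⟨a, b⟩, rfl⟩ := (Submodule.prodEquivOfIsCompl _ _ h').surjective v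
      rw [Submodule.coe_prodEquivOfIsCompl', map_add]
      simp [opOf_subrepresentation, e1, e2]
    · rw [not_nontrivial_iff_subsingleton] at hV
      exact Subsingleton.elim _ _

variable (G) in
/-- The left regular representation. -/
def regRep : Representation ℂ G (G → ℂ) where
  toFun g := LinearMap.funLeft ℂ ℂ (fun x => g⁻¹ * x)
  map_one' := by ext; simp
  map_mul' g h := by ext; simp [mul_assoc]

theorem eq_zero_of_forall_ip {f : G → ℂ} (hf : IsClassFun f)
    (h : ∀ η, IsIrrChar G η → ip f η = 0) : f = 0 := by
  have h1 := opOf_eq_zero hf h _ (regRep G) rfl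
  ext x
  have h2 : opOf f (regRep G) (Pi.single 1 1) x⁻¹ = 0 := by rw [h1]; rfl
  rw [opOf_apply] at h2
  have h3 := map_avg (LinearMap.proj x⁻¹ : (G → ℂ) →ₗ[ℂ] ℂ)
    (fun g => f g • regRep G g⁻¹ (Pi.single 1 1))
  rw [LinearMap.proj_apply] at h3
  rw [h3] at h2
  have := Fintype.ofFinite G
  rw [avg_eq_sum, Finset.sum_eq_single x] at h2
  · simpa [regRep] using h2
  · intro g _ hg
    have : g * x⁻¹ ≠ 1 := fun h => hg (mul_inv_eq_one.1 h)
    simp [regRep, this]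
  · exact fun h => absurd (Finset.mem_univ x) h

theorem eq_sum_irr {f : G → ℂ} (hf : IsClassFun f) :
    f = ∑ η ∈ irrFinset G, ip f η • η := by
  rw [← sub_eq_zero]
  refine eq_zero_of_forall_ip (fun g h => ?_) fun η hη => ?_
  · simp only [Pi.sub_apply, Finset.sum_apply, Pi.smul_apply, hf g h]
    congr 1
    refine Finset.sum_congr rfl fun η hη => ?_
    rw [(mem_irrFinset.1 hη).1.isClassFun g h]
  · rw [ip_sub_left, ip_sum_left, Finset.sum_eq_single η]
    · rw [ip_smul_left, hη.ip_self, mul_one, sub_self]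
    · intro ψ hψ hne
      rw [ip_smul_left, (mem_irrFinset.1 hψ).ip_ne hη hne, mul_zero]
    · exact fun h => absurd (mem_irrFinset.2 hη) h

theorem isCharacter_of_ip_nat {f : G → ℂ} (hf : IsClassFun f)
    (h : ∀ η, IsIrrChar G η → ∃ n : ℕ, ip f η = n) : IsCharacter G f := by
  rw [eq_sum_irr hf]
  refine IsCharacter.sum _ fun η hη => ?_
  obtain ⟨n, hn⟩ := h η (mem_irrFinset.1 hη)
  rw [hn]
  exact (mem_irrFinset.1 hη).1.nsmul n

theorem isConstituent_of_ip_ne_zero {χ η : G → ℂ} (hχ : IsCharacter G χ) (hη : IsIrrChar G η)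
    (h : ip χ η ≠ 0) : IsConstituent η χ := by
  refine ⟨hη, χ - η, Or.inr ?_, by simp⟩
  refine isCharacter_of_ip_nat (fun g h => ?_) fun ψ hψ => ?_
  · rw [Pi.sub_apply, Pi.sub_apply, hχ.conj, hη.1.conj]
  · rw [ip_sub_left]
    obtain ⟨n, hn⟩ := hχ.ip_nat hψ.1
    by_cases hne : η = ψ
    · subst hne
      have : n ≠ 0 := fun h0 => h (by rw [hn, h0, Nat.cast_zero])
      exact ⟨n - 1, by rw [hη.ip_self, hn, Nat.cast_sub (by omega), Nat.cast_one]⟩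
    · exact ⟨n, by rw [hη.ip_ne hψ hne, sub_zero, hn]⟩

/-- Averaging a character over the fibres of a surjective homomorphism gives a character. -/
theorem isCharacter_of_avg_fiber {A B : Type} [Group A] [Group B] [Finite A] [Finite B]
    (q : A →* B) (hq : Function.Surjective q) {χ : A → ℂ} (hχ : IsCharacter A χ) {f : B → ℂ}
    (hf : ∀ a, f (q a) = avg fun k : q.ker => χ (k * a)) : IsCharacter B f := by
  refine isCharacter_of_ip_nat (fun b x => ?_) fun η hη => ?_
  · obtain ⟨a, rfl⟩ := hq b
    obtain ⟨y, rfl⟩ := hq x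
    rw [← map_mul, ← map_inv, ← map_mul, hf, hf]
    rw [← avg_comp_equiv (MulAut.conjNormal y : MulAut q.ker).toEquiv]
    congr 1
    ext1 k
    rw [← hχ.conj (k * a) y]
    congr 1
    simp
  · have : ip f η = ip χ (fun a => η (q a)) := by
      rw [ip, ← avg_comp_surjective q hq]
      simp only [hf, ← avg_mul_right]
      rw [avg_comm]
      rw [← avg_const (α := q.ker) (ip χ (fun a => η (q a)))]
      congr 1
      ext1 k
      rw [ip, ← avg_mul_left_group (k : A) (fun a => χ a * η (q a⁻¹))]
      congr 1
      ext1 a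
      simp [(MonoidHom.mem_ker).1 k.2]
    rw [this]
    exact hχ.ip_nat (hη.1.comp q)

/-- Extension by zero from a subgroup. -/
def extZero {G : Type} [Group G] (S : Subgroup G) (ψ : S → ℂ) (g : G) : ℂ :=
  if h : g ∈ S then ψ ⟨g, h⟩ else 0

theorem avg_extZero (S : Subgroup G) (ψ : S → ℂ) :
    avg (extZero S ψ) * S.index = avg ψ := by
  have := Fintype.ofFinite G
  have hc : (Nat.card G : ℂ) = Nat.card S * S.index := by
    rw [← Nat.cast_mul, S.card_mul_index]
  have h1 : (Nat.card S : ℂ) ≠ 0 := card_ne_zero_complex S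
  have h2 : (S.index : ℂ) ≠ 0 := Nat.cast_ne_zero.2 S.index_ne_zero_of_finite
  have h3 : ∑ᶠ g, extZero S ψ g = ∑ᶠ s, ψ s := by
    rw [finsum_eq_sum_of_fintype, finsum_eq_sum_of_fintype,
      ← Finset.sum_subset (Finset.subset_univ (Finset.univ.map ⟨S.subtype, S.subtype_injective⟩)),
      Finset.sum_map]
    · simp [extZero]
    · intro g _ hg
      have : g ∉ S := fun h => hg (Finset.mem_map.2 ⟨⟨g, h⟩, Finset.mem_univ _, rfl⟩)
      simp [extZero, this]
  rw [avg, avg, h3, hc, smul_eq_mul, smul_eq_mul]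
  field_simp

/-- The induced class function of a character is a character. -/
theorem isCharacter_ind (S : Subgroup G) {ψ : S → ℂ} (hψ : IsCharacter S ψ) :
    IsCharacter G fun g => S.index * avg fun x => extZero S ψ (x * g * x⁻¹) := by
  refine isCharacter_of_ip_nat (fun g y => ?_) fun η hη => ?_
  · congr 1
    rw [← avg_mul_right_group y (fun x => extZero S ψ (x * g * x⁻¹))]
    congr 1
    ext1 x
    congr 1
    group
  · have : ip (fun g => S.index * avg fun x => extZero S ψ (x * g * x⁻¹)) η =
        ip ψ (fun s => η s) := by
      rw [ip]
      simp only [mul_assoc, ← avg_mul_right, avg_mul_left]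
      rw [avg_comm]
      rw [ip, ← avg_extZero, mul_comm]
      congr 1
      rw [← avg_const (α := G) (avg (extZero S _))]
      congr 1
      ext1 x
      rw [← avg_conj_group x⁻¹]
      congr 1
      ext1 g
      have : x * (x⁻¹ * g * x⁻¹⁻¹ * x⁻¹) = g := by group
      have h2 : (x⁻¹ * g * x⁻¹⁻¹)⁻¹ = x⁻¹ * g⁻¹ * x⁻¹⁻¹ := by group
      rw [this, h2, hη.1.conj]
      unfold extZero
      split_ifs <;> simp
    rw [this]
    exact hψ.ip_nat (hη.1.comp S.subtype)

end Completeness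

section DegreeDivides

variable {G : Type} [Group G] [Finite G]
variable {V : Type} [AddCommGroup V] [Module ℂ V] [FiniteDimensional ℂ V]

/-- The degree of an irreducible representation divides the order of the group. -/
theorem finrank_dvd_card {ρ : Representation ℂ G V} (h : ρ.IsIrreducible) :
    Module.finrank ℂ V ∣ Nat.card G := by
  have := Fintype.ofFinite G
  set d := Module.finrank ℂ V with hd
  have hd0 : (d : ℂ) ≠ 0 := finrank_ne_zero_of_isIrreducible h
  have hG0 : (Nat.card G : ℂ) ≠ 0 := card_ne_zero_complex G
  set z : G → ℂ := fun g => Nat.card G * ρ.character g / d with hz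
  have havg : ∀ A : V →ₗ[ℂ] V, ∑ x, ρ x * A * ρ x⁻¹ =
      (Nat.card G * LinearMap.trace ℂ V A / d) • 1 := by
    intro A
    have := avg_conj_rep h A
    rw [avg_eq_sum, ← Nat.card_eq_fintype_card] at this
    have h2 := congrArg (fun T => (Nat.card G : ℂ) • T) this
    simp only [smul_smul, mul_inv_cancel₀ hG0, one_smul] at h2
    rw [h2, mul_div_assoc]
  have hzz : ∀ g k, z k * z g = ∑ y, z (g * (y * k * y⁻¹)) := by
    intro g k
    have h1 : ∑ y, LinearMap.trace ℂ V (ρ g * (ρ y * ρ k * ρ y⁻¹)) = z k * ρ.character g := by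
      rw [← map_sum, ← Finset.mul_sum, havg, mul_smul_comm, map_smul, mul_one, smul_eq_mul]
      rfl
    have h2 : ∑ y, z (g * (y * k * y⁻¹)) =
        (Nat.card G : ℂ) / d * ∑ y, LinearMap.trace ℂ V (ρ g * (ρ y * ρ k * ρ y⁻¹)) := by
      rw [Finset.mul_sum]
      refine Finset.sum_congr rfl fun y _ => ?_
      simp only [hz, Representation.character, map_mul]
      ring
    rw [h2, h1]
    simp only [hz]
    ring
  set M : Submodule ℤ (V →ₗ[ℂ] V) :=
    Submodule.span ℤ (Set.range fun p : G × G => z p.1 • ρ p.2) with hM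
  have hmem : ∀ g k, z g • ρ k ∈ M := fun g k => Submodule.subset_span ⟨(g, k), rfl⟩
  have hfg : M.FG := Submodule.fg_span (Set.finite_range _)
  have hne : M ≠ ⊥ := by
    intro h0
    have h1 := hmem 1 1
    rw [h0, Submodule.mem_bot] at h1
    have h2 := congrArg (LinearMap.trace ℂ V) h1
    rw [map_one, map_smul, LinearMap.trace_one, map_zero, smul_eq_mul] at h2
    simp only [hz, ρ.char_one] at h2
    rw [← hd, mul_div_assoc, div_self hd0] at h2
    simp [hd0] at h2
  have hsum : ∑ k, z k • ρ k⁻¹ = (((Nat.card G / d : ℚ) ^ 2 : ℚ) : ℂ) • (1 : V →ₗ[ℂ] V) := by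
    have h1 : ∑ k, z k • ρ k⁻¹ = ((Nat.card G : ℂ) ^ 2 / d) • opOf ρ.character ρ := by
      rw [opOf, avg_eq_sum, smul_smul, Finset.smul_sum]
      refine Finset.sum_congr rfl fun k _ => ?_
      rw [smul_smul, ← Nat.card_eq_fintype_card]
      congr 1
      simp only [hz]
      field_simp
    obtain ⟨c, hc⟩ := schur_scalar h (opOf ρ.character ρ)
      (opOf_comm (isCharacter_character ρ).isClassFun ρ)
    have h2 := congrArg (LinearMap.trace ℂ V) hc
    rw [trace_opOf, (isIrrChar_of_isIrreducible h).ip_self, map_smul, LinearMap.trace_one,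
      smul_eq_mul] at h2
    rw [h1, hc, smul_smul]
    congr 1
    push_cast
    rw [← hd] at h2
    field_simp
    linear_combination -h2
  have hint : IsIntegral ℤ (((Nat.card G / d : ℚ) ^ 2 : ℚ) : ℂ) := by
    refine isIntegral_of_smul_mem_submodule M hne hfg _ fun T hT => ?_
    have h1 : (((Nat.card G / d : ℚ) ^ 2 : ℚ) : ℂ) • T = ∑ k, z k • ρ k⁻¹ * T := by
      rw [← Finset.sum_mul, hsum, smul_mul_assoc, one_mul]
    rw [h1]
    clear h1
    induction hT using Submodule.span_induction with
    | mem T hT =>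
      obtain ⟨⟨g, k⟩, rfl⟩ := hT
      refine Submodule.sum_mem _ fun x _ => ?_
      rw [smul_mul_smul_comm, hzz, ← map_mul, Finset.sum_smul]
      exact Submodule.sum_mem _ fun y _ => hmem _ _
    | zero => simp
    | add S T _ _ hS hT =>
      simp only [mul_add, Finset.sum_add_distrib]
      exact M.add_mem hS hT
    | smul c T _ hT =>
      simp only [mul_smul_comm, ← Finset.smul_sum]
      exact M.smul_mem c hT
  have hq : IsIntegral ℤ ((Nat.card G / d : ℚ) ^ 2 : ℚ) :=
    (isIntegral_algebraMap_iff (algebraMap ℚ ℂ).injective).1 hint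
  obtain ⟨m, hm⟩ := IsIntegrallyClosed.isIntegral_iff.1 hq
  have hd1 : (d : ℚ) ≠ 0 := by exact_mod_cast hd0
  have h3 : (m : ℚ) * d ^ 2 = Nat.card G ^ 2 := by
    rw [eq_intCast] at hm
    rw [hm]
    field_simp
  have h4 : m * (d : ℤ) ^ 2 = (Nat.card G : ℤ) ^ 2 := by exact_mod_cast h3
  have h5 : (d : ℤ) ^ 2 ∣ (Nat.card G : ℤ) ^ 2 := ⟨m, by rw [← h4, mul_comm]⟩
  have h6 := (Int.pow_dvd_pow_iff two_ne_zero).1 h5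
  exact Int.natCast_dvd_natCast.1 h6

theorem IsIrrChar.exists_rep {χ : G → ℂ} (h : IsIrrChar G χ) :
    ∃ (d : ℕ) (ρ : Representation ℂ G (Fin d → ℂ)), ρ.IsIrreducible ∧ χ = ρ.character ∧
      d ∣ Nat.card G ∧ χ 1 = d := by
  obtain ⟨d, ρ, rfl⟩ := h.1.exists_rep
  have := finrank_dvd_card h.isIrreducible
  rw [Module.finrank_fin_fun] at this
  exact ⟨d, ρ, h.isIrreducible, rfl, this, by rw [ρ.char_one, Module.finrank_fin_fun]⟩

end DegreeDivides

section OddGroups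

variable {K : Type} [Group K] [Finite K]

/-- The subgroup of fixed points of an automorphism. -/
def fixSub (γ : MulAut K) : Subgroup K := MonoidHom.eqLocus γ.toMonoidHom (MonoidHom.id K)

@[simp] theorem mem_fixSub {γ : MulAut K} {k : K} : k ∈ fixSub γ ↔ γ k = k := Iff.rfl

/-- The square root in a group of odd order. -/
def oddSqrt (k : K) : K := k ^ ((Nat.card K + 1) / 2)

theorem oddSqrt_sq (hK : Odd (Nat.card K)) (k : K) : oddSqrt k * oddSqrt k = k := by
  obtain ⟨m, hm⟩ := hK
  rw [oddSqrt, ← pow_add, hm, show (2 * m + 1 + 1) / 2 + (2 * m + 1 + 1) / 2 = 2 * m + 1 + 1 by omega,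
    ← hm, pow_succ, pow_card_eq_one', one_mul]

theorem oddSqrt_mul_self (hK : Odd (Nat.card K)) (k : K) : oddSqrt (k * k) = k := by
  obtain ⟨m, hm⟩ := hK
  rw [oddSqrt, ← pow_two, ← pow_mul, hm, show 2 * ((2 * m + 1 + 1) / 2) = 2 * m + 1 + 1 by omega,
    ← hm, pow_succ, pow_card_eq_one', one_mul]

theorem eq_of_mul_self_eq (hK : Odd (Nat.card K)) {a b : K} (h : a * a = b * b) : a = b := by
  rw [← oddSqrt_mul_self hK a, h, oddSqrt_mul_self hK]

theorem map_oddSqrt (γ : MulAut K) (k : K) : γ (oddSqrt k) = oddSqrt (γ k) := map_pow _ _ _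

theorem oddSqrt_inv (k : K) : oddSqrt k⁻¹ = (oddSqrt k)⁻¹ := inv_pow _ _

theorem oddSqrt_conj (x k : K) : oddSqrt (x⁻¹ * k * x) = x⁻¹ * oddSqrt k * x := by
  have := map_oddSqrt (MulAut.conj x⁻¹) k
  simpa using this.symm

theorem card_fiber_eq_of_le {α β : Type*} [Finite α] [Finite β] (q : α → β) (m : ℕ)
    (h : ∀ b, Nat.card {a // q a = b} ≤ m) (hc : Nat.card α = Nat.card β * m) (b : β) :
    Nat.card {a // q a = b} = m := by
  have := Fintype.ofFinite β
  have h1 : ∑ b, Nat.card {a // q a = b} = ∑ _b : β, m := by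
    rw [← Nat.card_sigma, Nat.card_congr (Equiv.sigmaFiberEquiv q), hc]
    simp [Nat.card_eq_fintype_card]
  exact (Finset.sum_eq_sum_iff_of_le fun b _ => h b).1 h1 b (Finset.mem_univ b)

theorem fix_of_twisted_eq (hK : Odd (Nat.card K)) {γ : MulAut K} (hγ : ∀ k, γ (γ k) = k)
    {y y₀ c c₀ : K} (hc : γ c = c) (hc₀ : γ c₀ = c₀)
    (h : y * c * (γ y)⁻¹ = y₀ * c₀ * (γ y₀)⁻¹) :
    γ (y₀⁻¹ * y) = y₀⁻¹ * y ∧ y₀⁻¹ * y * c = c₀ * (y₀⁻¹ * y) := by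
  have h1 := congrArg γ h
  simp only [map_mul, map_inv, hγ, hc, hc₀] at h1
  have h2 : y * (c * c) * y⁻¹ = y₀ * (c₀ * c₀) * y₀⁻¹ := by
    have := congrArg₂ (· * ·) h h1
    calc y * (c * c) * y⁻¹ = y * c * (γ y)⁻¹ * (γ y * c * y⁻¹) := by group
      _ = y₀ * c₀ * (γ y₀)⁻¹ * (γ y₀ * c₀ * y₀⁻¹) := this
      _ = _ := by group
  have h3 : y₀⁻¹ * y * c * (y₀⁻¹ * y)⁻¹ = c₀ := by
    apply eq_of_mul_self_eq hK
    calc y₀⁻¹ * y * c * (y₀⁻¹ * y)⁻¹ * (y₀⁻¹ * y * c * (y₀⁻¹ * y)⁻¹) =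
        y₀⁻¹ * (y * (c * c) * y⁻¹) * y₀ := by group
      _ = c₀ * c₀ := by rw [h2]; group
  have h4 : y₀⁻¹ * y * c = c₀ * (y₀⁻¹ * y) := mul_inv_eq_iff_eq_mul.1 h3
  refine ⟨?_, h4⟩
  have h5 : y₀⁻¹ * y * c = c₀ * γ (y₀⁻¹ * y) := by
    rw [map_mul, map_inv]
    calc y₀⁻¹ * y * c = y₀⁻¹ * (y * c * (γ y)⁻¹) * γ y := by group
      _ = _ := by rw [h]; group
  exact mul_left_cancel (h5.symm.trans h4)

theorem avg_eq_avg_fixSub (hK : Odd (Nat.card K)) {γ : MulAut K} (hγ : ∀ k, γ (γ k) = k)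
    (Ψ : K → ℂ) (hΨ : ∀ y k, Ψ (y * k * (γ y)⁻¹) = Ψ k) :
    avg Ψ = avg fun c : fixSub γ => Ψ c := by
  let q : K × fixSub γ → K := fun x => x.1 * x.2 * (γ x.1)⁻¹
  have hq := card_fiber_eq_of_le q (Nat.card (fixSub γ)) (fun b => by
    by_cases hne : Nonempty {a // q a = b}
    · obtain ⟨⟨⟨y₀, c₀⟩, h₀⟩⟩ := hne
      refine Nat.card_le_card_of_injective (β := fixSub γ) (fun x => ⟨y₀⁻¹ * x.1.1,
        (fix_of_twisted_eq hK hγ x.1.2.2 c₀.2 (x.2.trans h₀.symm)).1⟩) ?_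
      rintro ⟨⟨y, c⟩, h⟩ ⟨⟨y', c'⟩, h'⟩ he
      have hy : y = y' := mul_left_cancel (congrArg Subtype.val he)
      subst hy
      have hc : c = c' := by
        have := h.trans h'.symm
        simp only [q, mul_left_inj, mul_right_inj] at this
        exact Subtype.ext this
      subst hc
      rfl
    · rw [not_nonempty_iff] at hne
      simp) (by rw [Nat.card_prod])
  rw [← avg_comp_of_card_fiber q _ Nat.card_pos.ne' hq Ψ, avg_prod, avg_comm]
  simp only [q, hΨ, avg_const]

theorem exists_decomposition (hK : Odd (Nat.card K)) {σ γ : MulAut K} (hσ : ∀ k, σ (σ k) = k)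
    (hγ : ∀ k, γ (γ k) = k) (hσγ : ∀ k, σ (γ k) = γ (σ k)) (k : K) :
    ∃ y c w, σ y = y ∧ γ c = c ∧ σ (γ w) = w ∧ y * c * w = k := by
  set p := k * (σ (γ k))⁻¹ with hp
  have hσp : σ p = (γ p)⁻¹ := by
    simp only [hp, map_mul, map_inv, hσ, mul_inv_rev, inv_inv, ← hσγ, hγ]
  have hσγp : σ (γ p) = p⁻¹ := by rw [hσγ, hσp, map_inv, hγ]
  set u := oddSqrt (p * γ p) with hu
  have huu : u * u = p * γ p := oddSqrt_sq hK _
  have hγu : γ u = p⁻¹ * u * p := by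
    rw [hu, map_oddSqrt, map_mul, hγ, ← oddSqrt_conj]
    congr 1
    group
  have hσu : σ u = u⁻¹ := by
    rw [hu, map_oddSqrt, map_mul, hσp, hσγp, ← oddSqrt_inv]
    congr 1
    exact (mul_inv_rev _ _).symm
  set r := oddSqrt (u⁻¹ * p) with hr
  have hrr : r * r = u⁻¹ * p := oddSqrt_sq hK _
  have hσr : σ r = r := by
    rw [hr, map_oddSqrt, map_mul, map_inv, hσu, hσp]
    congr 1
    have : (γ p)⁻¹ = u⁻¹ * u⁻¹ * p := by
      rw [← mul_inv_rev, huu]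
      group
    rw [this]
    group
  have hγr : γ r = r⁻¹ := by
    rw [hr, map_oddSqrt, map_mul, map_inv, hγu, ← oddSqrt_inv]
    congr 1
    have : γ p = p⁻¹ * (u * u) := by rw [huu]; group
    rw [this]
    group
  have hpu : p = u * r * r := by rw [mul_assoc, hrr]; group
  set P := r⁻¹ * u * r with hP
  have hγP : γ P = P := by
    rw [hP, map_mul, map_mul, map_inv, hγr, hγu]
    rw [hpu]
    group
  have hσP : σ P = P⁻¹ := by
    rw [hP, map_mul, map_mul, map_inv, hσr, hσu]
    group
  set c := oddSqrt P with hc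
  have hcc : c * c = P := oddSqrt_sq hK _
  have hγc : γ c = c := by rw [hc, map_oddSqrt, hγP]
  have hσc : σ c = c⁻¹ := by rw [hc, map_oddSqrt, hσP, oddSqrt_inv]
  refine ⟨r, c, (r * c)⁻¹ * k, hσr, hγc, ?_, by group⟩
  have h1 : σ (γ k) = p⁻¹ * k := by rw [hp]; group
  rw [map_mul, map_mul, map_inv, map_inv, map_mul, map_mul, hγr, hγc, map_inv, hσr, hσc, h1, hpu]
  have h2 : u = r * (c * c) * r⁻¹ := by rw [hcc, hP]; group
  rw [h2]
  group

theorem avg_twisted_eq_avg_fixSub (hK : Odd (Nat.card K)) {σ γ : MulAut K}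
    (hσ : ∀ k, σ (σ k) = k) (hγ : ∀ k, γ (γ k) = k) (hσγ : ∀ k, σ (γ k) = γ (σ k))
    (Ψ : K → ℂ) (hΨ : ∀ y k, Ψ (y * k * (γ y)⁻¹) = Ψ k) :
    avg (fun k => Ψ (σ k * (γ k)⁻¹)) = avg fun c : fixSub γ => Ψ (σ c * (c : K)⁻¹) := by
  let D : Subgroup K := fixSub σ ⊓ fixSub γ
  let q : fixSub σ × fixSub γ × fixSub (σ * γ) → K := fun x => x.1 * x.2.1 * x.2.2
  have hq : ∀ k, Nat.card {x // q x = k} = Nat.card (D × D) := by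
    intro k
    obtain ⟨y₀, c₀, w₀, hy₀, hc₀, hw₀, rfl⟩ := exists_decomposition hK hσ hγ hσγ k
    have key : ∀ y c w, σ y = y → γ c = c → σ (γ w) = w → y * c * w = y₀ * c₀ * w₀ →
        y₀⁻¹ * y ∈ D ∧ c₀⁻¹ * (y₀⁻¹ * y) * c ∈ D := by
      intro y c w hy hc hw h
      have h1 := congrArg (fun k => k * (σ (γ k))⁻¹) h
      simp only [map_mul, hw, hw₀, hc, hc₀] at h1
      have hγy : σ (γ y) = γ y := by rw [hσγ, hy]
      have hγy₀ : σ (γ y₀) = γ y₀ := by rw [hσγ, hy₀]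
      rw [hγy, hγy₀] at h1
      have h2 : y * (c * (σ c)⁻¹) * (γ y)⁻¹ = y₀ * (c₀ * (σ c₀)⁻¹) * (γ y₀)⁻¹ := by
        calc _ = y * c * w * (γ y * σ c * w)⁻¹ := by group
          _ = _ := h1
          _ = _ := by group
      obtain ⟨h3, h4⟩ := fix_of_twisted_eq hK hγ
        (by rw [map_mul, map_inv, ← hσγ, hc]) (by rw [map_mul, map_inv, ← hσγ, hc₀]) h2
      have h5 : σ (y₀⁻¹ * y) = y₀⁻¹ * y := by rw [map_mul, map_inv, hy, hy₀]
      refine ⟨⟨h5, h3⟩, ?_, ?_⟩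
      · change σ (c₀⁻¹ * (y₀⁻¹ * y) * c) = c₀⁻¹ * (y₀⁻¹ * y) * c
        rw [map_mul, map_mul, h5, map_inv]
        have h6 : y₀⁻¹ * y = c₀ * (σ c₀)⁻¹ * (y₀⁻¹ * y) * (c * (σ c)⁻¹)⁻¹ := by
          rw [← h4]; group
        calc (σ c₀)⁻¹ * (y₀⁻¹ * y) * σ c =
            c₀⁻¹ * (c₀ * (σ c₀)⁻¹ * (y₀⁻¹ * y) * (c * (σ c)⁻¹)⁻¹) * c := by group
          _ = _ := by rw [← h6]
      · change γ (c₀⁻¹ * (y₀⁻¹ * y) * c) = c₀⁻¹ * (y₀⁻¹ * y) * c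
        rw [map_mul, map_mul, h3, map_inv, hc, hc₀]
    refine Nat.card_congr ⟨fun x => (⟨_, (key _ _ _ x.1.1.2 x.1.2.1.2 x.1.2.2.2 x.2).1⟩,
      ⟨_, (key _ _ _ x.1.1.2 x.1.2.1.2 x.1.2.2.2 x.2).2⟩), fun ef =>
      ⟨(⟨y₀ * ef.1, Subgroup.mul_mem (fixSub σ) hy₀ ef.1.2.1⟩,
        ⟨(ef.1 : K)⁻¹ * c₀ * ef.2, Subgroup.mul_mem (fixSub γ)
          (Subgroup.mul_mem (fixSub γ) (Subgroup.inv_mem (fixSub γ) ef.1.2.2) hc₀) ef.2.2.2⟩,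
        ⟨(ef.2 : K)⁻¹ * w₀, Subgroup.mul_mem (fixSub (σ * γ)) (Subgroup.inv_mem (fixSub (σ * γ)) (by
          have h1 : σ ef.2 = ef.2 := ef.2.2.1
          have h2 : γ ef.2 = ef.2 := ef.2.2.2
          simp [h1, h2])) hw₀⟩), ?_⟩, ?_, ?_⟩
    · change y₀ * _ * ((_ : K)⁻¹ * c₀ * _) * ((_ : K)⁻¹ * w₀) = _
      group
    · rintro ⟨⟨⟨y, hy⟩, ⟨c, hc⟩, ⟨w, hw⟩⟩, h⟩
      have hw' : w = (y * c)⁻¹ * (y₀ * c₀ * w₀) := by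
        rw [← h]
        change w = (y * c)⁻¹ * (y * c * w)
        group
      simp only [Subtype.mk.injEq, Prod.mk.injEq, hw']
      refine ⟨by group, by group, by group⟩
    · rintro ⟨⟨e, he⟩, ⟨f, hf⟩⟩
      simp only [Prod.mk.injEq, Subtype.mk.injEq]
      refine ⟨by group, by group⟩
  have hinv : ∀ x, Ψ (σ (q x) * (γ (q x))⁻¹) = Ψ (σ x.2.1 * (x.2.1 : K)⁻¹) := by
    rintro ⟨⟨y, hy⟩, ⟨c, hc⟩, ⟨w, hw⟩⟩
    have hw' : σ w = γ w := by
      have : σ (γ w) = w := hw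
      rw [hσγ] at this
      rw [← hγ (σ w), this]
    rw [mem_fixSub] at hy hc
    simp only [q, map_mul, hy, hc, hw']
    rw [← hΨ y (σ c * c⁻¹)]
    congr 1
    group
  rw [← avg_comp_of_card_fiber q _ Nat.card_pos.ne' hq]
  simp only [hinv]
  simp only [avg_prod, avg_const]

end OddGroups

section Idempotents

variable {V : Type} [AddCommGroup V] [Module ℂ V] [FiniteDimensional ℂ V]

theorem exists_trace_idem {e : V →ₗ[ℂ] V} (he : e * e = e) :
    ∃ a : ℕ, LinearMap.trace ℂ V e = a ∧ (a = 0 → e = 0) := by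
  have he' : ∀ x, e (e x) = e x := fun x => LinearMap.congr_fun he x
  refine ⟨Module.finrank ℂ (LinearMap.range e), ?_, fun h => ?_⟩
  · rw [← LinearMap.trace_restrict_eq_of_forall_mem (LinearMap.range e) e
      (fun x => LinearMap.mem_range_self e x), ← LinearMap.trace_one]
    congr 1
    ext ⟨_, ⟨x, rfl⟩⟩
    simp [LinearMap.restrict_apply, he']
  · rwa [Submodule.finrank_eq_zero, LinearMap.range_eq_bot] at h

theorem isCharacter_trace_mul_idem {G : Type} [Group G] (ρ : Representation ℂ G V)
    {e : V →ₗ[ℂ] V} (he : e * e = e) (hc : ∀ g, e * ρ g = ρ g * e) :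
    IsCharacter G fun g => LinearMap.trace ℂ V (ρ g * e) := by
  have he' : ∀ x, e (e x) = e x := fun x => LinearMap.congr_fun he x
  have hc' : ∀ g x, e (ρ g x) = ρ g (e x) := fun g x => LinearMap.congr_fun (hc g) x
  let A : Subrepresentation ρ := ⟨LinearMap.range e, by
    rintro g _ ⟨x, rfl⟩
    exact ⟨ρ g x, hc' g x⟩⟩
  convert isCharacter_character A.toRepresentation using 1
  ext g
  rw [← LinearMap.trace_restrict_eq_of_forall_mem (LinearMap.range e) (ρ g * e)
      (fun x => ⟨ρ g x, hc' g x⟩), Representation.character]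
  congr 1
  ext ⟨_, ⟨x, rfl⟩⟩
  change ρ g (e (e x)) = ρ g (e x)
  rw [he']

theorem idem_of_involution {T : V →ₗ[ℂ] V} (hT : T * T = 1) :
    ((1 / 2 : ℂ) • (1 + T)) * ((1 / 2 : ℂ) • (1 + T)) = (1 / 2 : ℂ) • (1 + T) := by
  rw [smul_mul_smul_comm, mul_add, add_mul, add_mul, hT, one_mul, mul_one, one_mul,
    show (1 : V →ₗ[ℂ] V) + T + (T + 1) = (2 : ℂ) • (1 + T) by module, smul_smul]
  norm_num

theorem neg_mul_neg_one {T : V →ₗ[ℂ] V} (hT : T * T = 1) : -T * -T = 1 := by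
  rw [neg_mul_neg, hT]

theorem exists_trace_involution {T : V →ₗ[ℂ] V} (hT : T * T = 1) :
    ∃ a b : ℕ, LinearMap.trace ℂ V T = (a : ℂ) - b ∧ a + b = Module.finrank ℂ V ∧
      (a = 0 → T = -1) ∧ (b = 0 → T = 1) := by
  obtain ⟨a, ha, ha'⟩ := exists_trace_idem (idem_of_involution hT)
  obtain ⟨b, hb, hb'⟩ := exists_trace_idem (idem_of_involution (neg_mul_neg_one hT))
  rw [map_smul, map_add, LinearMap.trace_one, smul_eq_mul] at ha hb
  rw [map_neg] at hb
  refine ⟨a, b, ?_, ?_, fun h => ?_, fun h => ?_⟩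
  · rw [← ha, ← hb]; ring
  · have : (a : ℂ) + b = Module.finrank ℂ V := by rw [← ha, ← hb]; ring
    exact_mod_cast this
  · have := ha' h
    rw [smul_eq_zero_iff_right (by norm_num)] at this
    exact (neg_eq_of_add_eq_zero_right this).symm
  · have := hb' h
    rw [smul_eq_zero_iff_right (by norm_num)] at this
    exact (sub_eq_zero.1 (by rw [← this]; abel) : (1 : V →ₗ[ℂ] V) = T).symm

theorem exists_sub_character {G : Type} [Group G] (ρ : Representation ℂ G V)
    {T : V →ₗ[ℂ] V} (hT : T * T = 1) (hc : ∀ g, T * ρ g = ρ g * T) :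
    ∃ χ ψ, IsCharacter G χ ∧ IsCharacter G ψ ∧
      (fun g => LinearMap.trace ℂ V (ρ g * T)) = χ - ψ := by
  refine ⟨_, _, isCharacter_trace_mul_idem ρ (idem_of_involution hT) fun g => ?_,
    isCharacter_trace_mul_idem ρ (idem_of_involution (neg_mul_neg_one hT)) fun g => ?_, ?_⟩
  · rw [smul_mul_assoc, add_mul, hc, mul_smul_comm, mul_add, one_mul, mul_one]
  · rw [smul_mul_assoc, add_mul, neg_mul, hc, mul_smul_comm, mul_add, one_mul, mul_one, mul_neg]
  · ext g
    simp only [Pi.sub_apply, ← map_sub]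
    congr 1
    rw [← mul_sub]
    congr 1
    module

end Idempotents

section Irreducibles

variable {G : Type} [Group G] [Finite G]

theorem exists_irr_of_ip_sub_self {χ ψ : G → ℂ} (hχ : IsCharacter G χ) (hψ : IsCharacter G ψ)
    (h : ip (χ - ψ) (χ - ψ) = 1) :
    ∃ β, IsIrrChar G β ∧ ∃ ε : ℂ, (ε = 1 ∨ ε = -1) ∧ χ - ψ = ε • β := by
  have hint : ∀ η, ∃ m : ℤ, IsIrrChar G η → ip (χ - ψ) η = m := fun η => by
    by_cases hη : IsIrrChar G η
    · obtain ⟨a, ha⟩ := hχ.ip_nat hη.1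
      obtain ⟨b, hb⟩ := hψ.ip_nat hη.1
      exact ⟨a - b, fun _ => by rw [ip_sub_left, ha, hb]; push_cast; rfl⟩
    · exact ⟨0, fun h => absurd h hη⟩
  choose m hm using hint
  have hcf : IsClassFun (χ - ψ) := fun g k => by
    rw [Pi.sub_apply, Pi.sub_apply, hχ.conj, hψ.conj]
  have hsum : χ - ψ = ∑ η ∈ irrFinset G, (m η : ℂ) • η := by
    rw [eq_sum_irr hcf]
    exact Finset.sum_congr rfl fun η hη => by rw [hm η (mem_irrFinset.1 hη)]
  have hsq : ∑ η ∈ irrFinset G, m η ^ 2 = 1 := by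
    nth_rw 1 [hsum] at h
    rw [ip_sum_left] at h
    have : ∑ η ∈ irrFinset G, ((m η : ℂ)) ^ 2 = 1 := by
      rw [← h]
      refine Finset.sum_congr rfl fun η hη => ?_
      rw [ip_smul_left, ip_comm, hm η (mem_irrFinset.1 hη), pow_two]
    exact_mod_cast this
  obtain ⟨β, hβ, hβ0⟩ : ∃ β ∈ irrFinset G, m β ^ 2 ≠ 0 := by
    by_contra! hc
    rw [Finset.sum_eq_zero hc] at hsq
    exact zero_ne_one hsq
  rw [← Finset.add_sum_erase _ _ hβ] at hsq
  have h1 : 0 ≤ ∑ η ∈ (irrFinset G).erase β, m η ^ 2 := Finset.sum_nonneg fun _ _ => sq_nonneg _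
  have h2 : 0 < m β ^ 2 := lt_of_le_of_ne (sq_nonneg _) hβ0.symm
  have h3 : m β ^ 2 = 1 := by omega
  have h4 : ∑ η ∈ (irrFinset G).erase β, m η ^ 2 = 0 := by omega
  rw [Finset.sum_eq_zero_iff_of_nonneg fun _ _ => sq_nonneg _] at h4
  refine ⟨β, mem_irrFinset.1 hβ, m β, ?_, ?_⟩
  · rcases sq_eq_one_iff.1 h3 with h | h
    · exact Or.inl (by rw [h]; simp)
    · exact Or.inr (by rw [h]; simp)
  · rw [hsum, ← Finset.add_sum_erase _ _ hβ, Finset.sum_eq_zero, add_zero]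
    intro η hη
    rw [pow_eq_zero_iff two_ne_zero |>.1 (h4 η hη)]
    simp

theorem exists_equiv_of_character_eq {V W : Type} [AddCommGroup V] [Module ℂ V]
    [FiniteDimensional ℂ V] [AddCommGroup W] [Module ℂ W] [FiniteDimensional ℂ W]
    {ρ : Representation ℂ G V} {σ : Representation ℂ G W} (hρ : ρ.IsIrreducible)
    (h : ρ.character = σ.character) : ∃ e : V ≃ₗ[ℂ] W, ∀ g v, e (ρ g v) = σ g (e v) := by
  have hi := isIrrChar_of_isIrreducible hρ
  have hi' := hi
  rw [h] at hi'
  have hσ := hi'.isIrreducible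
  have := Fintype.ofFinite G
  have : Invertible (Nat.card G : ℂ) := invertibleOfNonzero (card_ne_zero_complex G)
  have key := Representation.char_orthonormal σ ρ
  by_cases hn : Nonempty (Representation.Equiv ρ σ)
  · obtain ⟨f⟩ := hn
    exact ⟨f.toLinearEquiv, fun g v => LinearMap.congr_fun (f.toIntertwiningMap.isIntertwining' g) v⟩
  · exfalso
    rw [if_neg fun ⟨f⟩ => hn ⟨f⟩] at key
    have h1 := hi.ip_self
    rw [ip, avg_eq_sum, ← Nat.card_eq_fintype_card, smul_eq_mul] at h1
    rw [← h] at key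
    rw [h1] at key
    exact one_ne_zero key

/-- An irreducible representation whose character is invariant under an involutory automorphism
extends to an involution on the representation space. -/
theorem exists_involution {V : Type} [AddCommGroup V] [Module ℂ V]
    [FiniteDimensional ℂ V] {ρ : Representation ℂ G V} (hρ : ρ.IsIrreducible) {γ : MulAut G}
    (hγ : ∀ k, γ (γ k) = k) (h : ∀ k, ρ.character (γ k) = ρ.character k) :
    ∃ T : V →ₗ[ℂ] V, T * T = 1 ∧ ∀ k, T * ρ k = ρ (γ k) * T := by
  obtain ⟨e, he⟩ := exists_equiv_of_character_eq (σ := MonoidHom.comp ρ γ.toMonoidHom) hρ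
    (funext fun k => (h k).symm)
  set A : V →ₗ[ℂ] V := e.toLinearMap with hA
  have hA' : ∀ k, A * ρ k = ρ (γ k) * A := fun k => LinearMap.ext fun v => he k v
  obtain ⟨c, hc⟩ := schur_scalar hρ (A * A) fun k => by
    rw [mul_assoc, hA', ← mul_assoc, hA', hγ, mul_assoc]
  have hn0 := finrank_ne_zero_of_isIrreducible hρ
  have hc0 : c ≠ 0 := by
    rintro rfl
    rw [zero_smul] at hc
    apply hn0
    rw [Nat.cast_eq_zero, Module.finrank_zero_iff]
    refine ⟨fun a b => e.injective (e.injective ?_)⟩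
    exact (LinearMap.congr_fun hc a).trans (LinearMap.congr_fun hc b).symm
  obtain ⟨s, hs⟩ := IsAlgClosed.exists_eq_mul_self c
  have hs0 : s ≠ 0 := by rintro rfl; simp [hs] at hc0
  refine ⟨s⁻¹ • A, ?_, fun k => ?_⟩
  · rw [smul_mul_smul_comm, hc, smul_smul, hs]
    field_simp
    rw [one_smul]
  · rw [smul_mul_assoc, hA', mul_smul_comm]

end Irreducibles

/-- A family of involutions intertwining an irreducible representation with its twists by an
action of a group. -/
structure IsTwistFamily {P K V : Type} [CommGroup P] [Group K] [AddCommGroup V] [Module ℂ V]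
    (s : P →* MulAut K) (ρ : Representation ℂ K V) (T : P → V →ₗ[ℂ] V) : Prop where
  irr : ρ.IsIrreducible
  sq : ∀ h, T h * T h = 1
  comm : ∀ h k, T h * ρ k = ρ (s h k) * T h

/-- The restriction of an action of a commutative group to the fixed points of an involution. -/
def fixAction {P K : Type} [CommGroup P] [Group K] (hP : ∀ h : P, h * h = 1)
    (s : P →* MulAut K) (g : P) : P →* MulAut (fixSub (s g)) :=
  have hs : ∀ h : P, ∀ k, s h (s h k) = k := fun h k => by
    rw [← MulAut.mul_apply, ← map_mul, hP, map_one, MulAut.one_apply]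
  have hmem : ∀ h : P, ∀ c : fixSub (s g), s h c ∈ fixSub (s g) := fun h c => by
    change s g (s h c) = s h c
    rw [← MulAut.mul_apply, ← map_mul, mul_comm, map_mul, MulAut.mul_apply]
    exact congrArg (s h) c.2
  { toFun := fun h =>
      { toFun := fun c => ⟨s h c, hmem h c⟩
        invFun := fun c => ⟨s h c, hmem h c⟩
        left_inv := fun c => Subtype.ext (hs h c)
        right_inv := fun c => Subtype.ext (hs h c)
        map_mul' := fun a b => Subtype.ext (map_mul (s h) (a : K) b) }
    map_one' := by ext; simp
    map_mul' := fun a b => by ext; simp }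

section Twist

variable {P K V : Type} [CommGroup P] [Group K] [Finite K] [AddCommGroup V] [Module ℂ V]
  [FiniteDimensional ℂ V] {s : P →* MulAut K} {ρ : Representation ℂ K V} {T : P → V →ₗ[ℂ] V}

theorem aut_involutive (hP : ∀ h : P, h * h = 1) (s : P →* MulAut K) (h : P) (k : K) :
    s h (s h k) = k := by
  rw [← MulAut.mul_apply, ← map_mul, hP, map_one, MulAut.one_apply]

theorem aut_comm (s : P →* MulAut K) (g h : P) (k : K) : s h (s g k) = s g (s h k) := by
  rw [← MulAut.mul_apply, ← map_mul, mul_comm, map_mul, MulAut.mul_apply]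

namespace IsTwistFamily

theorem odd_finrank (hT : IsTwistFamily s ρ T) (hK : Odd (Nat.card K)) :
    Odd (Module.finrank ℂ V) :=
  hK.of_dvd_nat (finrank_dvd_card hT.irr)

theorem trace_ne_zero (hT : IsTwistFamily s ρ T) (hK : Odd (Nat.card K)) (h : P) :
    LinearMap.trace ℂ V (T h) ≠ 0 := by
  obtain ⟨a, b, hab, hd, -⟩ := exists_trace_involution (hT.sq h)
  have := hT.odd_finrank hK
  rw [hab, sub_ne_zero]
  intro he
  rw [Nat.cast_inj] at he
  rw [← hd, he] at this
  exact (Nat.not_odd_iff_even.2 ⟨b, rfl⟩) this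

theorem norm_trace_le (hT : IsTwistFamily s ρ T) (h : P) :
    ‖LinearMap.trace ℂ V (T h)‖ ≤ Module.finrank ℂ V := by
  obtain ⟨a, b, hab, hd, -⟩ := exists_trace_involution (hT.sq h)
  rw [hab, ← hd]
  calc ‖(a : ℂ) - b‖ ≤ ‖(a : ℂ)‖ + ‖(b : ℂ)‖ := norm_sub_le _ _
    _ = _ := by simp

theorem comm_op (hT : IsTwistFamily s ρ T) (hK : Odd (Nat.card K)) (hP : ∀ h : P, h * h = 1)
    (g h : P) : T h * T g = T g * T h := by
  obtain ⟨μ, hμ⟩ := schur_scalar hT.irr (T h * T g * T h * T g) fun k => by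
    rw [mul_assoc, hT.comm, ← mul_assoc, mul_assoc _ _ (ρ _), hT.comm, ← mul_assoc,
      mul_assoc _ _ (ρ _), hT.comm, ← mul_assoc, hT.comm, aut_comm s h g, aut_involutive hP,
      aut_involutive hP]
    simp only [mul_assoc]
  have h1 : T h * T g * T h = μ • T g := by
    have := congrArg (· * T g) hμ
    simpa [mul_assoc, hT.sq] using this
  have h2 : LinearMap.trace ℂ V (T h * T g * T h) = LinearMap.trace ℂ V (T g) := by
    rw [LinearMap.trace_mul_comm, ← mul_assoc, hT.sq, one_mul]
  rw [h1, map_smul, smul_eq_mul] at h2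
  have h3 : μ = 1 := by
    have := hT.trace_ne_zero hK g
    exact mul_right_cancel₀ this (by rw [h2, one_mul])
  rw [h3, one_smul] at h1
  calc T h * T g = T h * T g * T h * T h := by rw [mul_assoc, hT.sq, mul_one]
    _ = _ := by rw [h1]

theorem norm_trace_mul (hT : IsTwistFamily s ρ T) (hK : Odd (Nat.card K))
    (hP : ∀ h : P, h * h = 1) (g h : P) :
    ‖LinearMap.trace ℂ V (T h * T g)‖ = ‖LinearMap.trace ℂ V (T (h * g))‖ := by
  obtain ⟨μ, hμ⟩ := schur_scalar hT.irr (T h * T g * T (h * g)) fun k => by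
    rw [mul_assoc, hT.comm, ← mul_assoc, mul_assoc _ _ (ρ _), hT.comm, ← mul_assoc, hT.comm,
      ← MulAut.mul_apply, ← MulAut.mul_apply, ← map_mul, ← map_mul, ← mul_assoc,
      mul_assoc (h * g), hP, map_one, MulAut.one_apply]
    simp only [mul_assoc]
  have h1 : T h * T g = μ • T (h * g) := by
    have := congrArg (· * T (h * g)) hμ
    simpa [mul_assoc, hT.sq] using this
  have h2 : (T h * T g) * (T h * T g) = 1 := by
    rw [mul_assoc, ← mul_assoc (T g), hT.comm_op hK hP h g, mul_assoc, hT.sq, mul_one, hT.sq]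
  rw [h1, smul_mul_smul_comm, hT.sq] at h2
  have h3 := congrArg (LinearMap.trace ℂ V) h2
  rw [map_smul, smul_eq_mul, mul_eq_right₀] at h3
  · have h4 : ‖μ‖ = 1 := by
      have := congrArg norm h3
      rw [norm_mul, norm_one] at this
      nlinarith [norm_nonneg μ]
    rw [h1, map_smul, norm_smul, h4, one_mul]
  · rw [LinearMap.trace_one]
    exact finrank_ne_zero_of_isIrreducible hT.irr

theorem exists_fixed_family (hT : IsTwistFamily s ρ T) (hK : Odd (Nat.card K))
    (hP : ∀ h : P, h * h = 1) (g : P) :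
    ∃ (m : ℕ) (τ : Representation ℂ (fixSub (s g)) (Fin m → ℂ)) (B : P → _),
      IsTwistFamily (fixAction hP s g) τ B ∧
      ∀ h, LinearMap.trace ℂ V (T h) * LinearMap.trace ℂ V (T g) *
        LinearMap.trace ℂ V (T h * T g) =
          Module.finrank ℂ V * (LinearMap.trace ℂ _ (B h)) ^ 2 := by
  set d := Module.finrank ℂ V
  have hd0 : (d : ℂ) ≠ 0 := finrank_ne_zero_of_isIrreducible hT.irr
  let Ψ : K → ℂ := fun k => LinearMap.trace ℂ V (ρ k * T g)
  have hΨ : ∀ y k, Ψ (y * k * (s g y)⁻¹) = Ψ k := fun y k => by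
    simp only [Ψ]
    rw [← map_inv, map_mul ρ, mul_assoc, ← hT.comm, map_mul ρ, mul_assoc, LinearMap.trace_mul_comm,
      mul_assoc, mul_assoc, rep_inv_mul, mul_one]
  have hΨ' : ∀ y k, LinearMap.trace ℂ V (ρ (y * k * (s g y)⁻¹)⁻¹ * T g) =
      LinearMap.trace ℂ V (ρ k⁻¹ * T g) := fun y k => by
    rw [show (y * k * (s g y)⁻¹)⁻¹ = s g y * (k⁻¹ * y⁻¹) by group, map_mul ρ,
      LinearMap.trace_mul_comm, ← mul_assoc, hT.comm, aut_involutive hP, map_mul ρ,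
      LinearMap.trace_mul_comm, mul_assoc, ← mul_assoc (ρ y⁻¹), rep_inv_mul, one_mul]
  have hcomm : ∀ c : fixSub (s g), T g * ρ c = ρ c * T g := fun c => by
    rw [hT.comm, mem_fixSub.1 c.2]
  let ρC : Representation ℂ (fixSub (s g)) V := MonoidHom.comp ρ (fixSub (s g)).subtype
  obtain ⟨χ, ψ, hχ, hψ, hn⟩ := exists_sub_character ρC (hT.sq g) hcomm
  have hip : ip (χ - ψ) (χ - ψ) = 1 := by
    rw [← hn, ip]
    have h1 := avg_eq_avg_fixSub hK (aut_involutive hP s g)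
      (fun k => Ψ k * LinearMap.trace ℂ V (ρ k⁻¹ * T g)) fun y k => by rw [hΨ, hΨ']
    have h2 := avg_trace_mul_trace hT.irr (T g) (T g)
    rw [hT.sq, LinearMap.trace_one, div_self hd0] at h2
    exact h1.symm.trans h2
  obtain ⟨β, hβ, ε, hε, hn'⟩ := exists_irr_of_ip_sub_self hχ hψ hip
  have hnβ : ∀ c : fixSub (s g), Ψ c = ε * β c := fun c => by
    have := congrFun (hn.trans hn') c
    exact this
  have hε0 : ε ≠ 0 := by rcases hε with rfl | rfl <;> norm_num
  have hεε : ε * ε = 1 := by rcases hε with rfl | rfl <;> norm_num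
  obtain ⟨m, τ, hτ, hβτ, -, hβ1⟩ := hβ.exists_rep
  have hinv : ∀ h c, τ.character (fixAction hP s g h c) = τ.character c := fun h c => by
    rw [← hβτ]
    apply mul_left_cancel₀ hε0
    rw [← hnβ, ← hnβ]
    change LinearMap.trace ℂ V (ρ (s h c) * T g) = LinearMap.trace ℂ V (ρ c * T g)
    have : ρ (s h c) = T h * ρ c * T h := by rw [hT.comm, mul_assoc, hT.sq, mul_one]
    rw [this, mul_assoc, hT.comm_op hK hP g h, ← mul_assoc, LinearMap.trace_mul_comm, ← mul_assoc,
      ← mul_assoc, hT.sq, one_mul]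
  choose B hB using fun h => exists_involution hτ (aut_involutive hP (fixAction hP s g) h) (hinv h)
  refine ⟨m, τ, B, ⟨hτ, fun h => (hB h).1, fun h => (hB h).2⟩, fun h => ?_⟩
  have hm0 : (m : ℂ) ≠ 0 := by
    have := finrank_ne_zero_of_isIrreducible hτ
    rwa [Module.finrank_fin_fun] at this
  have hg : LinearMap.trace ℂ V (T g) = ε * m := by
    have := hnβ 1
    simpa [Ψ, hβ1] using this
  have e1 := avg_trace_conj hT.irr (T h * T g) (T h)
  have e2 := avg_twisted_eq_avg_fixSub hK (aut_involutive hP s h) (aut_involutive hP s g)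
    (aut_comm s g h) Ψ hΨ
  have e3 : ∀ k, LinearMap.trace ℂ V (ρ k * (T h * T g) * ρ k⁻¹ * T h) =
      Ψ (s h k * (s g k)⁻¹) := fun k => by
    rw [LinearMap.trace_mul_comm, ← mul_assoc, ← mul_assoc, hT.comm,
      mul_assoc _ (T h) (T h * T g), ← mul_assoc (T h) (T h), hT.sq, one_mul, mul_assoc, hT.comm, ← mul_assoc, ← map_mul ρ, map_inv]
  have e4 : ∀ c : fixSub (s g), Ψ (s h c * (c : K)⁻¹) =
      ε * LinearMap.trace ℂ _ (τ c * B h * τ c⁻¹ * B h) := fun c => by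
    have := hnβ (fixAction hP s g h c * c⁻¹)
    refine this.trans ?_
    rw [hβτ, Representation.character, map_mul τ]
    have h5 : τ (fixAction hP s g h c) = B h * τ c * B h := by
      rw [(hB h).2, mul_assoc, (hB h).1, mul_one]
    rw [h5, LinearMap.trace_mul_comm ℂ (τ c * B h * τ c⁻¹) (B h)]
    simp only [mul_assoc]
  simp only [e3, e4] at e1 e2
  rw [avg_mul_left, avg_trace_conj hτ, Module.finrank_fin_fun] at e2
  rw [e1, div_eq_iff hd0] at e2
  rw [hg, mul_comm (LinearMap.trace ℂ V (T h)), mul_assoc, mul_comm (LinearMap.trace ℂ V (T h)), e2]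
  field_simp
  linear_combination (LinearMap.trace ℂ _ (B h)) ^ 2 * hεε

end IsTwistFamily

end Twist

section SignCharacters

variable {P : Type} [CommGroup P] [Finite P]

/-- The real value of a sign character. -/
def signVal (α : P →* ℤˣ) (h : P) : ℝ := ((α h : ℤˣ) : ℤ)

theorem signVal_eq (α : P →* ℤˣ) (h : P) : signVal α h = 1 ∨ signVal α h = -1 := by
  rcases Int.units_eq_one_or (α h) with h' | h' <;> simp [signVal, h']

theorem signVal_mul (α : P →* ℤˣ) (g h : P) : signVal α (g * h) = signVal α g * signVal α h := by
  simp [signVal]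

theorem signVal_mul' (α β : P →* ℤˣ) (h : P) : signVal (α * β) h = signVal α h * signVal β h := by
  simp [signVal]

theorem signVal_one (α : P →* ℤˣ) : signVal α 1 = 1 := by simp [signVal]

theorem signVal_one' (h : P) : signVal (1 : P →* ℤˣ) h = 1 := by simp [signVal]

theorem exists_signVal_eq_neg_one {α : P →* ℤˣ} (hα : α ≠ 1) : ∃ h, signVal α h = -1 := by
  by_contra! hc
  apply hα
  ext h
  have := (signVal_eq α h).resolve_right (hc h)
  have h2 : ((α h : ℤˣ) : ℤ) = 1 := by
    have h3 : (((α h : ℤˣ) : ℤ) : ℝ) = 1 := this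
    exact_mod_cast h3
  simpa using h2

theorem hasEnoughRootsOfUnity_int_two : HasEnoughRootsOfUnity ℤ 2 where
  prim := ⟨-1, IsPrimitiveRoot.neg_one 0 (by norm_num)⟩
  cyc := inferInstance

theorem exists_signVal_ne (hP : ∀ h : P, h * h = 1) {h : P} (hh : h ≠ 1) :
    ∃ α : P →* ℤˣ, signVal α h = -1 := by
  have h1 : Monoid.exponent P ∣ 2 := Monoid.exponent_dvd_of_forall_pow_eq_one fun g => by
    rw [pow_two, hP]
  have h2 : Monoid.exponent P = 2 := by
    rcases (Nat.dvd_prime Nat.prime_two).1 h1 with h3 | h3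
    · exact absurd (by simpa [h3] using Monoid.pow_exponent_eq_one h) hh
    · exact h3
  have : HasEnoughRootsOfUnity ℤ (Monoid.exponent P) := by
    rw [h2]
    exact hasEnoughRootsOfUnity_int_two
  obtain ⟨α, hα⟩ := CommGroup.exists_apply_ne_one_of_hasEnoughRootsOfUnity P ℤ hh
  refine ⟨α, ?_⟩
  rcases Int.units_eq_one_or (α h) with h' | h'
  · exact absurd h' hα
  · simp [signVal, h']

instance : Finite (P →* ℤˣ) := Finite.of_injective _ DFunLike.coe_injective

instance : Fintype (P →* ℤˣ) := Fintype.ofFinite _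

theorem sum_signVal (hP : ∀ h : P, h * h = 1) (h : P) :
    ∑ α : P →* ℤˣ, signVal α h = if h = 1 then (Fintype.card (P →* ℤˣ) : ℝ) else 0 := by
  split_ifs with hh
  · subst hh
    simp [signVal_one]
  · obtain ⟨β, hβ⟩ := exists_signVal_ne hP hh
    have : ∑ α : P →* ℤˣ, signVal (β * α) h = ∑ α : P →* ℤˣ, signVal α h :=
      Equiv.sum_comp (Equiv.mulLeft β) (fun α => signVal α h)
    simp only [signVal_mul', hβ, ← Finset.mul_sum] at this
    linarith

variable [Fintype P]

/-- Fourier coefficients with respect to sign characters. -/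
def signCoeff (f : P → ℝ) (α : P →* ℤˣ) : ℝ :=
  (Fintype.card (P →* ℤˣ) : ℝ)⁻¹ * ∑ x, signVal α x * f x

theorem sum_signCoeff (hP : ∀ h : P, h * h = 1) (f : P → ℝ) (h : P) :
    ∑ α, signCoeff f α * signVal α h = f h := by
  have hN : (Fintype.card (P →* ℤˣ) : ℝ) ≠ 0 := Nat.cast_ne_zero.2 Fintype.card_ne_zero
  have h1 : ∀ α, signCoeff f α * signVal α h =
      (Fintype.card (P →* ℤˣ) : ℝ)⁻¹ * ∑ x, signVal α (x * h) * f x := fun α => by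
    rw [signCoeff, mul_assoc, Finset.sum_mul]
    congr 1
    refine Finset.sum_congr rfl fun x _ => ?_
    rw [signVal_mul]
    ring
  simp only [h1]
  rw [← Finset.mul_sum, Finset.sum_comm]
  simp only [← Finset.sum_mul, sum_signVal hP]
  rw [Finset.sum_eq_single h]
  · rw [hP, if_pos rfl, inv_mul_cancel_left₀ hN]
  · intro x _ hx
    rw [if_neg, zero_mul]
    intro hxh
    apply hx
    rw [← mul_one x, ← hP h, ← mul_assoc, hxh, one_mul]
  · simp

theorem sum_signVal_eq_zero {α : P →* ℤˣ} (hα : α ≠ 1) : ∑ h, signVal α h = 0 := by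
  obtain ⟨g, hg⟩ := exists_signVal_eq_neg_one hα
  have : ∑ h, signVal α (g * h) = ∑ h, signVal α h :=
    Equiv.sum_comp (Equiv.mulLeft g) (fun h => signVal α h)
  simp only [signVal_mul, hg, ← Finset.mul_sum] at this
  linarith

/-- A positivity statement for exponentials of nonnegative combinations of sign characters. -/
theorem sum_sign_mul_prod_exp (w : (P →* ℤˣ) → ℝ) (A : Finset (P →* ℤˣ)) (hw : ∀ α ∈ A, 0 ≤ w α)
    (ε : P →* ℤˣ) :
    0 ≤ ∑ h, signVal ε h * ∏ α ∈ A, Real.exp (w α * signVal α h) ∧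
    (0 < ∑ h, signVal ε h * ∏ α ∈ A, Real.exp (w α * signVal α h) ∨
      ∃ h, signVal ε h = -1 ∧ ∀ α ∈ A, w α = 0 ∨ signVal α h = 1) := by
  induction A using Finset.induction_on generalizing ε with
  | empty =>
    simp only [Finset.prod_empty, mul_one, Finset.notMem_empty, false_imp_iff, implies_true,
      and_true]
    by_cases hε : ε = 1
    · subst hε
      simp [signVal_one', Fintype.card_pos]
    · exact ⟨(sum_signVal_eq_zero hε).ge, Or.inr (exists_signVal_eq_neg_one hε)⟩
  | insert β A hβ ih =>
    have hA := fun α hα => hw α (Finset.mem_insert_of_mem hα)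
    have hexp : ∀ h, Real.exp (w β * signVal β h) =
        Real.cosh (w β) + signVal β h * Real.sinh (w β) := fun h => by
      rcases signVal_eq β h with h1 | h1 <;> rw [h1]
      · rw [mul_one, one_mul, Real.cosh_add_sinh]
      · rw [mul_neg_one, ← Real.cosh_sub_sinh]
        ring
    have key : ∑ h, signVal ε h * ∏ α ∈ insert β A, Real.exp (w α * signVal α h) =
        Real.cosh (w β) * ∑ h, signVal ε h * ∏ α ∈ A, Real.exp (w α * signVal α h) +
        Real.sinh (w β) * ∑ h, signVal (ε * β) h * ∏ α ∈ A, Real.exp (w α * signVal α h) := by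
      rw [Finset.mul_sum, Finset.mul_sum, ← Finset.sum_add_distrib]
      refine Finset.sum_congr rfl fun h _ => ?_
      rw [Finset.prod_insert hβ, hexp, signVal_mul']
      ring
    obtain ⟨i1, i2⟩ := ih hA ε
    obtain ⟨j1, j2⟩ := ih hA (ε * β)
    have hc := Real.cosh_pos (w β)
    rcases (hw β (Finset.mem_insert_self _ _)).eq_or_lt with h0 | h0
    · rw [key, ← h0, Real.cosh_zero, Real.sinh_zero, one_mul, zero_mul, add_zero]
      refine ⟨i1, i2.imp_right fun ⟨h, h1, h2⟩ => ⟨h, h1, fun α hα => ?_⟩⟩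
      rcases Finset.mem_insert.1 hα with rfl | hα
      · exact Or.inl h0.symm
      · exact h2 α hα
    · have hs := Real.sinh_pos_iff.2 h0
      rw [key]
      refine ⟨add_nonneg (mul_nonneg hc.le i1) (mul_nonneg hs.le j1), ?_⟩
      rcases i2 with i2 | ⟨g, g1, g2⟩
      · exact Or.inl (add_pos_of_pos_of_nonneg (mul_pos hc i2) (mul_nonneg hs.le j1))
      rcases j2 with j2 | ⟨k, k1, k2⟩
      · exact Or.inl (add_pos_of_nonneg_of_pos (mul_nonneg hc.le i1) (mul_pos hs j2))
      right
      rw [signVal_mul'] at k1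
      rcases signVal_eq β g with hg | hg
      · refine ⟨g, g1, fun α hα => ?_⟩
        rcases Finset.mem_insert.1 hα with rfl | hα
        · exact Or.inr hg
        · exact g2 α hα
      rcases signVal_eq β k with hk | hk
      · refine ⟨k, by rwa [hk, mul_one] at k1, fun α hα => ?_⟩
        rcases Finset.mem_insert.1 hα with rfl | hα
        · exact Or.inr hk
        · exact k2 α hα
      · refine ⟨g * k, ?_, fun α hα => ?_⟩
        · rw [signVal_mul, g1]
          rw [hk] at k1
          linarith
        · rcases Finset.mem_insert.1 hα with rfl | hα
          · right
            rw [signVal_mul, hg, hk]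
            norm_num
          · rcases g2 α hα with h2 | h2
            · exact Or.inl h2
            · rcases k2 α hα with h3 | h3
              · exact Or.inl h3
              · right
                rw [signVal_mul, h2, h3, one_mul]

end SignCharacters

section LogInequality

variable {P : Type} [CommGroup P] [Fintype P]

theorem IsTwistFamily.sum_log_nonneg (hP : ∀ h : P, h * h = 1) {α : P →* ℤˣ} (hα : α ≠ 1)
    (n : ℕ) : ∀ {K V : Type} [Group K] [Finite K] [AddCommGroup V] [Module ℂ V]
    [FiniteDimensional ℂ V] {s : P →* MulAut K} {ρ : Representation ℂ K V} {T : P → V →ₗ[ℂ] V},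
    IsTwistFamily s ρ T → Odd (Nat.card K) → Nat.card K = n →
    0 ≤ ∑ h, signVal α h * Real.log ‖LinearMap.trace ℂ V (T h)‖ := by
  induction n using Nat.strong_induction_on with
  | _ n ih =>
    intro K V _ _ _ _ _ s ρ T hT hK hn
    set d := Module.finrank ℂ V with hd
    have hd0 : (d : ℂ) ≠ 0 := finrank_ne_zero_of_isIrreducible hT.irr
    have hpos : ∀ h, ‖LinearMap.trace ℂ V (T h)‖ ≠ 0 := fun h =>
      norm_ne_zero_iff.2 (hT.trace_ne_zero hK h)
    by_cases hall : ∀ g, signVal α g = 1 → ‖LinearMap.trace ℂ V (T g)‖ = d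
    · have : ∑ h, signVal α h * Real.log ‖LinearMap.trace ℂ V (T h)‖ =
          ∑ h, signVal α h * (Real.log ‖LinearMap.trace ℂ V (T h)‖ - Real.log d) := by
        simp only [mul_sub, Finset.sum_sub_distrib, ← Finset.sum_mul, sum_signVal_eq_zero hα]
        ring
      rw [this]
      refine Finset.sum_nonneg fun h _ => ?_
      rcases signVal_eq α h with h1 | h1
      · rw [hall h h1, sub_self, mul_zero]
      · have := Real.log_le_log (lt_of_le_of_ne (norm_nonneg _) (hpos h).symm) (hT.norm_trace_le h)
        rw [h1]
        linarith
    · push Not at hall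
      obtain ⟨g, hg1, hg⟩ := hall
      obtain ⟨m, τ, B, hB, hrec⟩ := hT.exists_fixed_family hK hP g
      have hcard : Nat.card (fixSub (s g)) < n := by
        rw [← hn]
        refine lt_of_le_of_ne (Subgroup.card_le_card_group _) fun he => ?_
        have htop := (Subgroup.card_eq_iff_eq_top _).1 he
        apply hg
        obtain ⟨c, hc⟩ := schur_scalar hT.irr (T g) fun k => by
          rw [hT.comm, mem_fixSub.1 (by rw [htop]; trivial : k ∈ fixSub (s g))]
        have h2 := hT.sq g
        rw [hc, smul_mul_smul_comm, one_mul] at h2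
        have h3 := congrArg (LinearMap.trace ℂ V) h2
        rw [map_smul, LinearMap.trace_one, smul_eq_mul, mul_eq_right₀ hd0] at h3
        have h4 : ‖c‖ = 1 := by
          have := congrArg norm h3
          rw [norm_mul, norm_one] at this
          nlinarith [norm_nonneg c]
        rw [hc, map_smul, LinearMap.trace_one, norm_smul, h4, one_mul, Complex.norm_natCast]
      have hKC : Odd (Nat.card (fixSub (s g))) := hK.of_dvd_nat (Subgroup.card_subgroup_dvd_card _)
      have h5 := ih _ hcard hB hKC rfl
      have hlog : ∀ h, Real.log ‖LinearMap.trace ℂ V (T h)‖ +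
          Real.log ‖LinearMap.trace ℂ V (T g)‖ + Real.log ‖LinearMap.trace ℂ V (T (h * g))‖ =
          Real.log d + 2 * Real.log ‖LinearMap.trace ℂ _ (B h)‖ := fun h => by
        have h6 := congrArg (fun z => Real.log ‖z‖) (hrec h)
        have hBpos := norm_ne_zero_iff.2 (hB.trace_ne_zero hKC h)
        simp only [norm_mul, norm_pow, Complex.norm_natCast] at h6
        rw [hT.norm_trace_mul hK hP, Real.log_mul (mul_ne_zero (hpos _) (hpos _)) (hpos _),
          Real.log_mul (hpos _) (hpos _), Real.log_mul (by exact_mod_cast hd0)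
          (pow_ne_zero _ hBpos), Real.log_pow] at h6
        rw [h6, hd]
        norm_num
      have hsum := Finset.sum_congr rfl fun h (_ : h ∈ Finset.univ) =>
        congrArg (signVal α h * ·) (hlog h)
      simp only [mul_add, Finset.sum_add_distrib, ← Finset.sum_mul, sum_signVal_eq_zero hα,
        zero_mul, add_zero, zero_add] at hsum
      have hshift : ∑ h, signVal α h * Real.log ‖LinearMap.trace ℂ V (T (h * g))‖ =
          ∑ h, signVal α h * Real.log ‖LinearMap.trace ℂ V (T h)‖ := by
        rw [← Equiv.sum_comp (Equiv.mulRight g)]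
        refine Finset.sum_congr rfl fun h _ => ?_
        rw [Equiv.coe_mulRight, signVal_mul, hg1, mul_one, mul_assoc, hP, mul_one]
      rw [hshift] at hsum
      have h7 : ∑ h, signVal α h * (2 * Real.log ‖LinearMap.trace ℂ _ (B h)‖) =
          2 * ∑ h, signVal α h * Real.log ‖LinearMap.trace ℂ _ (B h)‖ := by
        rw [Finset.mul_sum]
        exact Finset.sum_congr rfl fun h _ => by ring
      rw [h7] at hsum
      linarith

end LogInequality

section SignSum

variable {P K V : Type} [CommGroup P] [Fintype P] [Group K] [Finite K] [AddCommGroup V]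
  [Module ℂ V] [FiniteDimensional ℂ V] {s : P →* MulAut K} {ρ : Representation ℂ K V}
  {T : P → V →ₗ[ℂ] V}

theorem IsTwistFamily.sum_trace_ne_zero (hT : IsTwistFamily s ρ T) (hK : Odd (Nat.card K))
    (hP : ∀ h : P, h * h = 1) (hmul : ∀ g h, T (g * h) = T g * T h) (hneg : ∀ h, T h ≠ -1) :
    ∑ h, LinearMap.trace ℂ V (T h) ≠ 0 := by
  set d := Module.finrank ℂ V with hd
  have hd0 : (d : ℂ) ≠ 0 := finrank_ne_zero_of_isIrreducible hT.irr
  have hdpos : (0 : ℝ) < d := Nat.cast_pos.2 (Nat.pos_of_ne_zero (by exact_mod_cast hd0))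
  have hT1 : T 1 = 1 := by
    rw [← hT.sq 1, ← hmul, one_mul]
  choose a b hab hadd ha _ using fun h => exists_trace_involution (hT.sq h)
  set F : P → ℝ := fun h => (a h : ℝ) - b h with hF
  have hFt : ∀ h, LinearMap.trace ℂ V (T h) = (F h : ℂ) := fun h => by
    rw [hab]
    simp [hF]
  have hF0 : ∀ h, F h ≠ 0 := fun h h0 => hT.trace_ne_zero hK h (by rw [hFt, h0, Complex.ofReal_zero])
  have hFnorm : ∀ h, ‖LinearMap.trace ℂ V (T h)‖ = |F h| := fun h => by
    rw [hFt, Complex.norm_real, Real.norm_eq_abs]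
  have hF1 : F 1 = d := by
    have := hFt 1
    rw [hT1, LinearMap.trace_one] at this
    exact_mod_cast this.symm
  have hprod : ∀ g h, 0 < F h * F g * F (h * g) := fun g h => by
    obtain ⟨m, τ, B, hB, hrec⟩ := hT.exists_fixed_family hK hP g
    have hKC : Odd (Nat.card (fixSub (s g))) := hK.of_dvd_nat (Subgroup.card_subgroup_dvd_card _)
    obtain ⟨a', b', hab', -⟩ := exists_trace_involution (hB.sq h)
    have h1 := hrec h
    have h2 := hB.trace_ne_zero hKC h
    rw [← hmul, hFt, hFt, hFt, hab'] at h1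
    rw [hab'] at h2
    have h3 : F h * F g * F (h * g) = d * ((a' : ℝ) - b') ^ 2 := by exact_mod_cast h1
    have h4 : ((a' : ℝ) - b') ≠ 0 := by exact_mod_cast h2
    rw [h3]
    positivity
  let ε : P →* ℤˣ := MonoidHom.mk' (fun h => if 0 < F h then 1 else -1) fun g h => by
    have h1 := hprod h g
    have hg := hF0 g
    have hh := hF0 h
    have hgh := hF0 (g * h)
    rcases lt_or_gt_of_ne hg with h2 | h2 <;> rcases lt_or_gt_of_ne hh with h3 | h3 <;>
      rcases lt_or_gt_of_ne hgh with h4 | h4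
    · have := mul_neg_of_pos_of_neg (mul_pos_of_neg_of_neg h2 h3) h4
      linarith
    · simp [h2.not_gt, h3.not_gt, h4]
    · simp [h2.not_gt, h3, h4.not_gt]
    · have := mul_neg_of_neg_of_pos (mul_neg_of_neg_of_pos h2 h3) h4
      linarith
    · simp [h2, h3.not_gt, h4.not_gt]
    · have := mul_neg_of_neg_of_pos (mul_neg_of_pos_of_neg h2 h3) h4
      linarith
    · have := mul_neg_of_pos_of_neg (mul_pos h2 h3) h4
      linarith
    · simp [h2, h3, h4]
  have hε : ∀ h, signVal ε h * |F h| = F h := fun h => by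
    rcases lt_or_gt_of_ne (hF0 h) with h2 | h2
    · have : signVal ε h = -1 := by simp [signVal, ε, h2.not_gt]
      rw [this, abs_of_neg h2]
      ring
    · have : signVal ε h = 1 := by simp [signVal, ε, h2]
      rw [this, abs_of_pos h2, one_mul]
  set w := signCoeff (fun h => Real.log |F h|) with hw
  have hwn : ∀ α ∈ Finset.univ.erase (1 : P →* ℤˣ), 0 ≤ w α := fun α hα => by
    have := hT.sum_log_nonneg hP (Finset.ne_of_mem_erase hα) _ hK rfl
    simp only [hFnorm] at this
    exact mul_nonneg (by positivity) this
  have hlog : ∀ h, Real.log |F h| = w 1 + ∑ α ∈ Finset.univ.erase (1 : P →* ℤˣ), w α * signVal α h :=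
    fun h => by
      rw [← sum_signCoeff hP (fun h => Real.log |F h|) h,
        ← Finset.add_sum_erase _ _ (Finset.mem_univ (1 : P →* ℤˣ)), signVal_one', mul_one]
  have habs : ∀ h, |F h| = Real.exp (w 1) *
      ∏ α ∈ Finset.univ.erase (1 : P →* ℤˣ), Real.exp (w α * signVal α h) := fun h => by
    rw [← Real.exp_sum, ← Real.exp_add, ← hlog, Real.exp_log (abs_pos.2 (hF0 h))]
  have hsum : ∑ h, F h = Real.exp (w 1) * ∑ h, signVal ε h *
      ∏ α ∈ Finset.univ.erase (1 : P →* ℤˣ), Real.exp (w α * signVal α h) := by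
    rw [Finset.mul_sum]
    refine Finset.sum_congr rfl fun h _ => ?_
    rw [← hε h, habs h]
    ring
  have hgoal : ∑ h, LinearMap.trace ℂ V (T h) = ((∑ h, F h : ℝ) : ℂ) := by
    rw [Complex.ofReal_sum]
    exact Finset.sum_congr rfl fun h _ => hFt h
  rw [hgoal, Complex.ofReal_ne_zero]
  rcases (sum_sign_mul_prod_exp w _ hwn ε).2 with h1 | ⟨h, h1, h2⟩
  · rw [hsum]
    exact (mul_pos (Real.exp_pos _) h1).ne'
  · exfalso
    have h3 : |F h| = d := by
      rw [← abs_of_pos hdpos, ← hF1, habs, habs]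
      congr 1
      refine Finset.prod_congr rfl fun α hα => ?_
      rcases h2 α hα with h4 | h4
      · rw [h4, zero_mul, zero_mul]
      · rw [h4, signVal_one]
    have h4 := hε h
    rw [h1, h3] at h4
    have h5 : ((a h + b h : ℕ) : ℝ) = d := by rw [hadd h]
    have h6 : (a h : ℝ) - b h = F h := rfl
    push_cast at h5
    have h7 : (a h : ℝ) = 0 := by linarith
    exact hneg h (ha h (by exact_mod_cast h7))

end SignSum

section AbelianQuotient

variable {A : Type} [CommGroup A] [Finite A]

instance : Finite (A →* ℂˣ) := by
  have : NeZero ((Monoid.exponent A : ℕ) : ℂ) :=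
    ⟨Nat.cast_ne_zero.2 (Monoid.exponent_ne_zero_of_finite)⟩
  have h := CommGroup.card_monoidHom_of_hasEnoughRootsOfUnity A ℂ
  exact Nat.finite_of_card_ne_zero (by rw [h]; exact Nat.card_pos.ne')

instance : Fintype (A →* ℂˣ) := Fintype.ofFinite _

theorem sum_linear_char (a : A) :
    ∑ μ : A →* ℂˣ, ((μ a : ℂˣ) : ℂ) = if a = 1 then (Nat.card A : ℂ) else 0 := by
  have : NeZero ((Monoid.exponent A : ℕ) : ℂ) :=
    ⟨Nat.cast_ne_zero.2 (Monoid.exponent_ne_zero_of_finite)⟩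
  split_ifs with ha
  · subst ha
    rw [← CommGroup.card_monoidHom_of_hasEnoughRootsOfUnity A ℂ]
    simp
  · obtain ⟨β, hβ⟩ := CommGroup.exists_apply_ne_one_of_hasEnoughRootsOfUnity A ℂ ha
    have h1 : ∑ μ : A →* ℂˣ, (((β * μ) a : ℂˣ) : ℂ) = ∑ μ : A →* ℂˣ, ((μ a : ℂˣ) : ℂ) :=
      Equiv.sum_comp (Equiv.mulLeft β) (fun μ : A →* ℂˣ => ((μ a : ℂˣ) : ℂ))
    simp only [MonoidHom.mul_apply, Units.val_mul, ← Finset.mul_sum] at h1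
    have h2 : ((β a : ℂˣ) : ℂ) - 1 ≠ 0 := sub_ne_zero.2 fun h => hβ (Units.ext h)
    refine (mul_eq_zero.1 (?_ : (((β a : ℂˣ) : ℂ) - 1) * _ = 0)).resolve_left h2
    rw [sub_mul, h1, one_mul, sub_self]

theorem isCharacter_linear {G : Type} [Group G] (μ : G →* ℂˣ) :
    IsCharacter G fun g => ((μ g : ℂˣ) : ℂ) := by
  let ρ : Representation ℂ G ℂ :=
    { toFun := fun g => ((μ g : ℂˣ) : ℂ) • 1
      map_one' := by simp
      map_mul' := fun g h => by
        rw [map_mul, Units.val_mul, smul_mul_smul_comm, one_mul] }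
  have : (fun g => ((μ g : ℂˣ) : ℂ)) = ρ.character := by
    ext g
    change _ = LinearMap.trace ℂ ℂ (((μ g : ℂˣ) : ℂ) • 1)
    simp [LinearMap.trace_one]
  rw [this]
  exact isCharacter_character ρ

variable {N : Type} [Group N] [Finite N]

theorem isIrrChar_linear_mul {θ : N → ℂ} (hθ : IsIrrChar N θ) (μ : N →* ℂˣ) :
    IsIrrChar N fun n => ((μ n : ℂˣ) : ℂ) * θ n := by
  refine isIrrChar_of_ip_self ((isCharacter_linear μ).mul hθ.1) ?_
  rw [← hθ.ip_self]
  unfold ip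
  congr 1
  ext g
  dsimp only
  rw [map_inv, Units.val_inv_eq_inv_val]
  have := (μ g).ne_zero
  field_simp

/-- Restriction of an irreducible character to the kernel of a map to a commutative group. -/
theorem IsIrrChar.res_ker_or {q : N →* A} (hq : Function.Surjective q) {θ : N → ℂ}
    (hθ : IsIrrChar N θ) : IsIrrChar q.ker (fun k => θ k) ∨
      ∃ μ : A →* ℂˣ, μ ≠ 1 ∧ ∀ n, μ (q n) ≠ 1 → θ n = 0 := by
  by_cases h : ∃ μ : A →* ℂˣ, μ ≠ 1 ∧ (fun n => ((μ (q n) : ℂˣ) : ℂ) * θ n) = θ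
  · obtain ⟨μ, hμ, h1⟩ := h
    refine Or.inr ⟨μ, hμ, fun n hn => ?_⟩
    have h2 : ((μ (q n) : ℂˣ) : ℂ) - 1 ≠ 0 := sub_ne_zero.2 fun h => hn (Units.ext h)
    refine (mul_eq_zero.1 (?_ : (((μ (q n) : ℂˣ) : ℂ) - 1) * _ = 0)).resolve_left h2
    rw [sub_mul, congrFun h1 n, one_mul, sub_self]
  · left
    push Not at h
    refine isIrrChar_of_ip_self (hθ.1.comp q.ker.subtype) ?_
    have h1 : ∑ μ : A →* ℂˣ, ip (fun n => ((μ (q n) : ℂˣ) : ℂ) * θ n) θ = 1 := by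
      rw [Finset.sum_eq_single 1]
      · rw [← hθ.ip_self]
        simp
      · intro μ _ hμ
        exact (isIrrChar_linear_mul hθ (μ.comp q)).ip_ne hθ (h μ hμ)
      · simp
    rw [← h1]
    unfold ip
    rw [← avg_sum, ← avg_extZero, ← avg_mul_right]
    have hidx : q.ker.index = Nat.card A := by
      rw [Subgroup.index_ker, MonoidHom.range_eq_top.2 hq, Subgroup.card_top]
    congr 1
    ext n
    simp only [mul_assoc]
    rw [← Finset.sum_mul, sum_linear_char, hidx]
    unfold extZero
    by_cases hn : q n = 1
    · rw [dif_pos (show n ∈ q.ker from hn), if_pos hn]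
      simp [mul_comm]
    · rw [dif_neg (show ¬ n ∈ q.ker from hn), if_neg hn]
      simp

end AbelianQuotient

section KeyLemma

variable {P N V : Type} [CommGroup P] [Fintype P] [Group N] [Finite N] [AddCommGroup V]
  [Module ℂ V] [FiniteDimensional ℂ V]

/-- The trivial character appears on a complement of an odd normal subgroup with elementary abelian
quotient of exponent two. -/
theorem sum_trace_complement_ne_zero (hP : ∀ h : P, h * h = 1) (q : N →* P) (i : P →* N)
    (hqi : ∀ h, q (i h) = h) (hK : Odd (Nat.card q.ker)) {ρ : Representation ℂ N V}
    (hρ : ρ.IsIrreducible) (hd : Odd (Module.finrank ℂ V))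
    (hdet : ∀ h, LinearMap.det (ρ (i h)) = 1) : ∑ h, LinearMap.trace ℂ V (ρ (i h)) ≠ 0 := by
  have hsq : ∀ h, ρ (i h) * ρ (i h) = 1 := fun h => by
    rw [← map_mul, ← map_mul, hP, map_one, map_one]
  have hirr : IsIrrChar q.ker (fun k => ρ.character k) := by
    refine ((isIrrChar_of_isIrreducible hρ).res_ker_or
      (fun h => ⟨i h, hqi h⟩ : Function.Surjective q)).resolve_right ?_
    rintro ⟨μ, hμ, h1⟩
    obtain ⟨h, hh⟩ : ∃ h, μ h ≠ 1 := by
      by_contra! hc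
      exact hμ (MonoidHom.ext hc)
    have h2 : LinearMap.trace ℂ V (ρ (i h)) = 0 := h1 (i h) (by rwa [hqi])
    obtain ⟨a, b, hab, hadd, -⟩ := exists_trace_involution (hsq h)
    rw [hab, sub_eq_zero] at h2
    have h3 : a = b := by exact_mod_cast h2
    rw [← hadd, h3, Nat.odd_iff] at hd
    omega
  let ρK : Representation ℂ q.ker V := ρ.comp q.ker.subtype
  have hρK : ρK.IsIrreducible := IsIrrChar.isIrreducible (ρ := ρK) hirr
  have hT : IsTwistFamily (MulAut.conjNormal.comp i : P →* MulAut q.ker) ρK (fun h => ρ (i h)) :=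
    { irr := hρK
      sq := hsq
      comm := fun h k => by
        change ρ (i h) * ρ k = ρ ((MulAut.conjNormal (i h) k : q.ker) : N) * ρ (i h)
        rw [MulAut.conjNormal_apply, ← map_mul, ← map_mul, inv_mul_cancel_right] }
  refine hT.sum_trace_ne_zero hK hP (fun g h => by rw [map_mul, map_mul]) fun h h1 => ?_
  have h2 := hdet h
  have h3 : ρ (i h) = (-1 : ℂ) • (1 : V →ₗ[ℂ] V) := by
    change ρ (i h) = -1 at h1
    rw [h1, neg_one_smul]
  rw [h3, LinearMap.det_smul, hd.neg_one_pow, map_one, mul_one] at h2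
  norm_num at h2

end KeyLemma

section FieldEndomorphism

theorem exists_ringHom_extending {S K L : Type} [CommRing S] [IsDomain S] [Field K] [Field L]
    [Algebra S K] [Algebra.IsAlgebraic S K] [FaithfulSMul S K] [IsAlgClosed L] (g : S →+* L)
    (hg : Function.Injective g) : ∃ σ : K →+* L, ∀ s, σ (algebraMap S K s) = g s := by
  let := g.toAlgebra
  have : FaithfulSMul S L := (faithfulSMul_iff_algebraMap_injective S L).2 hg
  exact ⟨(IsAlgClosed.lift : K →ₐ[S] L).toRingHom, fun s =>
    (IsAlgClosed.lift : K →ₐ[S] L).commutes s⟩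

theorem exists_ringHom_extending_equiv {E K : Type} [Field E] [Field K] [Algebra E K]
    [IsAlgClosed K] (τ : E →+* E) :
    ∃ σ : K →+* K, ∀ e, σ (algebraMap E K e) = algebraMap E K (τ e) := by
  obtain ⟨ι, x, hx⟩ := exists_isTranscendenceBasis' E K
  let S := Algebra.adjoin E (Set.range x)
  have : Algebra.IsAlgebraic S K := hx.isAlgebraic
  let g : S →+* K := ((MvPolynomial.aeval (R := E) x).toRingHom.comp (MvPolynomial.map τ)).comp
    hx.1.aevalEquiv.symm.toRingEquiv.toRingHom
  have hg : Function.Injective g :=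
    (Function.Injective.comp hx.1 (MvPolynomial.map_injective τ τ.injective)).comp
      hx.1.aevalEquiv.symm.injective
  obtain ⟨σ, hσ⟩ := exists_ringHom_extending (K := K) g hg
  refine ⟨σ, fun e => ?_⟩
  have h1 := hσ (algebraMap E S e)
  have h2 : hx.1.aevalEquiv.symm (algebraMap E S e) = MvPolynomial.C e :=
    hx.1.aevalEquiv.symm.commutes e
  rw [← IsScalarTower.algebraMap_apply] at h1
  rw [h1]
  change MvPolynomial.aeval x (MvPolynomial.map τ (hx.1.aevalEquiv.symm (algebraMap E S e))) = _
  rw [h2, MvPolynomial.map_C, MvPolynomial.aeval_C]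

theorem exists_ringHom_pow_of_cyclotomic (E : Type) [Field E] [CharZero E] (n : ℕ) [NeZero n]
    [IsCyclotomicExtension {n} ℚ E] {k : ℕ} (hk : k.Coprime n) :
    ∃ σ : ℂ →+* ℂ, ∀ z : ℂ, z ^ n = 1 → σ z = z ^ k := by
  have := IsCyclotomicExtension.finiteDimensional {n} ℚ E
  let : Algebra E ℂ := (IsAlgClosed.lift : E →ₐ[ℚ] ℂ).toRingHom.toAlgebra
  have hζ := IsCyclotomicExtension.zeta_spec n ℚ E
  have hirr := Polynomial.cyclotomic.irreducible_rat (NeZero.pos n)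
  have hμ := hζ.pow_of_coprime k hk
  obtain ⟨σ, hσ⟩ := exists_ringHom_extending_equiv (E := E) (K := ℂ)
    (IsCyclotomicExtension.fromZetaAut hμ hirr : E ≃ₐ[ℚ] E).toRingEquiv.toRingHom
  refine ⟨σ, fun z hz => ?_⟩
  have h1 := hσ (IsCyclotomicExtension.zeta n ℚ E)
  have h2 := IsCyclotomicExtension.fromZetaAut_spec hμ hirr
  have hζ' : IsPrimitiveRoot (algebraMap E ℂ (IsCyclotomicExtension.zeta n ℚ E)) n :=
    hζ.map_of_injective (algebraMap E ℂ).injective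
  obtain ⟨i, -, hi⟩ := hζ'.eq_pow_of_pow_eq_one hz
  have h3 : σ (algebraMap E ℂ (IsCyclotomicExtension.zeta n ℚ E)) =
      (algebraMap E ℂ (IsCyclotomicExtension.zeta n ℚ E)) ^ k := by
    rw [h1, ← map_pow]
    exact congrArg _ h2
  rw [← hi, map_pow, h3, ← pow_mul, ← pow_mul, mul_comm]

theorem exists_ringHom_pow (n : ℕ) [NeZero n] {k : ℕ} (hk : k.Coprime n) :
    ∃ σ : ℂ →+* ℂ, ∀ z : ℂ, z ^ n = 1 → σ z = z ^ k := by
  have : NeZero ((n : ℕ) : ℚ) := NeZero.charZero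
  have : IsCyclotomicExtension {n} ℚ (CyclotomicField n ℚ) :=
    CyclotomicField.isCyclotomicExtension n ℚ
  exact exists_ringHom_pow_of_cyclotomic (CyclotomicField n ℚ) n hk

end FieldEndomorphism

section LinearCharacters

variable {G : Type} [Group G] [Finite G]

theorem IsIrrChar.exists_linear {θ : G → ℂ} (hθ : IsIrrChar G θ) (h1 : θ 1 = 1) :
    ∃ μ : G →* ℂˣ, ∀ g, θ g = μ g := by
  obtain ⟨d, ρ, -, rfl, -, hd⟩ := hθ.exists_rep
  rw [h1] at hd
  obtain rfl : d = 1 := by exact_mod_cast hd.symm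
  refine ⟨(LinearMap.det.comp ρ).toHomUnits, fun g => ?_⟩
  change LinearMap.trace ℂ _ (ρ g) = LinearMap.det (ρ g)
  rw [LinearMap.trace_eq_matrix_trace ℂ (Pi.basisFun ℂ (Fin 1)),
    ← LinearMap.det_toMatrix (Pi.basisFun ℂ (Fin 1)), Matrix.det_fin_one, Matrix.trace_fin_one]

theorem IsIrrChar.degree_one_of_comm (hG : ∀ a b : G, a * b = b * a) {θ : G → ℂ}
    (hθ : IsIrrChar G θ) : θ 1 = 1 := by
  obtain ⟨d, ρ, hρ, rfl, -, hd⟩ := hθ.exists_rep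
  have hd0 : (d : ℂ) ≠ 0 := by simpa using finrank_ne_zero_of_isIrreducible hρ
  choose c hc using fun g => schur_scalar hρ (ρ g) fun k => by rw [← map_mul, ← map_mul, hG]
  have h1 := hθ.ip_self
  have h2 : ∀ g, ρ.character g * ρ.character g⁻¹ = (d : ℂ) * d := fun g => by
    have h3 := rep_mul_inv ρ g
    rw [hc g, hc g⁻¹, smul_mul_smul_comm, one_mul] at h3
    have h4 := congrArg (LinearMap.trace ℂ _) h3
    change LinearMap.trace ℂ _ (ρ g) * LinearMap.trace ℂ _ (ρ g⁻¹) = _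
    rw [hc g, hc g⁻¹]
    simp only [map_smul, LinearMap.trace_one, smul_eq_mul, Module.finrank_fintype_fun_eq_card,
      Fintype.card_fin] at h4 ⊢
    linear_combination (d : ℂ) * h4
  unfold ip at h1
  simp only [h2] at h1
  rw [avg_const] at h1
  have h5 : d * d = 1 := by exact_mod_cast h1
  rw [hd, Nat.eq_one_of_mul_eq_one_right h5, Nat.cast_one]

theorem IsCharacter.map_ringHom {χ : G → ℂ} (hχ : IsCharacter G χ) {n k : ℕ} {σ : ℂ →+* ℂ}
    (hσ : ∀ z : ℂ, z ^ n = 1 → σ z = z ^ k) {g : G} (hg : g ^ n = 1) : σ (χ g) = χ (g ^ k) := by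
  obtain ⟨s, hs, hsum⟩ := (hχ.comp (Subgroup.zpowers g).subtype).exists_sum_irr
  let c : Subgroup.zpowers g := ⟨g, Subgroup.mem_zpowers g⟩
  have h1 : ∀ x : Subgroup.zpowers g, χ x = (s.map fun ψ => ψ x).sum := fun x => by
    have := congrFun hsum x
    change χ x = Pi.evalAddMonoidHom (fun _ : Subgroup.zpowers g => ℂ) x s.sum at this
    rw [map_multiset_sum] at this
    exact this
  have h2 : χ g = χ (c : G) := rfl
  have h3 : χ (g ^ k) = χ ((c ^ k : Subgroup.zpowers g) : G) := rfl
  rw [h2, h3, h1, h1, map_multiset_sum, Multiset.map_map]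
  refine congrArg _ (Multiset.map_congr rfl fun ψ hψ => ?_)
  have hcomm : ∀ a b : Subgroup.zpowers g, a * b = b * a := by
    rintro ⟨_, i, rfl⟩ ⟨_, j, rfl⟩
    exact Subtype.ext (zpow_mul_comm g i j)
  obtain ⟨μ, hμ⟩ := (hs ψ hψ).exists_linear ((hs ψ hψ).degree_one_of_comm hcomm)
  have hc : c ^ n = 1 := Subtype.ext hg
  rw [Function.comp_apply, hμ, hμ, map_pow, Units.val_pow_eq_pow_val, hσ]
  rw [← Units.val_pow_eq_pow_val, ← map_pow, hc, map_one, Units.val_one]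

end LinearCharacters

section GaloisTwist

variable {G : Type} [Group G] [Finite G]

/-- The twist of a matrix representation by a ring endomorphism of the field. -/
def galRep (σ : ℂ →+* ℂ) {d : ℕ} (ρ : Representation ℂ G (Fin d → ℂ)) :
    Representation ℂ G (Fin d → ℂ) where
  toFun g := Matrix.toLin' (σ.mapMatrix (LinearMap.toMatrix' (ρ g)))
  map_one' := by
    rw [map_one, LinearMap.toMatrix'_one, map_one, Matrix.toLin'_one]
    rfl
  map_mul' g h := by
    rw [map_mul, LinearMap.toMatrix'_mul, map_mul, Matrix.toLin'_mul]
    rfl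

theorem trace_toLin' {d : ℕ} (A : Matrix (Fin d) (Fin d) ℂ) :
    LinearMap.trace ℂ _ (Matrix.toLin' A) = A.trace := by
  rw [LinearMap.trace_eq_matrix_trace ℂ (Pi.basisFun ℂ (Fin d)), LinearMap.toMatrix_eq_toMatrix',
    LinearMap.toMatrix'_toLin']

theorem galRep_character (σ : ℂ →+* ℂ) {d : ℕ} (ρ : Representation ℂ G (Fin d → ℂ)) (g : G) :
    (galRep σ ρ).character g = σ (ρ.character g) := by
  change LinearMap.trace ℂ _ (Matrix.toLin' _) = σ (LinearMap.trace ℂ _ (ρ g))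
  rw [trace_toLin', ← Matrix.toLin'_toMatrix' (ρ g), trace_toLin', Matrix.toLin'_toMatrix']
  simp [Matrix.trace]

theorem galRep_det (σ : ℂ →+* ℂ) {d : ℕ} (ρ : Representation ℂ G (Fin d → ℂ)) (g : G) :
    LinearMap.det (galRep σ ρ g) = σ (LinearMap.det (ρ g)) := by
  change LinearMap.det (Matrix.toLin' _) = σ (LinearMap.det (ρ g))
  rw [LinearMap.det_toLin', ← RingHom.map_det, LinearMap.det_toMatrix']

variable {A : Type} [CommGroup A] [Finite A]

/-- Reality of character values with trivial determinant over a complement of prime order. -/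
theorem character_inv_of_det_eq_one {q : G →* A} (hq : Function.Surjective q) {h : G}
    (hgen : ∀ μ : A →* ℂˣ, μ (q h) = 1 → μ = 1) {p : ℕ} (hp : p.Prime) (hh : h ^ p = 1)
    (hK : ¬ p ∣ Nat.card q.ker) {d : ℕ} {ρ : Representation ℂ G (Fin d → ℂ)}
    (hρ : ρ.IsIrreducible) (hdet : LinearMap.det (ρ h) = 1) :
    ρ.character h⁻¹ = ρ.character h := by
  rcases (isIrrChar_of_isIrreducible hρ).res_ker_or hq with hirr | ⟨μ, hμ, h1⟩
  swap
  · have h2 : μ (q h) ≠ 1 := fun h' => hμ (hgen μ h')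
    rw [h1 h h2, h1 h⁻¹ (by rwa [map_inv, map_inv, Ne, inv_eq_one])]
  set m := Nat.card q.ker with hm
  have hm0 : m ≠ 0 := Nat.card_pos.ne'
  have hco : m.Coprime p := ((Nat.Prime.coprime_iff_not_dvd hp).2 hK).symm
  obtain ⟨k, hk1, hk2⟩ := Nat.chineseRemainder hco 1 (p - 1)
  have hk : k.Coprime (m * p) := by
    refine Nat.Coprime.mul_right ?_ ?_
    · rw [Nat.Coprime, hk1.gcd_eq, Nat.gcd_one_left]
    · rw [Nat.Coprime, hk2.gcd_eq]
      exact (Nat.coprime_self_sub_left hp.one_lt.le).2 (Nat.coprime_one_left p)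
  have : NeZero (m * p) := ⟨mul_ne_zero hm0 hp.ne_zero⟩
  obtain ⟨σ, hσ⟩ := exists_ringHom_pow (m * p) hk
  have hχ := isCharacter_character ρ
  have hσK : ∀ x : q.ker, σ (ρ.character x) = ρ.character x := fun x => by
    have hx : (x : G) ^ m = 1 := by
      have := pow_card_eq_one' (x := x)
      exact congrArg Subtype.val this
    rw [hχ.map_ringHom hσ (by rw [pow_mul, hx, one_pow])]
    congr 1
    conv_rhs => rw [← pow_one (x : G)]
    exact pow_eq_pow_iff_modEq.2 (hk1.of_dvd (orderOf_dvd_of_pow_eq_one hx))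
  have hσh : σ (ρ.character h) = ρ.character h⁻¹ := by
    rw [hχ.map_ringHom hσ (by rw [mul_comm, pow_mul, hh, one_pow])]
    congr 1
    have h3 : h ^ k = h ^ (p - 1) :=
      pow_eq_pow_iff_modEq.2 (hk2.of_dvd (orderOf_dvd_of_pow_eq_one hh))
    rw [h3]
    refine eq_inv_of_mul_eq_one_left ?_
    rw [← pow_succ, Nat.sub_add_cancel hp.one_lt.le, hh]
  set ρ' := galRep σ ρ with hρ'
  let ρK : Representation ℂ q.ker (Fin d → ℂ) := ρ.comp q.ker.subtype
  let ρK' : Representation ℂ q.ker (Fin d → ℂ) := ρ'.comp q.ker.subtype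
  have hρK : ρK.IsIrreducible := IsIrrChar.isIrreducible (ρ := ρK) hirr
  obtain ⟨e, he⟩ := exists_equiv_of_character_eq (ρ := ρK) (σ := ρK') hρK (by
    ext x
    change ρ.character x = ρ'.character x
    rw [galRep_character, hσK])
  have heq : ∀ x ∈ q.ker, ∀ v, e (ρ x v) = ρ' x (e v) := fun x hx v => he ⟨x, hx⟩ v
  have hsymm : ∀ x ∈ q.ker, ∀ v, e.symm (ρ' x v) = ρ x (e.symm v) := fun x hx v => by
    rw [e.symm_apply_eq, heq x hx, e.apply_symm_apply]
  obtain ⟨c, hc⟩ := schur_scalar hρK (e.symm.conj (ρ' h) * ρ h⁻¹) fun x => by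
    refine LinearMap.ext fun v => ?_
    change e.symm (ρ' h (e (ρ h⁻¹ (ρ x v)))) = ρ x (e.symm (ρ' h (e (ρ h⁻¹ v))))
    have hx' : h⁻¹ * x * h ∈ q.ker := by
      have := q.normal_ker.conj_mem x x.2 h⁻¹
      rwa [inv_inv] at this
    rw [← hsymm x x.2, ← Module.End.mul_apply (ρ' x), ← map_mul, ← Module.End.mul_apply (ρ h⁻¹),
      ← map_mul, show h⁻¹ * (x : G) = (h⁻¹ * x * h) * h⁻¹ by group, map_mul, Module.End.mul_apply,
      heq _ hx', ← Module.End.mul_apply (ρ' h), ← map_mul,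
      show h * (h⁻¹ * (x : G) * h) = x * h by group, map_mul]
  have hconj : e.symm.conj (ρ' h) = c • ρ h := by
    have := congrArg (· * ρ h) hc
    simp only [mul_assoc, rep_inv_mul, mul_one, smul_mul_assoc, one_mul] at this
    exact this
  have hd1 : c ^ d = 1 := by
    have := congrArg LinearMap.det hconj
    have h8 : LinearMap.det (e.symm.conj (ρ' h)) = LinearMap.det (ρ' h) :=
      LinearMap.det_conj (ρ' h) e.symm
    rw [h8, galRep_det, hdet, map_one, LinearMap.det_smul, hdet, mul_one] at this
    simpa using this.symm
  have hd0 : d ≠ 0 := by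
    have := finrank_ne_zero_of_isIrreducible hρ
    simpa using this
  have hpc : c ^ p = 1 := by
    have h4 := congrArg (· ^ p) hconj
    have h5 : e.symm.conj (ρ' h) ^ p = 1 := by
      have : ∀ j : ℕ, e.symm.conj (ρ' h) ^ j = e.symm.conj (ρ' (h ^ j)) := fun j => by
        induction j with
        | zero =>
          rw [pow_zero, pow_zero, map_one]
          exact e.symm.conj_id.symm
        | succ j ih =>
          rw [pow_succ, ih, pow_succ h, map_mul]
          exact (e.symm.conj_comp _ _).symm
      rw [this, hh, map_one]
      exact e.symm.conj_id
    simp only [h5, smul_pow] at h4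
    rw [← map_pow, hh, map_one] at h4
    have h6 := congrArg (LinearMap.trace ℂ _) h4
    rw [map_smul, LinearMap.trace_one, smul_eq_mul] at h6
    have := finrank_ne_zero_of_isIrreducible hρ
    exact (mul_eq_right₀ this).1 h6.symm
  have hdm : d ∣ m := by
    have := finrank_dvd_card hρK
    rwa [Module.finrank_fintype_fun_eq_card, Fintype.card_fin] at this
  have hc1 : c = 1 := by
    have h7 : orderOf c ∣ Nat.gcd d p :=
      Nat.dvd_gcd (orderOf_dvd_of_pow_eq_one hd1) (orderOf_dvd_of_pow_eq_one hpc)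
    rw [Nat.Coprime.coprime_dvd_left hdm hco, Nat.dvd_one] at h7
    exact orderOf_eq_one_iff.1 h7
  rw [hc1, one_smul] at hconj
  rw [← hσh, ← galRep_character]
  change LinearMap.trace ℂ _ (ρ' h) = LinearMap.trace ℂ _ (ρ h)
  rw [← hconj, LinearMap.trace_conj']

end GaloisTwist

theorem IsPiNumber.of_dvd {σ : Set ℕ} {m n : ℕ} (h : IsPiNumber σ n) (hmn : m ∣ n) :
    IsPiNumber σ m := fun q hq hqm => h q hq (hqm.trans hmn)

theorem IsPiNumber.mul {σ : Set ℕ} {m n : ℕ} (hm : IsPiNumber σ m) (hn : IsPiNumber σ n) :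
    IsPiNumber σ (m * n) := fun q hq hqm => (hq.dvd_mul.1 hqm).elim (hm q hq) (hn q hq)

theorem isPiNumber_one (σ : Set ℕ) : IsPiNumber σ 1 :=
  fun _ hq h => absurd (Nat.dvd_one.1 h) hq.ne_one

theorem IsPiNumber.coprime {σ : Set ℕ} {m n : ℕ} (hm : IsPiNumber σ m) (hn : IsPiNumber σᶜ n) :
    m.Coprime n :=
  Nat.coprime_of_dvd fun _ hq h1 h2 => hn _ hq h2 (hm _ hq h1)

/-- `n` is a `σ`-number or a `σᶜ`-number. -/
def IsPiPure (σ : Set ℕ) (n : ℕ) : Prop := IsPiNumber σ n ∨ IsPiNumber σᶜ n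

theorem IsPiPure.of_dvd {σ : Set ℕ} {m n : ℕ} (h : IsPiPure σ n) (hmn : m ∣ n) : IsPiPure σ m :=
  h.imp (fun h => h.of_dvd hmn) fun h => h.of_dvd hmn

/-- A series of length `n`, each term normalized by the next, with pure factors. -/
def IsPiChain (σ : Set ℕ) {G : Type*} [Group G] (n : ℕ) (c : ℕ → Subgroup G) : Prop :=
  c 0 = ⊥ ∧ c n = ⊤ ∧ ∀ i < n, (∀ a ∈ c i, ∀ b ∈ c (i + 1), b * a * b⁻¹ ∈ c i) ∧
    IsPiPure σ ((c i).relIndex (c (i + 1)))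

/-- `G` possesses a series with pure factors. -/
def HasPiChain (σ : Set ℕ) (G : Type*) [Group G] : Prop :=
  ∃ (n : ℕ) (c : ℕ → Subgroup G), IsPiChain σ n c

theorem IsPiSeparable.hasPiChain {σ : Set ℕ} {G : Type} [Group G] (h : IsPiSeparable σ G) :
    HasPiChain σ G := by
  obtain ⟨n, c, h0, hn, hc⟩ := h
  refine ⟨n, fun i => if h : i < n + 1 then c ⟨i, h⟩ else ⊤, ?_, ?_, fun i hi => ?_⟩
  · simpa using h0
  · exact (dif_pos (Nat.lt_succ_self n)).trans hn
  · obtain ⟨hle, hnor, hp⟩ := hc ⟨i, hi⟩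
    have h1 : i < n + 1 := by omega
    have h2 : i + 1 < n + 1 := by omega
    simp only [h1, h2, dif_pos]
    refine ⟨fun a ha b hb => ?_, hp⟩
    have := hnor.conj_mem ⟨a, hle ha⟩ (Subgroup.mem_subgroupOf.2 ha) ⟨b, hb⟩
    exact Subgroup.mem_subgroupOf.1 this

section

variable {σ : Set ℕ} {A B : Type*} [Group A] [Group B]

theorem relIndex_dvd_of_normalized {a b L : Subgroup A} (hL : L ≤ b)
    (h : ∀ x ∈ a, ∀ y ∈ b, y * x * y⁻¹ ∈ a) : a.relIndex L ∣ a.relIndex b := by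
  have : (a.subgroupOf b).Normal :=
    ⟨fun x hx y => Subgroup.mem_subgroupOf.2 (h x (Subgroup.mem_subgroupOf.1 hx) y y.2)⟩
  have h2 := Subgroup.relIndex_dvd_index_of_normal (a.subgroupOf b) (L.subgroupOf b)
  rwa [Subgroup.relIndex_subgroupOf hL] at h2

theorem relIndex_comap_comap_dvd (f : A →* B) {a b : Subgroup B}
    (h : ∀ x ∈ a, ∀ y ∈ b, y * x * y⁻¹ ∈ a) :
    (a.comap f).relIndex (b.comap f) ∣ a.relIndex b := by
  rw [Subgroup.relIndex_comap]
  exact relIndex_dvd_of_normalized (Subgroup.map_comap_le f b) h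

theorem comap_normalized (f : A →* B) {a b : Subgroup B}
    (h : ∀ x ∈ a, ∀ y ∈ b, y * x * y⁻¹ ∈ a) :
    ∀ x ∈ a.comap f, ∀ y ∈ b.comap f, y * x * y⁻¹ ∈ a.comap f := fun x hx y hy => by
  simpa [Subgroup.mem_comap] using h (f x) hx (f y) hy

theorem HasPiChain.of_hom (f : A →* B) (hker : IsPiPure σ (Nat.card f.ker))
    (h : HasPiChain σ B) : HasPiChain σ A := by
  obtain ⟨n, c, h0, hn, hc⟩ := h
  refine ⟨n + 1, fun i => Nat.casesOn i ⊥ fun i => (c i).comap f, rfl, ?_, ?_⟩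
  · simp [hn]
  · rintro (_ | i) hi
    · refine ⟨fun a ha b _ => ?_, ?_⟩
      · have ha : a = 1 := by simpa using ha
        simp [ha]
      · simpa [h0, Subgroup.relIndex_bot_left] using hker
    · have := hc i (by omega)
      exact ⟨comap_normalized f this.1, this.2.of_dvd (relIndex_comap_comap_dvd f this.1)⟩

theorem HasPiChain.map {f : A →* B} (hf : Function.Surjective f) (h : HasPiChain σ A) :
    HasPiChain σ B := by
  obtain ⟨n, c, h0, hn, hc⟩ := h
  refine ⟨n, fun i => (c i).map f, by simp [h0], by
    simp [hn, Subgroup.map_top_of_surjective f hf], fun i hi => ⟨?_, ?_⟩⟩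
  · rintro _ ⟨a, ha, rfl⟩ _ ⟨b, hb, rfl⟩
    exact ⟨b * a * b⁻¹, (hc i hi).1 a ha b hb, by simp⟩
  · refine (hc i hi).2.of_dvd ?_
    rw [← Subgroup.relIndex_comap]
    exact Subgroup.relIndex_dvd_of_le_left _ (Subgroup.le_comap_map _ _)

theorem isPiNumber_card_sup {Y Z : Subgroup A} [Z.Normal] (hY : IsPiNumber σ (Nat.card Y))
    (hZ : IsPiNumber σ (Nat.card Z)) : IsPiNumber σ (Nat.card ↥(Y ⊔ Z)) := by
  have h := Subgroup.relIndex_mul_relIndex (⊥ : Subgroup A) Z (Y ⊔ Z) bot_le le_sup_right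
  rw [Subgroup.relIndex_bot_left, Subgroup.relIndex_bot_left, Subgroup.relIndex_sup_right] at h
  rw [← h]
  exact hZ.mul (hY.of_dvd (Subgroup.relIndex_dvd_card _ _))

/-- The largest normal `σ`-subgroup. -/
theorem exists_largest_normal (σ : Set ℕ) (A : Type*) [Group A] [Finite A] :
    ∃ O : Subgroup A, O.Normal ∧ IsPiNumber σ (Nat.card O) ∧
      ∀ Y : Subgroup A, Y.Normal → IsPiNumber σ (Nat.card Y) → Y ≤ O := by
  have hfin : {Y : Subgroup A | Y.Normal ∧ IsPiNumber σ (Nat.card Y)}.Finite := Set.toFinite _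
  obtain ⟨O, hO⟩ := hfin.exists_maximal ⟨⊥, inferInstance, by simpa using isPiNumber_one σ⟩
  refine ⟨O, hO.1.1, hO.1.2, fun Y hY hYc => ?_⟩
  have := hO.1.1
  exact le_sup_left.trans
    (hO.2 ⟨Subgroup.sup_normal Y O, isPiNumber_card_sup hYc hO.1.2⟩ le_sup_right)

theorem exists_largest_characteristic (σ : Set ℕ) (A : Type*) [Group A] [Finite A] :
    ∃ O : Subgroup A, O.Characteristic ∧ IsPiNumber σ (Nat.card O) ∧
      ∀ Y : Subgroup A, Y.Normal → IsPiNumber σ (Nat.card Y) → Y ≤ O := by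
  obtain ⟨O, hn, hc, hmax⟩ := exists_largest_normal σ A
  refine ⟨O, Subgroup.characteristic_iff_map_le.2 fun φ => hmax _ (hn.map _ φ.surjective) ?_,
    hc, hmax⟩
  rwa [Subgroup.card_map_of_injective φ.injective]

theorem exists_normal_pure_of_characteristic {N : Subgroup A} [N.Normal] [Finite A] {τ : Set ℕ}
    {Y : Subgroup N} (hY : Y.Normal) (hY1 : Y ≠ ⊥) (hYc : IsPiNumber τ (Nat.card Y)) :
    ∃ O : Subgroup A, O.Normal ∧ O ≠ ⊥ ∧ IsPiNumber τ (Nat.card O) := by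
  obtain ⟨O, hO, hOc, hmax⟩ := exists_largest_characteristic τ N
  refine ⟨O.map N.subtype, inferInstance, ?_, ?_⟩
  · rw [Ne, Subgroup.map_eq_bot_iff_of_injective _ N.subtype_injective]
    exact fun h => hY1 (le_bot_iff.1 (h ▸ hmax Y hY hYc))
  · rwa [Subgroup.card_map_of_injective N.subtype_injective]

end

theorem IsPiChain.exists_normal {σ : Set ℕ} (n : ℕ) : ∀ (A : Type) [Group A] [Finite A]
    [Nontrivial A] (c : ℕ → Subgroup A), IsPiChain σ n c →
      ∃ N : Subgroup A, N.Normal ∧ N ≠ ⊥ ∧ IsPiPure σ (Nat.card N) := by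
  induction n with
  | zero =>
    intro A _ _ _ c hc
    exact absurd (hc.1.symm.trans hc.2.1) bot_ne_top
  | succ n ih =>
    intro A _ _ _ c hc
    have hn : (c n).Normal := ⟨fun a ha b => (hc.2.2 n (by omega)).1 a ha b (by simp [hc.2.1])⟩
    by_cases h : c n = ⊥
    · refine ⟨⊤, inferInstance, top_ne_bot, ?_⟩
      have := (hc.2.2 n (by omega)).2
      rwa [h, hc.2.1, Subgroup.relIndex_bot_left] at this
    · have : Nontrivial (c n) := (Subgroup.nontrivial_iff_ne_bot _).2 h
      obtain ⟨Y, hY, hY1, hYc⟩ := ih (c n) (fun i => (c i).comap (c n).subtype)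
        ⟨by simp [hc.1, MonoidHom.comap_bot],
          by simp, fun i hi => ⟨comap_normalized _ (hc.2.2 i (by omega)).1,
          (hc.2.2 i (by omega)).2.of_dvd
            (relIndex_comap_comap_dvd _ (hc.2.2 i (by omega)).1)⟩⟩
      rcases hYc with hYc | hYc
      · obtain ⟨O, h1, h2, h3⟩ := exists_normal_pure_of_characteristic hY hY1 hYc
        exact ⟨O, h1, h2, Or.inl h3⟩
      · obtain ⟨O, h1, h2, h3⟩ := exists_normal_pure_of_characteristic hY hY1 hYc
        exact ⟨O, h1, h2, Or.inr h3⟩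

theorem HasPiChain.exists_normal_above {σ : Set ℕ} {A : Type} [Group A] [Finite A]
    (h : HasPiChain σ A) {M : Subgroup A} [M.Normal] (hM : M ≠ ⊤) :
    ∃ N : Subgroup A, N.Normal ∧ M < N ∧ IsPiPure σ (M.relIndex N) := by
  have hq := QuotientGroup.mk'_surjective M
  have : Nontrivial (A ⧸ M) := QuotientGroup.nontrivial_iff.2 hM
  obtain ⟨n, c, hc⟩ := h.map hq
  obtain ⟨N, h1, h2, h3⟩ := hc.exists_normal
  refine ⟨N.comap (QuotientGroup.mk' M), inferInstance, ?_, ?_⟩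
  · refine lt_of_le_of_ne (fun m hm => ?_) fun he => h2 ?_
    · rw [Subgroup.mem_comap, QuotientGroup.mk'_apply, (QuotientGroup.eq_one_iff m).2 hm]
      exact N.one_mem
    · rw [← Subgroup.map_comap_eq_self_of_surjective hq N, ← he]
      exact QuotientGroup.map_mk'_self M
  · have h4 := Subgroup.relIndex_ker (N.comap (QuotientGroup.mk' M)) (QuotientGroup.mk' M)
    rw [Subgroup.map_comap_eq_self_of_surjective hq, QuotientGroup.ker_mk'] at h4
    rwa [h4]

/-- The elements of `σ`-order in a coset of a normal `σᶜ`-subgroup are conjugate. -/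
theorem exists_conj_of_map_eq {σ : Set ℕ} {G Q : Type*} [Group G] [Finite G] [Group Q]
    (q : G →* Q) (hK : IsPiNumber σᶜ (Nat.card q.ker)) {g g' : G}
    (hg : IsPiNumber σ (orderOf g)) (hg' : IsPiNumber σ (orderOf g')) (h : q g' = q g) :
    ∃ x, x * g * x⁻¹ = g' := by
  have hm : IsPiNumber σ (orderOf g * orderOf g') := hg.mul hg'
  set m := orderOf g * orderOf g'
  have hco : m.Coprime (Nat.card q.ker) := hm.coprime hK
  obtain ⟨e, he1, he0⟩ := Nat.chineseRemainder hco 1 0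
  let S := {y : G // q y = q g ∧ y ^ m = 1}
  let act : MulAction q.ker S :=
    { smul := fun z s => ⟨(z : G) * s * (z : G)⁻¹, by
        have := z.2
        rw [MonoidHom.mem_ker] at this
        simp [this, s.2.1], by rw [conj_pow, s.2.2]; simp⟩
      one_smul := fun s => Subtype.ext (show ((1 : q.ker) : G) * s * ((1 : q.ker) : G)⁻¹ = s by simp)
      mul_smul := fun z w s => Subtype.ext
        (show ((z * w : q.ker) : G) * s * ((z * w : q.ker) : G)⁻¹ = z * (w * s * (w : G)⁻¹) * (z : G)⁻¹ by
          simp [mul_assoc]) }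
  have hsmul : ∀ (z : q.ker) (s : S), ((z • s : S) : G) = z * s * (z : G)⁻¹ := fun z s => rfl
  have hpow : ∀ (z : q.ker) (s : S), z • s = s → ((z : G) * s) ^ e = s := fun z s hzs => by
    have hc : Commute (z : G) s := by
      have := congrArg Subtype.val hzs
      rw [hsmul, mul_inv_eq_iff_eq_mul] at this
      exact this
    have h1 : (s : G) ^ e = s := by
      have := pow_eq_pow_of_modEq he1 s.2.2
      rwa [pow_one] at this
    have h2 : (z : G) ^ e = 1 := by
      have : z ^ e = 1 := orderOf_dvd_iff_pow_eq_one.1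
        ((orderOf_dvd_natCard z).trans ((Nat.modEq_zero_iff_dvd).1 he0))
      exact_mod_cast congrArg Subtype.val this
    rw [hc.mul_pow, h1, h2, one_mul]
  let F : (Σ z : q.ker, MulAction.fixedBy S z) → q.ker := fun p =>
    ⟨p.1 * (p.2 : S) * g⁻¹, by
      have := p.1.2
      rw [MonoidHom.mem_ker] at this ⊢
      rw [map_mul, map_mul, this, (p.2 : S).2.1, one_mul, map_inv, mul_inv_cancel]⟩
  have hF : Function.Injective F := by
    rintro ⟨z, s, hs⟩ ⟨w, t, ht⟩ hzw
    have h1 : (z : G) * s = w * t := mul_right_cancel (congrArg Subtype.val hzw)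
    have h2 : s = t := by
      refine Subtype.ext ?_
      rw [← hpow z s hs, ← hpow w t ht, h1]
    subst h2
    have h3 : z = w := Subtype.ext (mul_right_cancel h1)
    subst h3
    rfl
  have hcard := Nat.card_le_card_of_injective F hF
  rw [Nat.card_congr (MulAction.sigmaFixedByEquivOrbitsProdGroup q.ker S), Nat.card_prod] at hcard
  have hle : Nat.card (Quotient (MulAction.orbitRel q.ker S)) ≤ 1 :=
    Nat.le_of_mul_le_mul_right (by rwa [one_mul]) Nat.card_pos
  have hsub := Finite.card_le_one_iff_subsingleton.1 hle
  have hs : g ^ m = 1 := orderOf_dvd_iff_pow_eq_one.1 (dvd_mul_right _ _)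
  have hs' : g' ^ m = 1 := orderOf_dvd_iff_pow_eq_one.1 (dvd_mul_left _ _)
  obtain ⟨x, hx⟩ := Quotient.exact (hsub.elim (Quotient.mk (MulAction.orbitRel q.ker S)
    ⟨g', h, hs'⟩) (Quotient.mk (MulAction.orbitRel q.ker S) ⟨g, rfl, hs⟩))
  exact ⟨x, congrArg Subtype.val hx⟩

/-- Schur–Zassenhaus: a surjection with kernel of order coprime to its image splits. -/
theorem exists_section {Y X : Type*} [Group Y] [Finite Y] [Group X] {p : Y →* X}
    (hp : Function.Surjective p) (hco : (Nat.card p.ker).Coprime (Nat.card X)) :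
    ∃ s : X →* Y, ∀ x, p (s x) = x := by
  have hidx : p.ker.index = Nat.card X := by
    rw [Subgroup.index_ker, MonoidHom.range_eq_top.2 hp]
    exact Nat.card_congr Subgroup.topEquiv.toEquiv
  obtain ⟨H, hH⟩ := Subgroup.exists_right_complement'_of_coprime (N := p.ker) (by rwa [hidx])
  have hb : Function.Bijective (p.comp H.subtype) := by
    constructor
    · rw [← MonoidHom.ker_eq_bot_iff, eq_bot_iff]
      intro h hh
      have : (h : Y) ∈ p.ker ⊓ H := ⟨hh, h.2⟩
      rw [hH.disjoint.eq_bot] at this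
      simpa using this
    · intro x
      obtain ⟨y, rfl⟩ := hp x
      obtain ⟨⟨k, h⟩, hkh⟩ := hH.2 y
      refine ⟨h, ?_⟩
      have hk : p k = 1 := k.2
      rw [← hkh]
      simp [hk]
  let e := MulEquiv.ofBijective _ hb
  exact ⟨H.subtype.comp e.symm.toMonoidHom, fun x => e.apply_symm_apply x⟩

theorem exists_section_subgroup {σ : Set ℕ} {G Q : Type*} [Group G] [Finite G] [Group Q]
    {q : G →* Q} (hq : Function.Surjective q) (hK : IsPiNumber σᶜ (Nat.card q.ker))
    (X : Subgroup Q) (hX : IsPiNumber σ (Nat.card X)) : ∃ s : X →* G, ∀ x, q (s x) = x := by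
  let p : X.comap q →* X := (q.comp (X.comap q).subtype).codRestrict X fun y => y.2
  have hp : Function.Surjective p := fun x => by
    obtain ⟨y, hy⟩ := hq x
    exact ⟨⟨y, by rw [Subgroup.mem_comap, hy]; exact x.2⟩, Subtype.ext hy⟩
  let f : p.ker →* q.ker := ((X.comap q).subtype.comp p.ker.subtype).codRestrict q.ker
    fun y => congrArg Subtype.val y.2
  have hf : Function.Injective f := fun a b hab =>
    Subtype.ext (Subtype.ext (show (f a : G) = f b by rw [hab]))
  have hdvd : Nat.card p.ker ∣ Nat.card q.ker := Subgroup.card_dvd_of_injective f hf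
  obtain ⟨s, hs⟩ := exists_section hp (hX.coprime (hK.of_dvd hdvd)).symm
  exact ⟨(X.comap q).subtype.comp s, fun x => congrArg Subtype.val (hs x)⟩

/-- A function which is invariant under conjugation on `σ`-elements and restricts to a
character of every `σ`-subgroup. -/
structure IsCharLike (σ : Set ℕ) {G : Type} [Group G] (φ : G → ℂ) : Prop where
  conj : ∀ g x, IsPiElt σ g → φ (x * g * x⁻¹) = φ g
  res : ∀ X : Subgroup G, IsPiNumber σ (Nat.card X) → IsCharacter X fun x => φ x

theorem IsCharLike.comp_injective {σ : Set ℕ} {G H : Type} [Group G] [Group H] {φ : G → ℂ}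
    (hφ : IsCharLike σ φ) (f : H →* G) (hH : IsPiNumber σ (Nat.card H)) :
    IsCharacter H fun h => φ (f h) :=
  (hφ.res f.range (hH.of_dvd (Subgroup.card_range_dvd f))).comp f.rangeRestrict

theorem IsCharacter.isCharLike {σ : Set ℕ} {G : Type} [Group G] [Finite G] {φ : G → ℂ}
    (hφ : IsCharacter G φ) : IsCharLike σ φ :=
  ⟨fun g x _ => hφ.conj g x, fun X _ => hφ.comp X.subtype⟩

theorem IsPiElt.of_map {σ : Set ℕ} {G Q : Type} [Group G] [Group Q] {g : G}
    (hg : IsPiElt σ g) (q : G →* Q) : IsPiElt σ (q g) := hg.of_dvd (orderOf_map_dvd q g)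

theorem IsPiElt.conj {σ : Set ℕ} {G : Type} [Group G] {g : G} (hg : IsPiElt σ g) (x : G) :
    IsPiElt σ (x * g * x⁻¹) := hg.of_map (MulAut.conj x).toMonoidHom

theorem IsPiNumber.isPiElt {σ : Set ℕ} {G : Type} [Group G]
    (h : IsPiNumber σ (Nat.card G)) (g : G) : IsPiElt σ g := h.of_dvd (orderOf_dvd_natCard g)

theorem exists_isPiElt_lift {σ : Set ℕ} {G Q : Type} [Group G] [Finite G] [Group Q] {q : G →* Q}
    (hq : Function.Surjective q) (hK : IsPiNumber σᶜ (Nat.card q.ker)) {y : Q}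
    (hy : IsPiElt σ y) : ∃ g, IsPiElt σ g ∧ q g = y := by
  have hc : IsPiNumber σ (Nat.card (Subgroup.zpowers y)) := by rwa [Nat.card_zpowers]
  obtain ⟨s, hs⟩ := exists_section_subgroup hq hK (Subgroup.zpowers y) hc
  exact ⟨s ⟨y, Subgroup.mem_zpowers y⟩, (hc.isPiElt _).of_map s, hs _⟩

theorem IsCharLike.descend {σ : Set ℕ} {G Q : Type} [Group G] [Finite G] [Group Q] {φ : G → ℂ}
    (hφ : IsCharLike σ φ) {q : G →* Q} (hq : Function.Surjective q)
    (hK : IsPiNumber σᶜ (Nat.card q.ker)) :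
    ∃ φ' : Q → ℂ, IsCharLike σ φ' ∧ ∀ g, IsPiElt σ g → φ' (q g) = φ g := by
  let φ' : Q → ℂ := fun y => if h : ∃ g, IsPiElt σ g ∧ q g = y then φ h.choose else 0
  have h1 : ∀ g, IsPiElt σ g → φ' (q g) = φ g := fun g hg => by
    have hex : ∃ g', IsPiElt σ g' ∧ q g' = q g := ⟨g, hg, rfl⟩
    obtain ⟨x, hx⟩ := exists_conj_of_map_eq q hK hg hex.choose_spec.1 hex.choose_spec.2
    simp only [φ', dif_pos hex]
    rw [← hx, hφ.conj _ _ hg]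
  refine ⟨φ', ⟨fun y x hy => ?_, fun X hX => ?_⟩, h1⟩
  · obtain ⟨g, hg, rfl⟩ := exists_isPiElt_lift hq hK hy
    obtain ⟨w, rfl⟩ := hq x
    rw [← map_inv, ← map_mul, ← map_mul, h1 _ (hg.conj w), h1 _ hg, hφ.conj _ _ hg]
  · obtain ⟨s, hs⟩ := exists_section_subgroup hq hK X hX
    have h2 : (fun x : X => φ' x) = fun x => φ (s x) := funext fun x => by
      rw [← h1 _ ((hX.isPiElt x).of_map s), hs]
    rw [h2]
    exact hφ.comp_injective s hX

section CharLikeOps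

variable {σ : Set ℕ} {G H : Type} [Group G] [Group H]

theorem IsCharLike.comp {φ : G → ℂ} (hφ : IsCharLike σ φ) (f : H →* G) :
    IsCharLike σ fun h => φ (f h) :=
  ⟨fun g x hg => by simpa using hφ.conj (f g) (f x) (hg.of_map f),
    fun X hX => hφ.comp_injective (f.comp X.subtype) hX⟩

theorem IsCharLike.mul {φ ψ : G → ℂ} (hφ : IsCharLike σ φ) (hψ : IsCharLike σ ψ) :
    IsCharLike σ (φ * ψ) :=
  ⟨fun g x hg => by rw [Pi.mul_apply, Pi.mul_apply, hφ.conj g x hg, hψ.conj g x hg],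
    fun X hX => (hφ.res X hX).mul (hψ.res X hX)⟩

theorem isPiElt_of_map {q : G →* H} (hK : IsPiNumber σ (Nat.card q.ker)) {g : G}
    (hg : IsPiElt σ (q g)) : IsPiElt σ g := by
  refine (hg.mul hK).of_dvd (orderOf_dvd_of_pow_eq_one ?_)
  have hmem : g ^ orderOf (q g) ∈ q.ker := by
    rw [MonoidHom.mem_ker, map_pow, pow_orderOf_eq_one]
  have := congrArg Subtype.val (pow_card_eq_one' (x := (⟨_, hmem⟩ : q.ker)))
  rw [pow_mul]
  exact this

theorem IsPiElt.mul_mem {N : Subgroup G} [N.Normal] (hN : IsPiNumber σ (Nat.card N)) {g : G}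
    (hg : IsPiElt σ g) (n : N) : IsPiElt σ (n * g) := by
  refine isPiElt_of_map (q := QuotientGroup.mk' N) (by rwa [QuotientGroup.ker_mk']) ?_
  have : QuotientGroup.mk' N (n * g) = QuotientGroup.mk' N g := by
    rw [map_mul, QuotientGroup.mk'_apply, (QuotientGroup.eq_one_iff (n : G)).2 n.2, one_mul]
  rw [this]
  exact hg.of_map _

/-- Averaging over the fibres of a quotient by a normal `σ`-subgroup. -/
theorem IsCharLike.exists_avg_fiber [Finite G] [Finite H] {φ : G → ℂ} (hφ : IsCharLike σ φ)
    {q : G →* H} (hq : Function.Surjective q) (hK : IsPiNumber σ (Nat.card q.ker)) :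
    ∃ f : H → ℂ, IsCharLike σ f ∧ ∀ a, f (q a) = avg fun k : q.ker => φ (k * a) := by
  let f : H → ℂ := fun b => avg fun k : q.ker => φ (k * Function.surjInv hq b)
  have hf : ∀ a, f (q a) = avg fun k : q.ker => φ (k * a) := fun a => by
    have hmem : Function.surjInv hq (q a) * a⁻¹ ∈ q.ker := by
      rw [MonoidHom.mem_ker, map_mul, Function.surjInv_eq hq, map_inv, mul_inv_cancel]
    rw [← avg_mul_right_group (⟨_, hmem⟩ : q.ker)]
    refine congrArg avg (funext fun k => congrArg φ ?_)
    simp [mul_assoc]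
  refine ⟨f, ⟨fun b y hb => ?_, fun X hX => ?_⟩, hf⟩
  · obtain ⟨a, rfl⟩ := hq b
    obtain ⟨x, rfl⟩ := hq y
    have ha := isPiElt_of_map hK hb
    rw [← map_inv, ← map_mul, ← map_mul, hf, hf,
      ← avg_comp_equiv (MulAut.conjNormal x : q.ker ≃* q.ker).toEquiv]
    refine congrArg avg (funext fun k => ?_)
    have h1 := hφ.conj (k * a) x (isPiElt_of_map hK (by
      rw [map_mul, (MonoidHom.mem_ker).1 k.2, one_mul]; exact hb))
    rw [← h1]
    refine congrArg φ ?_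
    simp [MulAut.conjNormal_apply, mul_assoc]
  · let p : X.comap q →* X := (q.comp (X.comap q).subtype).codRestrict X fun y => y.2
    have hp : Function.Surjective p := fun x => by
      obtain ⟨y, hy⟩ := hq x
      exact ⟨⟨y, by rw [Subgroup.mem_comap, hy]; exact x.2⟩, Subtype.ext hy⟩
    have hle : q.ker ≤ X.comap q := fun k hk => by
      rw [Subgroup.mem_comap, (MonoidHom.mem_ker).1 hk]
      exact X.one_mem
    let e : p.ker ≃ q.ker :=
      { toFun := fun k => ⟨((k : X.comap q) : G), congrArg Subtype.val k.2⟩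
        invFun := fun k => ⟨⟨k, hle k.2⟩, Subtype.ext k.2⟩
        left_inv := fun k => rfl
        right_inv := fun k => rfl }
    have hcard : IsPiNumber σ (Nat.card (X.comap q)) := by
      have h1 := Subgroup.card_mul_index p.ker
      rw [Subgroup.index_ker, MonoidHom.range_eq_top.2 hp, Nat.card_congr e,
        Nat.card_congr Subgroup.topEquiv.toEquiv] at h1
      rw [← h1]
      exact hK.mul hX
    refine isCharacter_of_avg_fiber p hp (hφ.res _ hcard) fun a => ?_
    change f (q a) = _
    rw [hf, ← avg_comp_equiv e]
    rfl

end CharLikeOps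

section IsoPart

variable {σ : Set ℕ} {G : Type} [Group G] [Finite G] {N : Subgroup G} {φ : G → ℂ}

/-- The `α`-isotypic part of `φ`, for `α` a character of a subgroup `N`. -/
def isoPart (φ : G → ℂ) (α : N → ℂ) (g : G) : ℂ := α 1 * avg fun n : N => φ (n * g) * α n⁻¹

theorem sum_degree_mul (n : N) :
    ∑ α ∈ irrFinset N, α 1 * α n = if n = 1 then (Nat.card N : ℂ) else 0 := by
  have hf : IsClassFun fun n : N => if n = 1 then (Nat.card N : ℂ) else 0 := fun g h => by
    simp only [conj_eq_one_iff]
  have h1 := congrFun (eq_sum_irr hf) n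
  rw [Finset.sum_apply] at h1
  rw [h1]
  refine Finset.sum_congr rfl fun α _ => ?_
  rw [Pi.smul_apply, smul_eq_mul]
  congr 1
  have := Fintype.ofFinite N
  have h0 := card_ne_zero_complex N
  rw [ip, avg_eq_sum, Finset.sum_eq_single 1]
  · rw [Nat.card_eq_fintype_card] at h0 ⊢
    simp [h0]
  · intro b _ hb
    simp [hb]
  · simp

theorem sum_isoPart (φ : G → ℂ) (g : G) :
    ∑ α ∈ irrFinset N, isoPart φ α g = φ g := by
  have : ∀ α ∈ irrFinset N, isoPart φ α g = avg fun n : N => φ (n * g) * (α 1 * α n⁻¹) :=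
    fun α _ => by
      rw [isoPart, ← avg_mul_left]
      exact congrArg avg (funext fun n => mul_left_comm _ _ _)
  rw [Finset.sum_congr rfl this, ← avg_sum]
  simp_rw [← Finset.mul_sum, sum_degree_mul]
  have := Fintype.ofFinite N
  have h0 := card_ne_zero_complex N
  rw [avg_eq_sum, Finset.sum_eq_single 1]
  · rw [Nat.card_eq_fintype_card] at h0 ⊢
    simp only [inv_one, if_true, OneMemClass.coe_one, one_mul, smul_eq_mul]
    field_simp
  · intro b _ hb
    simp [hb]
  · simp

variable [N.Normal]

theorem avg_twist (hφ : IsCharLike σ φ) (hN : IsPiNumber σ (Nat.card N)) {g : G}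
    (hg : IsPiElt σ g) {E : Type*} [AddCommGroup E] [Module ℂ E] (h : N → E) (m : N) :
    avg (fun n : N => φ (n * g) • h n) =
      avg fun n : N => φ (n * g) • h (m⁻¹ * n * MulAut.conjNormal g m) := by
  rw [← avg_mul_left_group m (fun n : N => φ (n * g) • h (m⁻¹ * n * MulAut.conjNormal g m)),
    ← avg_mul_right_group (MulAut.conjNormal g m)⁻¹ (fun n : N => φ ((m * n : N) * g) •
      h (m⁻¹ * (m * n) * MulAut.conjNormal g m))]
  refine congrArg avg (funext fun n => ?_)
  rw [← hφ.conj (n * g) m (hg.mul_mem hN n)]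
  congr 2
  · simp [MulAut.conjNormal_apply, mul_assoc]
  · simp [mul_assoc]

theorem isoPart_conj (hφ : IsCharLike σ φ) (hN : IsPiNumber σ (Nat.card N)) {g : G}
    (hg : IsPiElt σ g) (α : N → ℂ) (x : G) :
    isoPart φ α (x * g * x⁻¹) = isoPart φ (fun n => α (MulAut.conjNormal x n)) g := by
  rw [isoPart, isoPart, ← avg_comp_equiv (MulAut.conjNormal x : N ≃* N).toEquiv]
  simp only [map_one]
  refine congrArg _ (congrArg avg (funext fun n => ?_))
  rw [← hφ.conj (n * g) x (hg.mul_mem hN n)]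
  simp [MulAut.conjNormal_apply, mul_assoc]

variable {V : Type} [AddCommGroup V] [Module ℂ V] [FiniteDimensional ℂ V]
  {ρ : Representation ℂ N V}

theorem isoPart_invariant (hφ : IsCharLike σ φ) (hN : IsPiNumber σ (Nat.card N)) {g : G}
    (hg : IsPiElt σ g) (hρ : ρ.IsIrreducible) (h0 : isoPart φ ρ.character g ≠ 0) (n : N) :
    ρ.character (MulAut.conjNormal g n) = ρ.character n := by
  let A : V →ₗ[ℂ] V := avg fun n : N => φ (n * g) • ρ n⁻¹
  let ρ' : Representation ℂ N V := ρ.comp (MulAut.conjNormal g : N ≃* N).toMonoidHom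
  have hA : ∀ m, A * ρ m = ρ' m * A := fun m => by
    have h1 : A = ρ' m⁻¹ * A * ρ m := by
      change avg _ = _
      rw [avg_twist hφ hN hg (fun n => ρ n⁻¹) m, avg_mul_left_end, avg_mul_right_end]
      refine congrArg avg (funext fun n => ?_)
      rw [mul_smul_comm, smul_mul_assoc, mul_inv_rev, mul_inv_rev, inv_inv, map_mul, map_mul,
        ← mul_assoc, ← map_inv]
      rfl
    conv_rhs => rw [h1]
    rw [← mul_assoc, ← mul_assoc, rep_mul_inv, one_mul]
  by_contra hne
  have hirr := isIrrChar_of_isIrreducible hρ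
  have hirr' : IsIrrChar N ρ'.character := by
    refine isIrrChar_of_ip_self (isCharacter_character _) ?_
    rw [← hirr.ip_self, ip, ip, ← avg_comp_equiv (MulAut.conjNormal g : N ≃* N).toEquiv
      fun n => ρ.character n * ρ.character n⁻¹]
    refine congrArg avg (funext fun k => ?_)
    change _ * ρ.character (MulAut.conjNormal g k⁻¹) = _
    rw [map_inv]
    rfl
  have hip := hirr'.ip_ne hirr fun h => hne (congrFun h n)
  rw [ip_character, Nat.cast_eq_zero, Module.finrank_zero_iff] at hip
  have hA0 : A = 0 := by
    have := hip.elim (⟨A, fun m => hA m⟩ : Representation.IntertwiningMap ρ ρ') 0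
    exact congrArg Representation.IntertwiningMap.toLinearMap this
  apply h0
  have h2 : LinearMap.trace ℂ V A = avg fun n : N => φ (n * g) * ρ.character n⁻¹ := by
    change LinearMap.trace ℂ V (avg _) = _
    rw [trace_avg]
    refine congrArg avg (funext fun n => ?_)
    rw [map_smul]
    rfl
  rw [isoPart, ← h2, hA0, map_zero, mul_zero]

theorem isoPart_eq_of_intertwine (hφ : IsCharLike σ φ) (hN : IsPiNumber σ (Nat.card N)) {g : G}
    (hg : IsPiElt σ g) (hρ : ρ.IsIrreducible) (T : (Module.End ℂ V)ˣ)
    (hT : ∀ n, (T : Module.End ℂ V) * ρ n = ρ (MulAut.conjNormal g n) * T) :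
    isoPart φ ρ.character g = LinearMap.trace ℂ V T *
      avg fun n : N => φ (n * g) * LinearMap.trace ℂ V ((T⁻¹ : (Module.End ℂ V)ˣ) * ρ n⁻¹) := by
  have hd := finrank_ne_zero_of_isIrreducible hρ
  have h1 : ∀ m n : N, ρ.character (m⁻¹ * n * MulAut.conjNormal g m)⁻¹ =
      LinearMap.trace ℂ V (ρ m⁻¹ * (((T⁻¹ : (Module.End ℂ V)ˣ) : Module.End ℂ V) * ρ n⁻¹) *
        ρ m⁻¹⁻¹ * T) := fun m n => by
    change LinearMap.trace ℂ V (ρ _) = _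
    rw [mul_inv_rev, mul_inv_rev, inv_inv, map_mul ρ, map_mul ρ, ← map_inv]
    have h2 : ρ (MulAut.conjNormal g m⁻¹) = T * ρ m⁻¹ * (T⁻¹ : (Module.End ℂ V)ˣ) := by
      rw [hT, mul_assoc, Units.mul_inv, mul_one]
    rw [h2, LinearMap.trace_mul_comm ℂ _ (T : Module.End ℂ V)]
    simp only [mul_assoc]
  have h3 : (avg fun n : N => φ (n * g) * ρ.character n⁻¹) =
      avg fun m : N => avg fun n : N => φ (n * g) * ρ.character
        (m⁻¹ * n * MulAut.conjNormal g m)⁻¹ := by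
    rw [← avg_const (α := N) (avg fun n : N => φ (n * g) * ρ.character n⁻¹)]
    exact congrArg avg (funext fun m => avg_twist hφ hN hg (fun n => ρ.character n⁻¹) m)
  have h4 : ∀ n : N, (avg fun m : N => φ (n * g) * ρ.character
      (m⁻¹ * n * MulAut.conjNormal g m)⁻¹) = (LinearMap.trace ℂ V T / Module.finrank ℂ V) *
        (φ (n * g) * LinearMap.trace ℂ V ((T⁻¹ : (Module.End ℂ V)ˣ) * ρ n⁻¹)) := fun n => by
    rw [avg_mul_left]
    simp_rw [h1]
    rw [avg_inv_group (fun m => LinearMap.trace ℂ V (ρ m *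
      (((T⁻¹ : (Module.End ℂ V)ˣ) : Module.End ℂ V) * ρ n⁻¹) * ρ m⁻¹ * T)), avg_trace_conj hρ]
    ring
  rw [isoPart, h3, avg_comm]
  simp_rw [h4]
  rw [avg_mul_left, Representation.char_one]
  field_simp

end IsoPart

section CliffordGroup

variable {G : Type} [Group G] [Finite G] {N : Subgroup G} [N.Normal]
variable {V : Type} [AddCommGroup V] [Module ℂ V] [FiniteDimensional ℂ V]

/-- The pairs `(g, T)` in which `T` intertwines `ρ` with its conjugate by `g`, with `T` of
bounded determinantal order. -/
def cliffordGroup (ρ : Representation ℂ N V) : Subgroup (G × (Module.End ℂ V)ˣ) where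
  carrier := {p | (∀ n, (p.2 : Module.End ℂ V) * ρ n = ρ (MulAut.conjNormal p.1 n) * p.2) ∧
    LinearMap.det (p.2 : Module.End ℂ V) ^ Nat.card N = 1}
  one_mem' := by simp
  mul_mem' := by
    rintro ⟨g, T⟩ ⟨h, U⟩ ⟨h1, h2⟩ ⟨h3, h4⟩
    refine ⟨fun n => ?_, ?_⟩
    · change ((T : Module.End ℂ V) * (U : Module.End ℂ V)) * ρ n = ρ (MulAut.conjNormal (g * h) n) * ((T : Module.End ℂ V) * (U : Module.End ℂ V))
      dsimp only at h1 h3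
      rw [mul_assoc, h3, ← mul_assoc, h1, mul_assoc, map_mul]
      rfl
    · change LinearMap.det ((T : Module.End ℂ V) * (U : Module.End ℂ V)) ^ Nat.card N = 1
      rw [map_mul, mul_pow, h2, h4, one_mul]
  inv_mem' := by
    rintro ⟨g, T⟩ ⟨h1, h2⟩
    refine ⟨fun n => ?_, ?_⟩
    · change ((T⁻¹ : (Module.End ℂ V)ˣ) : Module.End ℂ V) * ρ n =
        ρ (MulAut.conjNormal g⁻¹ n) * (T⁻¹ : (Module.End ℂ V)ˣ)
      have h3 := h1 (MulAut.conjNormal g⁻¹ n)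
      have h4 : MulAut.conjNormal g (MulAut.conjNormal g⁻¹ n) = n :=
        Subtype.ext (by simp)
      dsimp only at h3
      rw [h4] at h3
      rw [Units.inv_mul_eq_iff_eq_mul, ← mul_assoc, h3, mul_assoc, Units.mul_inv, mul_one]
    · change LinearMap.det ((T⁻¹ : (Module.End ℂ V)ˣ) : Module.End ℂ V) ^ Nat.card N = 1
      have h3 : LinearMap.det (T : Module.End ℂ V) *
          LinearMap.det ((T⁻¹ : (Module.End ℂ V)ˣ) : Module.End ℂ V) = 1 := by
        rw [← map_mul, Units.mul_inv, map_one]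
      have h4 := congrArg (· ^ Nat.card N) h3
      dsimp only at h4 h2
      rwa [mul_pow, h2, one_mul, one_pow] at h4

namespace cliffordGroup

variable (ρ : Representation ℂ N V)

/-- The projection to `G`. -/
def proj : cliffordGroup ρ →* G := (MonoidHom.fst G _).comp (cliffordGroup ρ).subtype

/-- The tautological representation. -/
def rep : Representation ℂ (cliffordGroup ρ) V :=
  (Units.coeHom _).comp ((MonoidHom.snd G _).comp (cliffordGroup ρ).subtype)

/-- The embedding of `N`. -/
def emb : N →* cliffordGroup ρ :=
  ((N.subtype).prod ρ.toHomUnits).codRestrict (cliffordGroup ρ) fun n =>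
    ⟨fun m => by
      change ρ n * ρ m = ρ (MulAut.conjNormal (n : G) m) * ρ n
      rw [← map_mul, ← map_mul]
      congr 1
      exact Subtype.ext (by simp [MulAut.conjNormal_apply]), by
      change LinearMap.det (ρ n) ^ Nat.card N = 1
      rw [← map_pow, ← map_pow, pow_card_eq_one', map_one, map_one]⟩

/-- The scalars in the Clifford group. -/
def scalar : rootsOfUnity (Module.finrank ℂ V * Nat.card N) ℂ →* cliffordGroup ρ :=
  ((1 : _ →* G).prod ((Units.map (algebraMap ℂ (Module.End ℂ V)).toMonoidHom).comp
    (rootsOfUnity (Module.finrank ℂ V * Nat.card N) ℂ).subtype)).codRestrict _ fun u =>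
    ⟨fun m => by
      change algebraMap ℂ (Module.End ℂ V) (u : ℂˣ) * ρ m = ρ (MulAut.conjNormal (1 : G) m) *
        algebraMap ℂ (Module.End ℂ V) (u : ℂˣ)
      rw [Algebra.commutes, map_one]
      rfl, by
      change LinearMap.det (algebraMap ℂ (Module.End ℂ V) (u : ℂˣ)) ^ Nat.card N = 1
      rw [Algebra.algebraMap_eq_smul_one, LinearMap.det_smul, map_one, mul_one, ← pow_mul]
      have h := congrArg Units.val ((mem_rootsOfUnity _ _).1 u.2)
      rwa [Units.val_pow_eq_pow_val] at h⟩

variable {ρ}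

theorem intertwine (x : cliffordGroup ρ) (n : N) :
    rep ρ x * ρ n = ρ (MulAut.conjNormal (proj ρ x) n) * rep ρ x := x.2.1 n

theorem ext {x y : cliffordGroup ρ} (h1 : proj ρ x = proj ρ y) (h2 : rep ρ x = rep ρ y) : x = y :=
  Subtype.ext (Prod.ext h1 (Units.ext h2))

theorem proj_emb (n : N) : proj ρ (emb ρ n) = n := rfl

theorem rep_emb (n : N) : rep ρ (emb ρ n) = ρ n := rfl

theorem conj_emb (x : cliffordGroup ρ) (n : N) :
    x * emb ρ n * x⁻¹ = emb ρ (MulAut.conjNormal (proj ρ x) n) := by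
  refine ext ?_ ?_
  · simp [proj_emb, MulAut.conjNormal_apply]
  · rw [map_mul, map_mul, rep_emb, rep_emb, intertwine, mul_assoc, rep_mul_inv, mul_one]

instance : (emb ρ).range.Normal :=
  ⟨by rintro _ ⟨n, rfl⟩ x; exact ⟨_, (conj_emb x n).symm⟩⟩

theorem ker_proj (hρ : ρ.IsIrreducible) : (proj ρ).ker ≤ (scalar ρ).range := by
  intro x hx
  rw [MonoidHom.mem_ker] at hx
  obtain ⟨c, hc⟩ := schur_scalar hρ (rep ρ x) fun n => by
    rw [intertwine, hx, map_one]
    rfl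
  have hd := x.2.2
  change LinearMap.det (rep ρ x) ^ Nat.card N = 1 at hd
  rw [hc, LinearMap.det_smul, map_one, mul_one, ← pow_mul] at hd
  have hn : Module.finrank ℂ V * Nat.card N ≠ 0 :=
    mul_ne_zero (Nat.cast_ne_zero.1 (finrank_ne_zero_of_isIrreducible hρ)) Nat.card_pos.ne'
  have hc0 : c ≠ 0 := by
    rintro rfl
    rw [zero_pow hn] at hd
    exact zero_ne_one hd
  refine ⟨⟨Units.mk0 c hc0, (mem_rootsOfUnity _ _).2 (Units.ext (by simpa using hd))⟩,
    ext hx.symm ?_⟩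
  rw [hc]
  exact Algebra.algebraMap_eq_smul_one c

theorem scalar_mem_center (u) : scalar ρ u ∈ Subgroup.center (cliffordGroup ρ) :=
  Subgroup.mem_center_iff.2 fun x => ext
    (by
      change proj ρ x * 1 = 1 * proj ρ x
      rw [mul_one, one_mul])
    (by
      change rep ρ x * algebraMap ℂ (Module.End ℂ V) (u : ℂˣ) =
        algebraMap ℂ (Module.End ℂ V) (u : ℂˣ) * rep ρ x
      rw [Algebra.commutes])

theorem card_ker_proj_dvd (hρ : ρ.IsIrreducible) :
    Nat.card (proj ρ).ker ∣ Module.finrank ℂ V * Nat.card N := by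
  have hn : NeZero (Module.finrank ℂ V * Nat.card N) :=
    ⟨mul_ne_zero (Nat.cast_ne_zero.1 (finrank_ne_zero_of_isIrreducible hρ)) Nat.card_pos.ne'⟩
  have h := Subgroup.card_range_dvd (scalar ρ)
  rw [Complex.card_rootsOfUnity] at h
  exact (Subgroup.card_dvd_of_le (ker_proj hρ)).trans h

theorem finite (hρ : ρ.IsIrreducible) : Finite (cliffordGroup ρ) := by
  have hn : Module.finrank ℂ V * Nat.card N ≠ 0 :=
    mul_ne_zero (Nat.cast_ne_zero.1 (finrank_ne_zero_of_isIrreducible hρ)) Nat.card_pos.ne'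
  have h1 : Nat.card (proj ρ).ker ≠ 0 := ne_zero_of_dvd_ne_zero hn (card_ker_proj_dvd hρ)
  have h2 : (proj ρ).ker.index ≠ 0 := by
    rw [Subgroup.index_ker]
    exact Nat.card_pos.ne'
  refine Nat.finite_of_card_ne_zero ?_
  rw [← Subgroup.card_mul_index (proj ρ).ker]
  exact mul_ne_zero h1 h2

theorem character_invariant (x : cliffordGroup ρ) (n : N) :
    ρ.character (MulAut.conjNormal (proj ρ x) n) = ρ.character n := by
  have h : ρ (MulAut.conjNormal (proj ρ x) n) = rep ρ x * ρ n * rep ρ x⁻¹ := by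
    rw [intertwine, mul_assoc, rep_mul_inv, mul_one]
  change LinearMap.trace ℂ V _ = LinearMap.trace ℂ V _
  rw [h, LinearMap.trace_mul_comm, ← mul_assoc, rep_inv_mul, one_mul]

theorem exists_proj_eq (hρ : ρ.IsIrreducible) {g : G}
    (hg : ∀ n, ρ.character (MulAut.conjNormal g n) = ρ.character n) : ∃ x, proj ρ x = g := by
  obtain ⟨e, he⟩ := exists_equiv_of_character_eq
    (σ := MonoidHom.comp ρ (MulAut.conjNormal g : N ≃* N).toMonoidHom) hρ
    (funext fun k => (hg k).symm)
  have hd : Module.finrank ℂ V ≠ 0 := Nat.cast_ne_zero.1 (finrank_ne_zero_of_isIrreducible hρ)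
  have hdet : LinearMap.det (e : V →ₗ[ℂ] V) ≠ 0 := (LinearEquiv.isUnit_det' e).ne_zero
  obtain ⟨c, hc⟩ := IsAlgClosed.exists_pow_nat_eq (LinearMap.det (e : V →ₗ[ℂ] V))⁻¹
    (Nat.pos_of_ne_zero hd)
  have hc0 : c ≠ 0 := by
    rintro rfl
    rw [zero_pow hd] at hc
    exact hdet (inv_eq_zero.1 hc.symm)
  let T : (Module.End ℂ V)ˣ := Units.mk0 c hc0 • LinearMap.GeneralLinearGroup.ofLinearEquiv e
  have hT : (T : Module.End ℂ V) = c • (e : V →ₗ[ℂ] V) := rfl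
  refine ⟨⟨⟨g, T⟩, fun n => ?_, ?_⟩, rfl⟩
  · dsimp only
    rw [hT, smul_mul_assoc, mul_smul_comm]
    congr 1
    exact LinearMap.ext fun v => he n v
  · dsimp only
    rw [hT, LinearMap.det_smul, hc, inv_mul_cancel₀ hdet, one_pow]

end cliffordGroup

end CliffordGroup

section Piece

variable {σ : Set ℕ} {G : Type} [Group G] [Finite G] {N : Subgroup G} [N.Normal]

/-- Every character-like function on `G` agrees with a character on the `σ`-elements. -/
def HasExtensions (σ : Set ℕ) (G : Type) [Group G] : Prop :=
  ∀ φ : G → ℂ, IsCharLike σ φ → ∃ χ, IsCharacter G χ ∧ ∀ g, IsPiElt σ g → χ g = φ g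

/-- The stabilizer of a function on a normal subgroup. -/
def stab (α : N → ℂ) : Subgroup G where
  carrier := {g | ∀ n, α (MulAut.conjNormal g n) = α n}
  one_mem' := by simp
  mul_mem' := fun {g h} hg hh n => by
    rw [map_mul, MulAut.mul_apply, hg, hh]
  inv_mem' := fun {g} hg n => by
    rw [← hg (MulAut.conjNormal g⁻¹ n), ← MulAut.mul_apply, ← map_mul, mul_inv_cancel, map_one,
      MulAut.one_apply]

variable {V : Type} [AddCommGroup V] [Module ℂ V] [FiniteDimensional ℂ V]
  {ρ : Representation ℂ N V}

namespace cliffordGroup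

theorem card_ker_proj (hN : IsPiNumber σ (Nat.card N)) (hρ : ρ.IsIrreducible) :
    IsPiNumber σ (Nat.card (proj ρ).ker) :=
  ((hN.of_dvd (finrank_dvd_card hρ)).mul hN).of_dvd (card_ker_proj_dvd hρ)

theorem exists_central (hN : IsPiNumber σ (Nat.card N)) (hρ : ρ.IsIrreducible)
    (hG : HasPiChain σ (G ⧸ N)) :
    HasPiChain σ (cliffordGroup ρ ⧸ (emb ρ).range) ∧
    ∃ Z : Subgroup (cliffordGroup ρ ⧸ (emb ρ).range), Z ≤ Subgroup.center _ ∧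
      IsPiNumber σ (Nat.card Z) ∧ Z.index ≤ N.index := by
  have := finite hρ
  let q := QuotientGroup.mk' (emb ρ).range
  have hq : Function.Surjective q := QuotientGroup.mk'_surjective _
  let r : cliffordGroup ρ →* G ⧸ N := (QuotientGroup.mk' N).comp (proj ρ)
  have hZ : IsPiNumber σ (Nat.card ((proj ρ).ker.map q)) :=
    (card_ker_proj hN hρ).of_dvd (Subgroup.card_map_dvd _ _)
  have hr : ∀ x, r x = 1 → q x ∈ (proj ρ).ker.map q := fun x hx => by
    have hx1 : proj ρ x ∈ N := (QuotientGroup.eq_one_iff _).1 hx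
    refine ⟨x * (emb ρ ⟨_, hx1⟩)⁻¹, ?_, ?_⟩
    · change proj ρ (x * (emb ρ ⟨_, hx1⟩)⁻¹) = 1
      rw [map_mul, map_inv, proj_emb, mul_inv_cancel]
    · rw [map_mul, map_inv, show q (emb ρ ⟨_, hx1⟩) = 1 from
        (QuotientGroup.eq_one_iff _).2 ⟨_, rfl⟩, inv_one, mul_one]
  refine ⟨?_, (proj ρ).ker.map q, ?_, hZ, ?_⟩
  · refine HasPiChain.of_hom (QuotientGroup.lift (emb ρ).range r ?_) ?_ hG
    · rintro _ ⟨n, rfl⟩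
      exact (QuotientGroup.eq_one_iff _).2 n.2
    · refine Or.inl (hZ.of_dvd (Subgroup.card_dvd_of_le fun y hy => ?_))
      obtain ⟨x, rfl⟩ := hq y
      exact hr x hy
  · rintro _ ⟨x, hx, rfl⟩
    obtain ⟨u, rfl⟩ := ker_proj hρ hx
    refine Subgroup.mem_center_iff.2 fun y => ?_
    obtain ⟨y, rfl⟩ := hq y
    rw [← map_mul, ← map_mul, Subgroup.mem_center_iff.1 (scalar_mem_center u)]
  · rw [← Subgroup.index_comap_of_surjective _ hq]
    have h1 : r.ker ≤ ((proj ρ).ker.map q).comap q := fun x hx => hr x hx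
    refine (Nat.le_of_dvd (Nat.pos_of_ne_zero Subgroup.index_ne_zero_of_finite)
      (Subgroup.index_dvd_of_le h1)).trans ?_
    rw [Subgroup.index_ker]
    exact Nat.card_le_card_of_injective _ Subtype.val_injective

theorem isoPart_proj {φ : G → ℂ} (hφ : IsCharLike σ φ) (hN : IsPiNumber σ (Nat.card N))
    (hρ : ρ.IsIrreducible) {x : cliffordGroup ρ} (hx : IsPiElt σ x) :
    isoPart φ ρ.character (proj ρ x) = (rep ρ).character x *
      avg fun n => φ (proj ρ (emb ρ n * x)) * (rep ρ).character (emb ρ n * x)⁻¹ := by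
  rw [isoPart_eq_of_intertwine hφ hN (hx.of_map (proj ρ)) hρ x.1.2 x.2.1]
  refine congrArg (_ * avg ·) (funext fun n => ?_)
  have h2 : rep ρ (emb ρ n * x)⁻¹ = rep ρ x⁻¹ * ρ n⁻¹ := by
    rw [mul_inv_rev, map_mul (rep ρ), ← map_inv, rep_emb]
  rw [Representation.character, h2, map_mul (proj ρ), proj_emb]
  rfl

end cliffordGroup

open cliffordGroup in
/-- If the quotient of the Clifford group has extensions, then the isotypic part of a
character-like function is, on the stabilizer, the restriction of a character. -/
theorem exists_character_isoPart {φ : G → ℂ} (hφ : IsCharLike σ φ)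
    (hN : IsPiNumber σ (Nat.card N)) (hρ : ρ.IsIrreducible)
    (hΓ : HasExtensions σ (cliffordGroup ρ ⧸ (emb ρ).range)) :
    ∃ ψ : stab ρ.character → ℂ, IsCharacter _ ψ ∧
      ∀ g : stab ρ.character, IsPiElt σ (g : G) → ψ g = isoPart φ ρ.character g := by
  have := finite hρ
  let q := QuotientGroup.mk' (emb ρ).range
  have hq : Function.Surjective q := QuotientGroup.mk'_surjective _
  have hqk : q.ker = (emb ρ).range := QuotientGroup.ker_mk' _
  have hqN : IsPiNumber σ (Nat.card q.ker) := by
    rw [hqk]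
    exact hN.of_dvd (Subgroup.card_range_dvd _)
  obtain ⟨f, hf, hfq⟩ := ((hφ.comp (proj ρ)).mul
    (isCharacter_character (rep ρ)).dual.isCharLike).exists_avg_fiber hq hqN
  obtain ⟨s, hs, hsf⟩ := hΓ f hf
  have hΨ := (isCharacter_character (rep ρ)).mul (hs.comp q)
  let p : cliffordGroup ρ →* stab ρ.character :=
    (proj ρ).codRestrict _ fun x n => character_invariant x n
  have hp : Function.Surjective p := fun g => by
    obtain ⟨x, hx⟩ := exists_proj_eq hρ g.2
    exact ⟨x, Subtype.ext hx⟩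
  have hpk : IsPiNumber σ (Nat.card p.ker) :=
    (card_ker_proj hN hρ).of_dvd (Subgroup.card_dvd_of_le fun x hx => congrArg Subtype.val hx)
  obtain ⟨ψ, -, hψp⟩ := (hΨ.isCharLike (σ := σ)).exists_avg_fiber hp hpk
  refine ⟨ψ, isCharacter_of_avg_fiber p hp hΨ hψp, fun g hg => ?_⟩
  have hkey : ∀ x : cliffordGroup ρ, IsPiElt σ x →
      (rep ρ).character x * s (q x) = isoPart φ ρ.character (proj ρ x) := fun x hx => by
    rw [hsf _ (hx.of_map q), hfq, isoPart_proj hφ hN hρ hx]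
    have hinj : Function.Injective (emb ρ) := fun m n h => Subtype.ext (congrArg (proj ρ) h)
    let e : N ≃ q.ker := Equiv.ofBijective
      (fun n => ⟨emb ρ n, hqk.ge ⟨n, rfl⟩⟩)
      ⟨fun m n h => hinj (congrArg Subtype.val h), fun k => by
        obtain ⟨n, hn⟩ := hqk.le k.2
        exact ⟨n, Subtype.ext hn⟩⟩
    rw [← avg_comp_equiv e]
    rfl
  obtain ⟨x, rfl⟩ := hp g
  have hx : IsPiElt σ x := isPiElt_of_map (q := proj ρ) (card_ker_proj hN hρ) hg
  rw [hψp]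
  refine Eq.trans (congrArg avg (funext fun k : p.ker => ?_)) (avg_const _)
  refine (hkey (k * x) (hx.mul_mem hpk k)).trans ?_
  rw [map_mul, show proj ρ k = 1 from congrArg Subtype.val k.2, one_mul]
  rfl

end Piece

section OrbitSum

variable {σ : Set ℕ} {G : Type} [Group G] [Finite G] {N : Subgroup G} [N.Normal]

/-- The conjugate of a function on a normal subgroup. -/
def conjFun (α : N → ℂ) (x : G) : N → ℂ := fun n => α (MulAut.conjNormal x n)

theorem conjFun_one (α : N → ℂ) : conjFun α 1 = α :=
  funext fun n => by rw [conjFun, map_one, MulAut.one_apply]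

theorem conjFun_mul (α : N → ℂ) (x y : G) : conjFun α (x * y) = conjFun (conjFun α x) y :=
  funext fun n => by rw [conjFun, map_mul, MulAut.mul_apply]; rfl

theorem IsIrrChar.conjFun {α : N → ℂ} (hα : IsIrrChar N α) (x : G) :
    IsIrrChar N (conjFun α x) := by
  refine isIrrChar_of_ip_self (hα.1.comp (MulAut.conjNormal x : N ≃* N).toMonoidHom) ?_
  rw [← hα.ip_self, ip, ip,
    ← avg_comp_equiv (MulAut.conjNormal x : N ≃* N).toEquiv fun n => α n * α n⁻¹]
  refine congrArg avg (funext fun n => ?_)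
  change α _ * α (MulAut.conjNormal x n⁻¹) = _
  rw [map_inv]
  rfl

/-- The characters conjugate to `α`. -/
def conjOrbit (α : N → ℂ) : Finset (N → ℂ) :=
  (irrFinset N).filter fun β => ∃ x : G, conjFun α x = β

theorem mem_conjOrbit {α β : N → ℂ} (hα : IsIrrChar N α) :
    β ∈ conjOrbit α ↔ ∃ x : G, conjFun α x = β := by
  rw [conjOrbit, Finset.mem_filter, mem_irrFinset]
  exact ⟨fun h => h.2, fun ⟨x, h⟩ => ⟨h ▸ hα.conjFun x, x, h⟩⟩

theorem card_fiber_conjFun {α : N → ℂ} (hα : IsIrrChar N α) (β : conjOrbit α) :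
    Nat.card {x : G // (⟨conjFun α x, (mem_conjOrbit hα).2 ⟨x, rfl⟩⟩ : conjOrbit α) = β} =
      Nat.card (stab α) := by
  obtain ⟨β, hβ⟩ := β
  obtain ⟨y, rfl⟩ := (mem_conjOrbit hα).1 hβ
  have hs : ∀ s : G, s ∈ stab α ↔ conjFun α s = α := fun s => funext_iff.symm
  refine Nat.card_congr
    { toFun := fun x => ⟨x.1 * y⁻¹, ?_⟩
      invFun := fun s => ⟨s * y, ?_⟩
      left_inv := fun x => Subtype.ext (by simp)
      right_inv := fun x => Subtype.ext (by simp) }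
  · have hx : conjFun α x.1 = conjFun α y := congrArg Subtype.val x.2
    rw [hs, conjFun_mul, hx, ← conjFun_mul, mul_inv_cancel, conjFun_one]
  · refine Subtype.ext ?_
    change conjFun α (s * y) = _
    rw [conjFun_mul, (hs s).1 s.2]

theorem card_conjOrbit {α : N → ℂ} (hα : IsIrrChar N α) :
    (conjOrbit α).card = (stab α).index := by
  have h : Nat.card G = (conjOrbit α).card * Nat.card (stab α) := by
    rw [Nat.card_congr (Equiv.sigmaFiberEquiv fun x : G =>
      (⟨conjFun α x, (mem_conjOrbit hα).2 ⟨x, rfl⟩⟩ : conjOrbit α)).symm, Nat.card_sigma]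
    simp only [card_fiber_conjFun hα]
    simp
  rw [← (stab α).index_mul_card] at h
  exact (Nat.eq_of_mul_eq_mul_right Nat.card_pos h).symm

theorem avg_conjFun {α : N → ℂ} (hα : IsIrrChar N α) (F : (N → ℂ) → ℂ) :
    (stab α).index * avg (fun x : G => F (conjFun α x)) = ∑ β ∈ conjOrbit α, F β := by
  have h := avg_comp_of_card_fiber _ _ Nat.card_pos.ne' (card_fiber_conjFun hα)
    fun β : conjOrbit α => F β
  rw [h, avg_eq_sum, Fintype.card_coe, card_conjOrbit hα, smul_eq_mul, ← mul_assoc,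
    mul_inv_cancel₀ (Nat.cast_ne_zero.2 Subgroup.index_ne_zero_of_finite), one_mul,
    Finset.sum_coe_sort]

variable {φ : G → ℂ}

theorem exists_character_sum_conjOrbit (hφ : IsCharLike σ φ) (hN : IsPiNumber σ (Nat.card N))
    {α : N → ℂ} (hα : IsIrrChar N α) {ψ : stab α → ℂ} (hψ : IsCharacter _ ψ)
    (h : ∀ g : stab α, IsPiElt σ (g : G) → ψ g = isoPart φ α g) :
    ∃ χ, IsCharacter G χ ∧ ∀ g, IsPiElt σ g → χ g = ∑ β ∈ conjOrbit α, isoPart φ β g := by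
  refine ⟨_, isCharacter_ind _ hψ, fun g hg => ?_⟩
  rw [← avg_conjFun hα fun β => isoPart φ β g]
  refine congrArg (_ * avg ·) (funext fun x => ?_)
  refine Eq.trans ?_ (isoPart_conj hφ hN hg α x)
  rw [extZero]
  split_ifs with hx
  · exact h ⟨_, hx⟩ (hg.conj x)
  · by_contra h0
    obtain ⟨d, ρ, hρ, rfl, -⟩ := hα.exists_rep
    exact hx fun n => isoPart_invariant hφ hN (hg.conj x) hρ (Ne.symm h0) n

theorem exists_character_sum_isoPart (hφ : IsCharLike σ φ) (hN : IsPiNumber σ (Nat.card N))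
    (hΓ : ∀ (d : ℕ) (ρ : Representation ℂ N (Fin d → ℂ)), ρ.IsIrreducible →
      HasExtensions σ (cliffordGroup ρ ⧸ (cliffordGroup.emb ρ).range))
    (A : Finset (N → ℂ)) (hA : ∀ α ∈ A, IsIrrChar N α)
    (hinv : ∀ α ∈ A, ∀ x : G, conjFun α x ∈ A) :
    ∃ χ, IsCharacter G χ ∧ ∀ g, IsPiElt σ g → χ g = ∑ α ∈ A, isoPart φ α g := by
  induction A using Finset.strongInduction with
  | H A ih =>
    rcases A.eq_empty_or_nonempty with rfl | ⟨α, hαA⟩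
    · exact ⟨0, isCharacter_zero, fun g _ => by simp⟩
    have hα := hA α hαA
    have hsub : conjOrbit α ⊆ A := fun β hβ => by
      obtain ⟨x, rfl⟩ := (mem_conjOrbit hα).1 hβ
      exact hinv α hαA x
    have hmem : α ∈ conjOrbit α := (mem_conjOrbit hα).2 ⟨1, conjFun_one α⟩
    obtain ⟨χ₁, hχ₁, h₁⟩ := ih (A \ conjOrbit α)
      (Finset.sdiff_ssubset hsub ⟨α, hmem⟩)
      (fun β hβ => hA β (Finset.mem_sdiff.1 hβ).1) fun β hβ x => by
        obtain ⟨h1, h2⟩ := Finset.mem_sdiff.1 hβ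
        refine Finset.mem_sdiff.2 ⟨hinv β h1 x, fun h3 => h2 ?_⟩
        obtain ⟨y, hy⟩ := (mem_conjOrbit hα).1 h3
        refine (mem_conjOrbit hα).2 ⟨y * x⁻¹, ?_⟩
        rw [conjFun_mul, hy, ← conjFun_mul, mul_inv_cancel, conjFun_one]
    obtain ⟨d, ρ, hρ, hαρ, -⟩ := hα.exists_rep
    obtain ⟨χ₂, hχ₂, h₂⟩ : ∃ χ, IsCharacter G χ ∧
        ∀ g, IsPiElt σ g → χ g = ∑ β ∈ conjOrbit α, isoPart φ β g := by
      subst hαρ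
      obtain ⟨ψ, hψ, hψ'⟩ := exists_character_isoPart hφ hN hρ (hΓ d ρ hρ)
      exact exists_character_sum_conjOrbit hφ hN hα hψ hψ'
    refine ⟨χ₁ + χ₂, hχ₁.add hχ₂, fun g hg => ?_⟩
    rw [Pi.add_apply, h₁ g hg, h₂ g hg, Finset.sum_sdiff hsub]

end OrbitSum

section Extensions

variable {σ : Set ℕ} {G : Type} [Group G] [Finite G]

theorem HasExtensions.of_map {Q : Type} [Group Q] {q : G →* Q} (hq : Function.Surjective q)
    (hK : IsPiNumber σᶜ (Nat.card q.ker)) (hQ : HasExtensions σ Q) : HasExtensions σ G := by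
  intro φ hφ
  obtain ⟨φ', hφ', h⟩ := hφ.descend hq hK
  obtain ⟨χ, hχ, hχ'⟩ := hQ φ' hφ'
  exact ⟨_, hχ.comp q, fun g hg => by rw [hχ' _ (hg.of_map q), h g hg]⟩

theorem hasExtensions_of_normal {N : Subgroup G} [N.Normal] (hN : IsPiNumber σ (Nat.card N))
    (hΓ : ∀ (d : ℕ) (ρ : Representation ℂ N (Fin d → ℂ)), ρ.IsIrreducible →
      HasExtensions σ (cliffordGroup ρ ⧸ (cliffordGroup.emb ρ).range)) : HasExtensions σ G := by
  intro φ hφ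
  obtain ⟨χ, hχ, h⟩ := exists_character_sum_isoPart hφ hN hΓ (irrFinset N)
    (fun α hα => mem_irrFinset.1 hα)
    fun α hα x => mem_irrFinset.2 ((mem_irrFinset.1 hα).conjFun x)
  exact ⟨χ, hχ, fun g hg => by rw [h g hg, sum_isoPart]⟩

theorem normal_of_le_center {A : Type*} [Group A] {Z : Subgroup A} (h : Z ≤ Subgroup.center A) :
    Z.Normal :=
  ⟨fun z hz x => by rwa [Subgroup.mem_center_iff.1 (h hz), mul_inv_cancel_right]⟩

/-- A central Hall subgroup of a normal subgroup has a normal complement. -/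
theorem exists_normal_of_central {Z N : Subgroup G} [N.Normal] (hZ : Z ≤ Subgroup.center G)
    (hZσ : IsPiNumber σ (Nat.card Z)) (hlt : Z < N) (hN : IsPiNumber σᶜ (Z.relIndex N)) :
    ∃ O : Subgroup G, O.Normal ∧ O ≠ ⊥ ∧ IsPiNumber σᶜ (Nat.card O) := by
  have hcent : Z.subgroupOf N ≤ Subgroup.center N := fun z hz =>
    Subgroup.mem_center_iff.2 fun n => Subtype.ext (Subgroup.mem_center_iff.1 (hZ hz) n)
  have : (Z.subgroupOf N).Normal := normal_of_le_center hcent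
  have hc : Nat.card (Z.subgroupOf N) = Nat.card Z :=
    Nat.card_congr (Subgroup.subgroupOfEquivOfLe hlt.le).toEquiv
  obtain ⟨Y, hY⟩ := Subgroup.exists_right_complement'_of_coprime (N := Z.subgroupOf N)
    (by rw [hc]; exact hZσ.coprime hN)
  have hYc : Nat.card Y = Z.relIndex N := Subgroup.IsComplement.card_right hY
  refine exists_normal_pure_of_characteristic (Y := Y) ⟨fun y hy n => ?_⟩ ?_ (hYc ▸ hN)
  · obtain ⟨⟨z, w⟩, rfl⟩ := hY.2 n
    have hz := Subgroup.mem_center_iff.1 (hcent z.2)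
    have h1 : (z : N) * w * y * ((z : N) * w)⁻¹ = w * y * (w : N)⁻¹ := by
      rw [mul_inv_rev, mul_assoc (z : N), mul_assoc (z : N), ← hz, mul_assoc, mul_assoc,
        mul_assoc, mul_assoc, inv_mul_cancel, mul_one]
    change (z : N) * w * y * ((z : N) * w)⁻¹ ∈ Y
    rw [h1]
    exact Y.mul_mem (Y.mul_mem w.2 hy) (Y.inv_mem w.2)
  · rintro rfl
    rw [Subgroup.card_bot] at hYc
    exact hlt.not_ge (Subgroup.relIndex_eq_one.1 hYc.symm)

/-- In a `σ`-separable group every character-like function extends. -/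
theorem hasExtensions_of_central (k : ℕ) : ∀ (m : ℕ) (G : Type) [Group G] [Finite G]
    (Z : Subgroup G), Z ≤ Subgroup.center G → IsPiNumber σ (Nat.card Z) → HasPiChain σ G →
    Z.index = k → Nat.card G = m → HasExtensions σ G := by
  induction k using Nat.strong_induction_on with
  | _ k ihk =>
  intro m
  induction m using Nat.strong_induction_on with
  | _ m ihm =>
  intro G _ _ Z hZ hZσ hG hk hm
  by_cases hO : ∃ O : Subgroup G, O.Normal ∧ O ≠ ⊥ ∧ IsPiNumber σᶜ (Nat.card O)
  · obtain ⟨K, hKn, hK1, hK⟩ := hO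
    have hq := QuotientGroup.mk'_surjective K
    have hker : IsPiNumber σᶜ (Nat.card (QuotientGroup.mk' K).ker) := by
      rwa [QuotientGroup.ker_mk']
    have hcard : Nat.card (G ⧸ K) < m := by
      have h1 := K.card_eq_card_quotient_mul_card_subgroup
      have h2 := (Subgroup.one_lt_card_iff_ne_bot K).2 hK1
      have h3 : 0 < Nat.card (G ⧸ K) := Nat.card_pos
      rw [← hm, h1]
      exact lt_mul_of_one_lt_right h3 h2
    have hZ' : Z.map (QuotientGroup.mk' K) ≤ Subgroup.center (G ⧸ K) := by
      rintro _ ⟨z, hz, rfl⟩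
      refine Subgroup.mem_center_iff.2 fun y => ?_
      obtain ⟨y, rfl⟩ := hq y
      rw [← map_mul, ← map_mul, Subgroup.mem_center_iff.1 (hZ hz)]
    have hZσ' := hZσ.of_dvd (Subgroup.card_map_dvd Z (QuotientGroup.mk' K))
    have hle : (Z.map (QuotientGroup.mk' K)).index ≤ k := by
      rw [← hk]
      exact Nat.le_of_dvd (Nat.pos_of_ne_zero Subgroup.index_ne_zero_of_finite)
        (Z.index_map_dvd hq)
    refine HasExtensions.of_map hq hker ?_
    rcases hle.lt_or_eq with h | h
    · exact ihk _ h _ _ _ hZ' hZσ' (hG.map hq) rfl rfl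
    · exact ihm _ hcard _ _ hZ' hZσ' (hG.map hq) h rfl
  · by_cases hZtop : Z = ⊤
    · intro φ hφ
      refine ⟨φ, hφ.comp_injective (MonoidHom.id G) ?_, fun _ _ => rfl⟩
      rwa [← Subgroup.card_top, ← hZtop]
    · have : Z.Normal := normal_of_le_center hZ
      obtain ⟨N, hN, hlt, hpure⟩ := hG.exists_normal_above hZtop
      have hNσ : IsPiNumber σ (Nat.card N) := by
        rcases hpure with h | h
        · rw [← Subgroup.relIndex_bot_left, ← Subgroup.relIndex_mul_relIndex _ _ _ bot_le hlt.le,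
            Subgroup.relIndex_bot_left]
          exact hZσ.mul h
        · exact absurd (exists_normal_of_central hZ hZσ hlt h) hO
      have hidx : N.index < k := by
        rw [← hk]
        exact Subgroup.index_strictAnti hlt
      refine hasExtensions_of_normal hNσ fun d ρ hρ => ?_
      have := cliffordGroup.finite hρ
      obtain ⟨hΓ, Z', h1, h2, h3⟩ :=
        cliffordGroup.exists_central hNσ hρ (hG.map (QuotientGroup.mk'_surjective N))
      exact ihk _ (h3.trans_lt hidx) _ _ Z' h1 h2 hΓ rfl rfl

theorem HasPiChain.hasExtensions (hG : HasPiChain σ G) : HasExtensions σ G :=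
  hasExtensions_of_central _ _ G ⊥ bot_le
    (by rw [Subgroup.card_bot]; exact isPiNumber_one σ) hG rfl rfl

end Extensions

open scoped commutatorElement

theorem isIrrChar_one {N : Type} [Group N] [Finite N] : IsIrrChar N 1 :=
  isIrrChar_of_ip_self isCharacter_one (by simpa [ip] using avg_const (α := N) (1 : ℂ))

section OrbitStructure

variable {σ : Set ℕ} {G : Type} [Group G] [Finite G] {N : Subgroup G} {φ : G → ℂ}

theorem isoPart_apply_one (φ : G → ℂ) (α : N → ℂ) :
    isoPart φ α 1 = α 1 * ip (fun n : N => φ n) α := by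
  simp only [isoPart, mul_one]
  rfl

theorem ip_eq_zero_of_sum_isoPart (hN : IsCharacter N fun n => φ n) {A : Finset (N → ℂ)}
    (hA : ∀ α ∈ A, IsIrrChar N α) (h : ∑ α ∈ A, isoPart φ α 1 = 0) {α : N → ℂ} (hα : α ∈ A) :
    ip (fun n : N => φ n) α = 0 := by
  have h1 : ∀ β ∈ A, ∃ m : ℕ, isoPart φ β 1 = m := fun β hβ => by
    obtain ⟨a, ha⟩ := (hA β hβ).1.exists_degree
    obtain ⟨b, hb⟩ := hN.ip_nat (hA β hβ).1
    exact ⟨a * b, by rw [isoPart_apply_one, ha, hb, Nat.cast_mul]⟩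
  choose! m hm using h1
  rw [Finset.sum_congr rfl hm, ← Nat.cast_sum, Nat.cast_eq_zero, Finset.sum_eq_zero_iff] at h
  have h2 := hm α hα
  rw [h α hα, Nat.cast_zero, isoPart_apply_one] at h2
  exact (mul_eq_zero.1 h2).resolve_left fun h0 =>
    (hA α hα).2.1 ((hA α hα).1.eq_zero_of_degree h0)

variable [N.Normal]

theorem ip_conjFun (hφ : IsCharLike σ φ) (hN : IsPiNumber σ (Nat.card N)) (α : N → ℂ) (x : G) :
    ip (fun n : N => φ n) (conjFun α x) = ip (fun n : N => φ n) α := by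
  rw [ip, ip, ← avg_comp_equiv (MulAut.conjNormal x : N ≃* N).toEquiv fun n : N => φ n * α n⁻¹]
  refine congrArg avg (funext fun n => ?_)
  have h1 : φ (MulAut.conjNormal x n : N) = φ n :=
    hφ.conj _ x (by simpa [IsPiElt] using hN.isPiElt n)
  change φ n * α (MulAut.conjNormal x n⁻¹) =
    φ (MulAut.conjNormal x n : N) * α (MulAut.conjNormal x n)⁻¹
  rw [h1, map_inv]

/-- The restriction of an indecomposable character-like function to a normal `σ`-subgroup is a
multiple of an orbit sum. -/
theorem exists_eq_mul_sum_conjOrbit (hG : HasPiChain σ G) (hφ : IsCharLike σ φ)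
    (hirr : ∀ χ₁ χ₂, IsCharacter G χ₁ → IsCharacter G χ₂ →
      (∀ g, IsPiElt σ g → φ g = χ₁ g + χ₂ g) → χ₁ = 0 ∨ χ₂ = 0)
    (hN : IsPiNumber σ (Nat.card N)) (h1 : φ 1 ≠ 0) :
    ∃ α : N → ℂ, IsIrrChar N α ∧ ∃ e : ℕ, ∀ n : N, φ n = e * ∑ β ∈ conjOrbit α, β n := by
  have hφN := hφ.res N hN
  obtain ⟨α, hα, hα0⟩ : ∃ α, IsIrrChar N α ∧ ip (fun n : N => φ n) α ≠ 0 := by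
    by_contra! h
    exact h1 (congrFun (eq_zero_of_forall_ip hφN.isClassFun h) 1)
  have hΓ : ∀ (d : ℕ) (ρ : Representation ℂ N (Fin d → ℂ)), ρ.IsIrreducible →
      HasExtensions σ (cliffordGroup ρ ⧸ (cliffordGroup.emb ρ).range) := fun d ρ hρ => by
    have := cliffordGroup.finite hρ
    exact (cliffordGroup.exists_central hN hρ
      (hG.map (QuotientGroup.mk'_surjective N))).1.hasExtensions
  have hmem : ∀ β, β ∈ conjOrbit α ↔ ∃ x : G, conjFun α x = β := fun β => mem_conjOrbit hα
  have hsub : conjOrbit α ⊆ irrFinset N := Finset.filter_subset _ _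
  have hinv : ∀ β ∈ conjOrbit α, ∀ x : G, conjFun β x ∈ conjOrbit α := fun β hβ x => by
    obtain ⟨y, rfl⟩ := (hmem β).1 hβ
    exact (hmem _).2 ⟨y * x, conjFun_mul α y x⟩
  have hinv' : ∀ β ∈ irrFinset N \ conjOrbit α, ∀ x : G,
      conjFun β x ∈ irrFinset N \ conjOrbit α := fun β hβ x => by
    obtain ⟨h2, h3⟩ := Finset.mem_sdiff.1 hβ
    refine Finset.mem_sdiff.2 ⟨mem_irrFinset.2 ((mem_irrFinset.1 h2).conjFun x), fun h4 => h3 ?_⟩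
    have h5 := hinv _ h4 x⁻¹
    rwa [← conjFun_mul, mul_inv_cancel, conjFun_one] at h5
  have hirr1 : ∀ β ∈ conjOrbit α, IsIrrChar N β := fun β hβ => mem_irrFinset.1 (hsub hβ)
  have hirr2 : ∀ β ∈ irrFinset N \ conjOrbit α, IsIrrChar N β := fun β hβ =>
    mem_irrFinset.1 (Finset.mem_sdiff.1 hβ).1
  obtain ⟨χ₁, hχ₁, h₁⟩ := exists_character_sum_isoPart hφ hN hΓ _ hirr1 hinv
  obtain ⟨χ₂, hχ₂, h₂⟩ := exists_character_sum_isoPart hφ hN hΓ _ hirr2 hinv'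
  have hone : IsPiElt σ (1 : G) := by
    rw [IsPiElt, orderOf_one]
    exact isPiNumber_one σ
  have h0 : ∀ β ∈ irrFinset N \ conjOrbit α, ip (fun n : N => φ n) β = 0 := by
    rcases hirr χ₁ χ₂ hχ₁ hχ₂ fun g hg => by
      rw [h₁ g hg, h₂ g hg, add_comm, Finset.sum_sdiff hsub, sum_isoPart] with rfl | rfl
    · exact absurd (ip_eq_zero_of_sum_isoPart hφN hirr1 (h₁ 1 hone).symm
        ((hmem α).2 ⟨1, conjFun_one α⟩)) hα0
    · exact fun β hβ => ip_eq_zero_of_sum_isoPart hφN hirr2 (h₂ 1 hone).symm hβ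
  obtain ⟨e, he⟩ := hφN.ip_nat hα.1
  refine ⟨α, hα, e, fun n => ?_⟩
  have h3 := congrFun (eq_sum_irr hφN.isClassFun) n
  rw [← Finset.sum_sdiff hsub, Finset.sum_eq_zero (s := irrFinset N \ conjOrbit α)
    fun β hβ => by rw [h0 β hβ, zero_smul], zero_add, Finset.sum_apply] at h3
  rw [h3, Finset.mul_sum]
  refine Finset.sum_congr rfl fun β hβ => ?_
  obtain ⟨x, rfl⟩ := (hmem β).1 hβ
  rw [ip_conjFun hφ hN, he]
  rfl

theorem conjOrbit_one : conjOrbit (G := G) (1 : N → ℂ) = {1} := by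
  refine Finset.ext fun β => ?_
  rw [mem_conjOrbit isIrrChar_one, Finset.mem_singleton]
  exact ⟨fun ⟨x, hx⟩ => hx.symm, fun h => ⟨1, (conjFun_one 1).trans h.symm⟩⟩

/-- A faithful indecomposable character-like function of odd `σ'`-degree restricts to a nontrivial
normal `σ`-subgroup as a multiple of a sum of an odd number of nontrivial linear characters. -/
theorem exists_odd_linear (h2 : 2 ∈ σ) (hG : HasPiChain σ G) (hφ : IsCharLike σ φ)
    (hirr : ∀ χ₁ χ₂, IsCharacter G χ₁ → IsCharacter G χ₂ →
      (∀ g, IsPiElt σ g → φ g = χ₁ g + χ₂ g) → χ₁ = 0 ∨ χ₂ = 0)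
    (hfaith : ∀ X : Subgroup G, IsPiNumber σ (Nat.card X) → (∀ x ∈ X, φ x = φ 1) → X = ⊥)
    (hN : IsPiNumber σ (Nat.card N)) (hN1 : N ≠ ⊥) {n : ℕ} (hn : φ 1 = n)
    (hnσ : IsPiNumber σᶜ n) :
    (∀ x y : N, x * y = y * x) ∧ ∃ (O : Finset (N → ℂ)) (e : ℕ), e ≠ 0 ∧ Odd O.card ∧
      (∀ β ∈ O, IsIrrChar N β ∧ β 1 = 1) ∧ 1 ∉ O ∧ ∀ x : N, φ x = e * ∑ β ∈ O, β x := by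
  have hodd : ¬ 2 ∣ n := fun h => hnσ 2 Nat.prime_two h h2
  have hn0 : n ≠ 0 := fun h => hodd (h ▸ dvd_zero 2)
  obtain ⟨α, hα, e, he⟩ := exists_eq_mul_sum_conjOrbit hG hφ hirr hN
    (by rw [hn]; exact Nat.cast_ne_zero.2 hn0)
  obtain ⟨d, ρ, hρ, hαρ, hd, hαd⟩ := hα.exists_rep
  have hdeg : ∀ β ∈ conjOrbit α, IsIrrChar N β ∧ β 1 = d := fun β hβ => by
    obtain ⟨x, rfl⟩ := (mem_conjOrbit hα).1 hβ
    exact ⟨hα.conjFun x, by rw [conjFun, map_one, hαd]⟩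
  have hprod : n = e * ((conjOrbit α).card * d) := by
    have h := he 1
    rw [OneMemClass.coe_one, hn, Finset.sum_congr rfl fun β hβ => (hdeg β hβ).2,
      Finset.sum_const, nsmul_eq_mul] at h
    exact_mod_cast h
  have hd1 : d = 1 := Nat.Coprime.eq_one_of_dvd
    ((hN.of_dvd hd).coprime (hnσ.of_dvd ⟨e * (conjOrbit α).card, by rw [hprod]; ring⟩)) dvd_rfl
  subst hd1
  simp only [Nat.cast_one] at hdeg
  rw [mul_one] at hprod
  refine ⟨fun x y => ?_, conjOrbit α, e, ?_, ?_, hdeg, fun hmem => ?_, he⟩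
  · have hX : ∀ x ∈ (commutator N).map N.subtype, φ x = φ 1 := by
      rintro _ ⟨x, hx, rfl⟩
      change φ x = _
      rw [← OneMemClass.coe_one N, he, he]
      refine congrArg _ (Finset.sum_congr rfl fun β hβ => ?_)
      obtain ⟨μ, hμ⟩ := (hdeg β hβ).1.exists_linear (hdeg β hβ).2
      rw [hμ, hμ, MonoidHom.mem_ker.1 (Abelianization.commutator_subset_ker μ hx), map_one]
    have hbot := hfaith _ (hN.of_dvd (Subgroup.card_dvd_of_le (Subgroup.map_subtype_le _))) hX
    have hxy : ⁅x, y⁆ ∈ commutator N :=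
      Subgroup.commutator_mem_commutator (Subgroup.mem_top x) (Subgroup.mem_top y)
    rw [(Subgroup.map_eq_bot_iff_of_injective _ N.subtype_injective).1 hbot,
      Subgroup.mem_bot] at hxy
    exact commutatorElement_eq_one_iff_mul_comm.1 hxy
  · rintro rfl
    exact hn0 (by rw [hprod, zero_mul])
  · rw [← Nat.not_even_iff_odd, even_iff_two_dvd]
    exact fun h => hodd (hprod ▸ h.mul_left e)
  · obtain ⟨x, hx⟩ := (mem_conjOrbit hα).1 hmem
    have hα1 : α = 1 := by
      rw [← conjFun_one α, ← mul_inv_cancel x, conjFun_mul, hx]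
      rfl
    subst hα1
    rw [conjOrbit_one] at he
    refine hN1 (hfaith N hN fun y hy => ?_)
    rw [he ⟨y, hy⟩, ← OneMemClass.coe_one N, he]
    simp

end OrbitStructure

section OddSums

variable {N : Type} [Group N] [Finite N]

theorem ip_mul_sum {O : Finset (N → ℂ)} (hO : ∀ β ∈ O, IsIrrChar N β) (e : ℂ) {γ : N → ℂ}
    (hγ : IsIrrChar N γ) :
    ip (fun x => e * ∑ β ∈ O, β x) γ = if γ ∈ O then e else 0 := by
  have h : (fun x => e * ∑ β ∈ O, β x) = e • ∑ β ∈ O, β :=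
    funext fun x => by simp
  rw [h, ip_smul_left, ip_sum_left]
  split_ifs with hmem
  · rw [Finset.sum_eq_single_of_mem γ hmem fun β hβ hne => (hO β hβ).ip_ne hγ hne, hγ.ip_self,
      mul_one]
  · rw [Finset.sum_eq_zero fun β hβ => (hO β hβ).ip_ne hγ fun h => hmem (h ▸ hβ), mul_zero]

theorem avg_eq_zero_of_one_notMem {O : Finset (N → ℂ)} (hO : ∀ β ∈ O, IsIrrChar N β)
    (h1 : 1 ∉ O) {e : ℂ} {f : N → ℂ} (hf : ∀ x, f x = e * ∑ β ∈ O, β x) : avg f = 0 := by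
  have h := ip_mul_sum hO e (isIrrChar_one (N := N))
  rw [if_neg h1, ← funext hf] at h
  simpa [ip] using h

/-- A multiple of an odd sum of nontrivial linear characters of a group of odd exponent is not
invariant under inversion. -/
theorem not_inv_invariant {O : Finset (N → ℂ)} (hO : ∀ β ∈ O, IsIrrChar N β ∧ β 1 = 1)
    (hodd : Odd O.card) (h1 : 1 ∉ O) {e : ℂ} (he : e ≠ 0) {f : N → ℂ}
    (hf : ∀ x, f x = e * ∑ β ∈ O, β x) {p : ℕ} (hp : Odd p) (hexp : ∀ x : N, x ^ p = 1) :
    ¬ ∀ x, f x⁻¹ = f x := by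
  intro hinv
  have hmem : ∀ β ∈ O, (fun x => β x⁻¹) ∈ O := fun β hβ => by
    have hβ' : IsIrrChar N fun x => β x⁻¹ := by
      refine isIrrChar_of_ip_self (hO β hβ).1.1.dual ?_
      rw [← (hO β hβ).1.ip_self]
      exact avg_inv_group fun x => β x * β x⁻¹
    have h := ip_mul_sum (fun β hβ => (hO β hβ).1) e hβ'
    rw [← funext hf] at h
    have h2 := ip_mul_sum (fun β hβ => (hO β hβ).1) e (hO β hβ).1
    rw [← funext hf, if_pos hβ] at h2
    by_contra hno
    rw [if_neg hno] at h
    refine he ?_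
    rw [← h2, ← h, ip, ip, ← avg_inv_group]
    refine congrArg avg (funext fun x => ?_)
    rw [hinv]
  let τ : Equiv.Perm O :=
    { toFun := fun β => ⟨_, hmem β β.2⟩
      invFun := fun β => ⟨_, hmem β β.2⟩
      left_inv := fun β => Subtype.ext (funext fun x => by simp)
      right_inv := fun β => Subtype.ext (funext fun x => by simp) }
  have hτ : τ ^ 2 ^ 1 = 1 := by
    rw [pow_one, sq]
    exact Equiv.ext fun β => Subtype.ext (funext fun x => by simp [τ])
  have : Fact (Nat.Prime 2) := ⟨Nat.prime_two⟩
  obtain ⟨⟨β, hβ⟩, hfix⟩ := Equiv.Perm.exists_fixed_point_of_prime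
    (by rw [Fintype.card_coe, ← even_iff_two_dvd, Nat.not_even_iff_odd]; exact hodd) hτ
  have hfix : ∀ x, β x⁻¹ = β x := congrFun (congrArg Subtype.val hfix)
  obtain ⟨μ, hμ⟩ := (hO β hβ).1.exists_linear (hO β hβ).2
  refine h1 ?_
  suffices β = 1 by rwa [← this]
  refine funext fun x => ?_
  have h2 : μ x ^ 2 = 1 := by
    have h := hfix x
    rw [hμ, hμ, Units.val_inj, map_inv] at h
    rw [sq]
    nth_rewrite 1 [← h]
    exact inv_mul_cancel _
  have hp1 : μ x ^ p = 1 := by rw [← map_pow, hexp, map_one]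
  obtain ⟨k, rfl⟩ := hp
  rw [pow_succ, pow_mul, h2, one_pow, one_mul] at hp1
  rw [hμ, hp1]
  rfl

end OddSums

/-- The irreducible constituents of the restriction of `χ` to any `M` which is normal in a normal
subgroup have `σ'`-determinantal order. -/
def HasPrimeDets (σ : Set ℕ) (G : Type) [Group G] (χ : G → ℂ) : Prop :=
  ∀ M N : Subgroup G, N.Normal → M ≤ N → (∀ x ∈ M, ∀ n ∈ N, n * x * n⁻¹ ∈ M) →
    ∀ (d : ℕ) (ρ : Representation ℂ M (Fin d → ℂ)), ρ.IsIrreducible →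
      IsConstituent ρ.character (resChar M χ) →
        ∃ m, IsPiNumber σᶜ m ∧ ∀ h, LinearMap.det (ρ h) ^ m = 1

section

variable {σ : Set ℕ} {G : Type} [Group G] [Finite G] {χ : G → ℂ}

theorem IsPiSpecial.hasPrimeDets (hχ : IsPiSpecial σᶜ G χ) : HasPrimeDets σ G χ := by
  intro M N hN hMN hn d ρ hρ hc
  obtain ⟨V, hV, hdet⟩ := hχ.2.2 M ⟨2, ![M, N, ⊤], rfl, rfl, fun i => by
    fin_cases i
    · refine ⟨hMN, ⟨fun x hx g => ?_⟩⟩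
      exact hn x hx g g.2
    · exact ⟨le_top, hN.subgroupOf _⟩⟩ ρ.character hc
  obtain ⟨e, he⟩ := exists_equiv_of_character_eq (σ := V.ρ) hρ (funext hV)
  refine ⟨_, hdet, fun h => ?_⟩
  have h1 : LinearMap.det (ρ h) = LinearMap.det (V.ρ h) := by
    rw [← LinearMap.det_conj (ρ h) e]
    congr 1
    refine LinearMap.ext fun v => ?_
    simp [he]
  rw [h1]
  exact congrFun (pow_orderOf_eq_one fun g : M => LinearMap.det (V.ρ g)) h

theorem HasPrimeDets.of_comp {Q : Type} [Group Q] {f : G →* Q} (hf : Function.Surjective f)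
    {ψ : Q → ℂ} (h : HasPrimeDets σ G fun g => ψ (f g)) : HasPrimeDets σ Q ψ := by
  intro M N hN hMN hn d ρ hρ hc
  let r : M.comap f →* M := f.subgroupComap M
  have hr : Function.Surjective r := MonoidHom.subgroupComap_surjective_of_surjective f M hf
  have : Finite Q := Finite.of_surjective f hf
  have hirr : IsIrrChar (M.comap f) (ρ.character ∘ r) := by
    refine isIrrChar_of_ip_self ((isCharacter_character ρ).comp r) ?_
    have h1 := (isIrrChar_of_isIrreducible hρ).ip_self
    rw [← h1, ip, ip, ← avg_comp_surjective r hr]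
    simp
  let ρ' : Representation ℂ (M.comap f) (Fin d → ℂ) := ρ.comp r
  have hirr' : ρ'.IsIrreducible := IsIrrChar.isIrreducible (ρ := ρ') hirr
  obtain ⟨ξ, hξ, hsum⟩ := hc.2
  have hξ' : ξ ∘ r = 0 ∨ IsCharacter (M.comap f) (ξ ∘ r) := by
    rcases hξ with rfl | hξ
    · exact Or.inl rfl
    · exact Or.inr (hξ.comp r)
  obtain ⟨m, hm, hd⟩ := h (M.comap f) (N.comap f) (hN.comap f) (Subgroup.comap_mono hMN)
    (fun x hx n hn' => by simpa using hn _ hx _ hn') d ρ' hirr'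
    ⟨hirr, ξ ∘ r, hξ', funext fun x => congrFun hsum (r x)⟩
  refine ⟨m, hm, fun x => ?_⟩
  obtain ⟨y, rfl⟩ := hr x
  exact hd y

theorem HasPrimeDets.det_eq_one (h : HasPrimeDets σ G χ) {M N : Subgroup G} (hN : N.Normal)
    (hMN : M ≤ N) (hn : ∀ x ∈ M, ∀ n ∈ N, n * x * n⁻¹ ∈ M) {d : ℕ}
    {ρ : Representation ℂ M (Fin d → ℂ)} (hρ : ρ.IsIrreducible)
    (hc : IsConstituent ρ.character (resChar M χ)) {x : M} (hx : IsPiElt σ x) :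
    LinearMap.det (ρ x) = 1 := by
  obtain ⟨m, hm, hd⟩ := h M N hN hMN hn d ρ hρ hc
  have h1 : LinearMap.det (ρ x) ^ orderOf x = 1 := by
    rw [← map_pow, ← map_pow, pow_orderOf_eq_one, map_one, map_one]
  have h2 := Nat.dvd_gcd (orderOf_dvd_of_pow_eq_one h1) (orderOf_dvd_of_pow_eq_one (hd x))
  rw [hx.coprime hm, Nat.dvd_one] at h2
  exact orderOf_eq_one_iff.1 h2

theorem eq_one_of_character_const {d : ℕ} (ρ : Representation ℂ G (Fin d → ℂ))
    (h : ∀ g, ρ.character g = d) (g : G) : ρ g = 1 := by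
  have := Fintype.ofFinite G
  have := invertibleOfNonzero (card_ne_zero_complex G)
  have ht := ρ.card_inv_mul_sum_char_eq_finrank
  simp only [h, Finset.sum_const, Finset.card_univ, nsmul_eq_mul, ← Nat.card_eq_fintype_card] at ht
  rw [inv_mul_cancel_left₀ (card_ne_zero_complex G), Nat.cast_inj] at ht
  have htop : ρ.invariants = ⊤ := Submodule.eq_top_of_finrank_eq (by simp [← ht])
  refine LinearMap.ext fun v => ?_
  exact (ρ.mem_invariants v).1 (htop ▸ Submodule.mem_top) g

end

section

variable {σ : Set ℕ} {G Q : Type} [Group G] [Finite G] [Group Q] {χ : G → ℂ} {q : G →* Q}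
  {N : Subgroup Q}

theorem isPiNumber_card_ker_subgroupComap {τ : Set ℕ} (hK : IsPiNumber τ (Nat.card q.ker))
    (M : Subgroup Q) : IsPiNumber τ (Nat.card (q.subgroupComap M).ker) := by
  refine hK.of_dvd (Subgroup.card_dvd_of_injective
    (((M.comap q).subtype.comp (q.subgroupComap M).ker.subtype).codRestrict q.ker
      fun k => congrArg Subtype.val k.2) fun a b hab => ?_)
  exact Subtype.ext (Subtype.ext (congrArg (fun g : q.ker => (g : G)) hab))

open scoped IsMulCommutative in
theorem HasPrimeDets.apply_inv (h : HasPrimeDets σ G χ) (hχ : IsCharacter G χ)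
    (hq : Function.Surjective q) (hK : IsPiNumber σᶜ (Nat.card q.ker)) (hN : N.Normal)
    (hcomm : ∀ x y : N, x * y = y * x) {p : ℕ} (hp : p.Prime) (hpσ : p ∈ σ)
    (hexp : ∀ x : N, x ^ p = 1) {s : N →* G} (hs : ∀ x, q (s x) = x) (x : N) :
    χ (s x)⁻¹ = χ (s x) := by
  let A := Subgroup.zpowers (x : Q)
  have : IsMulCommutative A := inferInstanceAs (IsMulCommutative (Subgroup.zpowers (x : Q)))
  have : Finite Q := Finite.of_surjective q hq
  have hAN : A ≤ N := by simp [A]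
  let M := A.comap q
  let qM : M →* A := q.subgroupComap A
  have hmem : s x ∈ M := by simp [M, A, hs]
  let y : M := ⟨s x, hmem⟩
  have hy : qM y = ⟨x, Subgroup.mem_zpowers _⟩ := Subtype.ext (hs x)
  have hyp : y ^ p = 1 := Subtype.ext (by
    change s x ^ p = 1
    rw [← map_pow, hexp, map_one])
  have hgen : ∀ μ : A →* ℂˣ, μ (qM y) = 1 → μ = 1 := fun μ hμ => by
    refine MonoidHom.ext fun ⟨a, ha⟩ => ?_
    obtain ⟨k, rfl⟩ := Subgroup.mem_zpowers_iff.1 ha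
    have : (⟨(x : Q) ^ k, ha⟩ : A) = qM y ^ k := Subtype.ext (by rw [hy]; rfl)
    rw [this, map_zpow, hμ, one_zpow, MonoidHom.one_apply]
  have hχM : IsCharacter M (resChar M χ) := hχ.comp M.subtype
  have key : resChar M χ y⁻¹ = resChar M χ y := by
    rw [eq_sum_irr hχM.isClassFun]
    simp only [Finset.sum_apply, Pi.smul_apply, smul_eq_mul]
    refine Finset.sum_congr rfl fun η hη => ?_
    by_cases h0 : ip (resChar M χ) η = 0
    · rw [h0, zero_mul, zero_mul]
    have hη' := mem_irrFinset.1 hη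
    obtain ⟨d, ρ, hρ, rfl, -⟩ := hη'.exists_rep
    rw [character_inv_of_det_eq_one (A := A) (q := qM) (MonoidHom.subgroupComap_surjective_of_surjective q A hq)
      hgen hp hyp ?_ hρ ?_]
    · exact fun hdvd => isPiNumber_card_ker_subgroupComap hK A p hp hdvd hpσ
    · refine h.det_eq_one (hN.comap q) (Subgroup.comap_mono hAN) (fun a ha n hn => ?_) hρ
        (isConstituent_of_ip_ne_zero hχM hη' h0) fun r hr hrd => ?_
      · have : q n * q a = q a * q n := congrArg Subtype.val (hcomm ⟨q n, hn⟩ ⟨q a, hAN ha⟩)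
        change q (n * a * n⁻¹) ∈ A
        rw [map_mul, map_mul, map_inv, this, mul_inv_cancel_right]
        exact ha
      · have := (Nat.prime_dvd_prime_iff_eq hr hp).1 (hrd.trans (orderOf_dvd_of_pow_eq_one hyp))
        rwa [this]
  exact key

open scoped IsMulCommutative in
theorem HasPrimeDets.avg_ne_zero (h : HasPrimeDets σ G χ) (hχ : IsCharacter G χ)
    (h2 : 2 ∈ σ) (hq : Function.Surjective q) (hK : IsPiNumber σᶜ (Nat.card q.ker))
    (hN : N.Normal) (hcomm : ∀ x y : N, x * y = y * x) (hexp : ∀ x : N, x * x = 1)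
    {n : ℕ} (hn : χ 1 = n) (hodd : Odd n) {s : N →* G} (hs : ∀ x, q (s x) = x) :
    avg (fun x => χ (s x)) ≠ 0 := by
  have : Finite Q := Finite.of_surjective q hq
  have := Fintype.ofFinite N
  have : IsMulCommutative N := ⟨⟨hcomm⟩⟩
  let M := N.comap q
  let qM : M →* N := q.subgroupComap N
  let i : N →* M := s.codRestrict M fun x => by simp [M, hs]
  have hqi : ∀ x, qM (i x) = x := fun x => Subtype.ext (hs x)
  have hχM : IsCharacter M (resChar M χ) := hχ.comp M.subtype
  have hdec := eq_sum_irr hχM.isClassFun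
  choose! k hk using fun η (hη : IsIrrChar M η) => hχM.ip_nat hη.1
  choose! d hd using fun η (hη : IsIrrChar M η) => hη.1.exists_degree
  choose! a ha using fun η (hη : IsIrrChar M η) =>
    (hη.1.comp i).ip_nat (isIrrChar_one (N := N)).1
  have ha' : ∀ η, IsIrrChar M η → avg (fun x => η (i x)) = a η := fun η hη => by
    rw [← ha η hη, ip]
    simp
  have hsum : n = ∑ η ∈ irrFinset M, k η * d η := by
    have h1 := congrFun hdec 1
    simp only [Finset.sum_apply, Pi.smul_apply, smul_eq_mul] at h1
    have h3 : resChar M χ 1 = n := hn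
    rw [h3] at h1
    have : (n : ℂ) = ((∑ η ∈ irrFinset M, k η * d η : ℕ) : ℂ) := by
      rw [h1]
      push_cast
      exact Finset.sum_congr rfl fun η hη => by
        rw [hk η (mem_irrFinset.1 hη), hd η (mem_irrFinset.1 hη)]
    exact_mod_cast this
  have havg : avg (fun x => χ (s x)) = ((∑ η ∈ irrFinset M, k η * a η : ℕ) : ℂ) := by
    have h1 : (fun x => χ (s x)) = fun x => ∑ η ∈ irrFinset M, ip (resChar M χ) η * η (i x) := by
      funext x
      have := congrFun hdec (i x)
      simp only [Finset.sum_apply, Pi.smul_apply, smul_eq_mul] at this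
      exact this
    rw [h1, avg_sum]
    push_cast
    exact Finset.sum_congr rfl fun η hη => by
      rw [avg_mul_left, ha' η (mem_irrFinset.1 hη), hk η (mem_irrFinset.1 hη)]
  obtain ⟨η, hη, hηodd⟩ : ∃ η ∈ irrFinset M, Odd (k η * d η) := by
    by_contra! hc
    rw [hsum] at hodd
    refine Nat.not_even_iff_odd.2 hodd (Finset.even_sum _ fun η hη => ?_)
    exact Nat.not_odd_iff_even.1 (hc η hη)
  have hη' := mem_irrFinset.1 hη
  obtain ⟨hko, hdo⟩ := Nat.odd_mul.1 hηodd
  have hk0 : k η ≠ 0 := fun h0 => by simp [h0] at hko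
  have ha0 : a η ≠ 0 := by
    obtain ⟨e, ρ, hρ, hηρ, -, hηe⟩ := hη'.exists_rep
    have he : e = d η := by
      rw [hd η hη'] at hηe
      exact_mod_cast hηe.symm
    have := sum_trace_complement_ne_zero (P := N) hexp qM i hqi ?_ hρ (by simpa [he] using hdo) ?_
    · intro h0
      apply this
      have h1 := ha' η hη'
      rw [h0, avg_eq_sum, Nat.cast_zero, smul_eq_zero] at h1
      rcases h1 with h1 | h1
      · simp at h1
      · rw [hηρ] at h1
        exact h1
    · rw [← Nat.not_even_iff_odd, even_iff_two_dvd]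
      exact fun hdvd => isPiNumber_card_ker_subgroupComap hK N 2 Nat.prime_two hdvd h2
    · intro x
      refine h.det_eq_one (hN.comap q) le_rfl (fun a ha n hn => (hN.comap q).conj_mem a ha n) hρ
        (hηρ ▸ isConstituent_of_ip_ne_zero hχM hη' ?_) fun r hr hrd => ?_
      · rw [hk η hη']
        exact_mod_cast hk0
      · have h1 : i x ^ 2 = 1 := by rw [pow_two, ← map_mul, hexp, map_one]
        have := (Nat.prime_dvd_prime_iff_eq hr Nat.prime_two).1
          (hrd.trans (orderOf_dvd_of_pow_eq_one h1))
        rwa [this]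
  rw [havg, Nat.cast_ne_zero]
  exact fun h0 => mul_ne_zero hk0 ha0 (Finset.sum_eq_zero_iff.1 h0 η hη)

end

/-- A function on a group does not decompose as a sum of two nonzero characters on the
`σ`-elements. -/
def IsPiIndecomposable (σ : Set ℕ) {G : Type} [Group G] (φ : G → ℂ) : Prop :=
  ∀ χ₁ χ₂, IsCharacter G χ₁ → IsCharacter G χ₂ →
    (∀ g, IsPiElt σ g → φ g = χ₁ g + χ₂ g) → χ₁ = 0 ∨ χ₂ = 0

theorem IsPiIndecomposable.of_map {σ : Set ℕ} {G Q : Type} [Group G] [Group Q] {φ : G → ℂ}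
    (h : IsPiIndecomposable σ φ) {q : G →* Q} (hq : Function.Surjective q) {φ' : Q → ℂ}
    (hφ' : ∀ g, IsPiElt σ g → φ' (q g) = φ g) : IsPiIndecomposable σ φ' := by
  intro χ₁ χ₂ h₁ h₂ hsum
  have hcancel : ∀ ψ : Q → ℂ, ψ ∘ q = 0 → ψ = 0 := fun ψ hψ => funext fun y => by
    obtain ⟨g, rfl⟩ := hq y
    exact congrFun hψ g
  refine (h (χ₁ ∘ q) (χ₂ ∘ q) (h₁.comp q) (h₂.comp q) fun g hg => ?_).imp (hcancel _) (hcancel _)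
  rw [← hφ' g hg]
  exact hsum _ (hg.of_map q)

/-- A minimal normal abelian subgroup has prime exponent. -/
theorem pow_eq_one_of_minimal {Q : Type} [Group Q] [Finite Q] {N : Subgroup Q} (hN : N.Normal)
    (hcomm : ∀ x y : N, x * y = y * x) {p : ℕ} (hp : p.Prime) (hpN : p ∣ Nat.card N)
    (hmin : ∀ T : Subgroup Q, T.Normal → T ≠ ⊥ → T ≤ N → T = N) (x : N) : x ^ p = 1 := by
  let T : Subgroup Q :=
    { carrier := {x | x ∈ N ∧ x ^ p = 1}
      one_mem' := ⟨N.one_mem, one_pow p⟩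
      mul_mem' := fun {a b} ha hb => ⟨N.mul_mem ha.1 hb.1, by
        have : Commute a b := congrArg Subtype.val (hcomm ⟨a, ha.1⟩ ⟨b, hb.1⟩)
        rw [this.mul_pow, ha.2, hb.2, one_mul]⟩
      inv_mem' := fun {a} ha => ⟨N.inv_mem ha.1, by rw [inv_pow, ha.2, inv_one]⟩ }
  have hT : T = N := by
    refine hmin T ⟨fun a ha g => ⟨hN.conj_mem a ha.1 g, ?_⟩⟩ ?_ fun a ha => ha.1
    · rw [conj_pow, ha.2, mul_one, mul_inv_cancel]
    · have := Fact.mk hp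
      obtain ⟨y, hy⟩ := exists_prime_orderOf_dvd_card' p hpN
      intro hbot
      have hyT : (y : Q) ∈ T := ⟨y.2, by
        rw [← hy, ← Subgroup.coe_pow, pow_orderOf_eq_one, Subgroup.coe_one]⟩
      rw [hbot, Subgroup.mem_bot] at hyT
      rw [show y = 1 from Subtype.ext hyT, orderOf_one] at hy
      exact hp.one_lt.ne hy
  have hx : (x : Q) ∈ T := hT.symm ▸ x.2
  exact Subtype.ext hx.2

section

variable {σ : Set ℕ} {G : Type} [Group G] [Finite G] {χ : G → ℂ}

/-- In an indecomposable situation of degree greater than one, the quotient by the largest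
normal `σ'`-subgroup has a minimal normal subgroup, which is a `σ`-group. -/
theorem exists_minimal_normal (hG : HasPiChain σ G) (hirr : IsPiIndecomposable σ χ)
    {n : ℕ} (hn : χ 1 = n) (h1n : 1 < n) {K : Subgroup G} [K.Normal]
    (hK : IsPiNumber σᶜ (Nat.card K))
    (hKmax : ∀ Y : Subgroup G, Y.Normal → IsPiNumber σᶜ (Nat.card Y) → Y ≤ K) :
    ∃ N : Subgroup (G ⧸ K), N.Normal ∧ N ≠ ⊥ ∧ IsPiNumber σ (Nat.card N) ∧
      ∀ T : Subgroup (G ⧸ K), T.Normal → T ≠ ⊥ → T ≤ N → T = N := by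
  have hKtop : K ≠ ⊤ := by
    rintro rfl
    have h1 : ∀ g : G, IsPiElt σ g → g = 1 := fun g hg => by
      have := hg.coprime (hK.of_dvd (m := orderOf g) (by simpa using orderOf_dvd_natCard g))
      exact orderOf_eq_one_iff.1 ((Nat.coprime_self _).1 this)
    rcases hirr 1 (((n - 1 : ℕ) : ℂ) • 1) isCharacter_one (isCharacter_one.nsmul _)
      fun g hg => by
        rw [h1 g hg, hn, Nat.cast_sub h1n.le]
        simp with h | h
    · simpa using congrFun h 1
    · have := congrFun h 1
      have h3 : n - 1 ≠ 0 := by omega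
      simp only [Pi.smul_apply, Pi.one_apply, smul_eq_mul, mul_one, Pi.zero_apply] at this
      exact h3 (by exact_mod_cast this)
  let q := QuotientGroup.mk' K
  have hq : Function.Surjective q := QuotientGroup.mk'_surjective K
  have hnt : Nontrivial (G ⧸ K) := by
    rwa [QuotientGroup.nontrivial_iff]
  obtain ⟨N₀, hN₀, hlt, hpure⟩ := (hG.map hq).exists_normal_above (M := ⊥) bot_ne_top
  rw [Subgroup.relIndex_bot_left] at hpure
  have hσ : IsPiNumber σ (Nat.card N₀) := by
    refine hpure.resolve_right fun hc => hlt.not_ge ?_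
    have hle : N₀.comap q ≤ K := by
      refine hKmax _ (hN₀.comap q) ?_
      have h1 := Subgroup.card_mul_index (q.subgroupComap N₀).ker
      rw [Subgroup.index_ker, MonoidHom.range_eq_top.2
        (MonoidHom.subgroupComap_surjective_of_surjective q N₀ hq), Subgroup.card_top] at h1
      rw [← h1]
      refine IsPiNumber.mul (isPiNumber_card_ker_subgroupComap ?_ N₀) hc
      rwa [QuotientGroup.ker_mk']
    intro y hy
    obtain ⟨g, rfl⟩ := hq y
    exact (QuotientGroup.eq_one_iff g).2 (hle hy)
  obtain ⟨N, ⟨hN, hN1, hNσ⟩, hmin⟩ := Set.Finite.exists_minimal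
    (s := {N : Subgroup (G ⧸ K) | N.Normal ∧ N ≠ ⊥ ∧ IsPiNumber σ (Nat.card N)})
    (Set.toFinite _) ⟨N₀, hN₀, hlt.ne', hσ⟩
  refine ⟨N, hN, hN1, hNσ, fun T hT hT1 hTN => le_antisymm hTN (hmin ⟨hT, hT1, ?_⟩ hTN)⟩
  exact hNσ.of_dvd (Subgroup.card_dvd_of_le hTN)

theorem HasPrimeDets.false_of_faithful (h2 : 2 ∈ σ) (hG : HasPiChain σ G)
    (hχ : IsCharacter G χ) (hfaith : ∀ X : Subgroup G, (∀ x ∈ X, χ x = χ 1) → X = ⊥)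
    (hdet : HasPrimeDets σ G χ) (hirr : IsPiIndecomposable σ χ) {n : ℕ} (hn : χ 1 = n)
    (hnσ : IsPiNumber σᶜ n) (h1n : 1 < n) : False := by
  obtain ⟨K, hKn, hK, hKmax⟩ := exists_largest_normal σᶜ G
  obtain ⟨N, hN, hN1, hNσ, hmin⟩ := exists_minimal_normal hG hirr hn h1n hK hKmax
  let q := QuotientGroup.mk' K
  have hq : Function.Surjective q := QuotientGroup.mk'_surjective K
  have hker : IsPiNumber σᶜ (Nat.card q.ker) := by rwa [QuotientGroup.ker_mk']
  obtain ⟨φ, hφ, hφχ⟩ := (hχ.isCharLike (σ := σ)).descend hq hker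
  have hφ1 : φ 1 = χ 1 := by
    rw [← hφχ 1 (by simpa [IsPiElt] using isPiNumber_one σ), map_one]
  have hsec : ∀ X : Subgroup (G ⧸ K), IsPiNumber σ (Nat.card X) →
      ∃ s : X →* G, (∀ x, q (s x) = x) ∧ ∀ x : X, χ (s x) = φ x := fun X hX => by
    obtain ⟨s, hs⟩ := exists_section_subgroup hq hker X hX
    refine ⟨s, hs, fun x => ?_⟩
    rw [← hφχ _ ((hX.isPiElt x).of_map s), hs]
  obtain ⟨hcomm, O, e, he, hodd, hO, h1O, hsum⟩ := exists_odd_linear h2 (hG.map hq) hφ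
    (hirr.of_map hq hφχ) (fun X hX hXφ => by
      obtain ⟨s, hs, hsχ⟩ := hsec X hX
      have := hfaith s.range fun x hx => by
        obtain ⟨y, rfl⟩ := hx
        rw [hsχ, hXφ y y.2, hφ1]
      rw [Subgroup.eq_bot_iff_forall]
      intro x hx
      have h1 : s ⟨x, hx⟩ ∈ s.range := ⟨_, rfl⟩
      rw [this, Subgroup.mem_bot] at h1
      have h3 := hs ⟨x, hx⟩
      rw [h1, map_one] at h3
      exact h3.symm) hNσ hN1 (hφ1.trans hn) hnσ
  obtain ⟨s, hs, hsχ⟩ := hsec N hNσ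
  obtain ⟨p, hp, hpN⟩ := Nat.exists_prime_and_dvd (mt Subgroup.card_eq_one.1 hN1)
  have hexp := pow_eq_one_of_minimal hN hcomm hp hpN hmin
  rcases hp.eq_two_or_odd' with rfl | hpodd
  · refine hdet.avg_ne_zero hχ h2 hq hker hN hcomm (fun x => by rw [← pow_two, hexp]) hn ?_ hs ?_
    · rw [← Nat.not_even_iff_odd, even_iff_two_dvd]
      exact fun hd => hnσ 2 Nat.prime_two hd h2
    · simp only [hsχ]
      exact avg_eq_zero_of_one_notMem (fun β hβ => (hO β hβ).1) h1O hsum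
  · refine not_inv_invariant hO hodd h1O (Nat.cast_ne_zero.2 he) hsum hpodd hexp fun x => ?_
    rw [← hsχ, ← hsχ, map_inv]
    exact hdet.apply_inv hχ hq hker hN hcomm hp (hNσ p hp hpN) hexp hs x

end

theorem IsIPiChar.isPiIndecomposable {σ : Set ℕ} {G : Type} [Group G] {χ : G → ℂ}
    (h : IsIPiChar σ G (piRestrict σ χ)) : IsPiIndecomposable σ χ := by
  intro χ₁ χ₂ h₁ h₂ hsum
  by_contra! hc
  refine h.2 ⟨_, _, ⟨χ₁, h₁, hc.1, rfl⟩, ⟨χ₂, h₂, hc.2, rfl⟩, funext fun g => ?_⟩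
  by_cases hg : IsPiElt σ g <;> simp [piRestrict, hg, hsum]

theorem exists_injective_factor {G M : Type} [Group G] [Monoid M] (ρ : G →* M) :
    ∃ (Q : Type) (_ : Group Q) (f : G →* Q) (τ : Q →* M), Function.Surjective f ∧
      Function.Injective τ ∧ ∀ g, τ (f g) = ρ g := by
  refine ⟨G ⧸ ρ.ker, QuotientGroup.Quotient.group _, QuotientGroup.mk' ρ.ker,
    QuotientGroup.lift ρ.ker ρ fun _ h => h, QuotientGroup.mk'_surjective _,
    (injective_iff_map_eq_one _).2 fun x hx => ?_, fun _ => rfl⟩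
  obtain ⟨g, rfl⟩ := QuotientGroup.mk'_surjective _ x
  exact (QuotientGroup.eq_one_iff g).2 hx

/-- Every character is inflated from a faithful character of a quotient. -/
theorem IsCharacter.exists_faithful {G : Type} [Group G] [Finite G] {χ : G → ℂ}
    (hχ : IsCharacter G χ) : ∃ (Q : Type) (_ : Group Q) (f : G →* Q) (ψ : Q → ℂ),
      Function.Surjective f ∧ IsCharacter Q ψ ∧ (∀ g, ψ (f g) = χ g) ∧
        ∀ X : Subgroup Q, (∀ x ∈ X, ψ x = ψ 1) → X = ⊥ := by
  obtain ⟨d, ρ, rfl⟩ := hχ.exists_rep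
  obtain ⟨Q, hQ, f, τ, hf, hτ, hτρ⟩ := exists_injective_factor ρ
  have hfin : Finite Q := Finite.of_surjective f hf
  let ρ' : Representation ℂ Q (Fin d → ℂ) := τ
  refine ⟨Q, hQ, f, ρ'.character, hf, isCharacter_character ρ',
    fun g => congrArg (LinearMap.trace ℂ _) (hτρ g), fun X hX => ?_⟩
  rw [Subgroup.eq_bot_iff_forall]
  intro x hx
  apply hτ
  rw [map_one]
  refine eq_one_of_character_const (ρ'.comp X.subtype) (fun g => (hX g g.2).trans ?_) ⟨x, hx⟩
  rw [Representation.char_one]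
  simp

/-- **Theorem (Statement 10, Navarro).** Let `π` be a set of primes with `2 ∈ π` and let
`G` be a finite `π`-separable group.  If `χ ∈ Irr(G)` is `π'`-special and `χ(1) > 1`,
then `χ^o ∉ I_π(G)`. -/
theorem piPrimeSpecial_restriction_not_irreducible
    (π : Set ℕ) (h2 : 2 ∈ π)
    (G : Type) [Group G] [Fintype G] (hG : IsPiSeparable π G)
    (χ : G → ℂ) (hχ : IsPiSpecial πᶜ G χ)
    (hdeg : ∃ n : ℕ, χ 1 = (n : ℂ) ∧ 1 < n) :
    ¬ IsIPiChar π G (piRestrict π χ) := by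
  intro h
  obtain ⟨n, hn, h1n⟩ := hdeg
  obtain ⟨m, hm, hmπ⟩ := hχ.2.1
  obtain rfl : m = n := by exact_mod_cast hm.symm.trans hn
  obtain ⟨Q, _, f, ψ, hf, hψ, hψχ, hfaith⟩ := hχ.1.1.exists_faithful
  have hQ : Finite Q := Finite.of_surjective f hf
  have hdet : HasPrimeDets π Q ψ := by
    refine HasPrimeDets.of_comp hf ?_
    rw [funext hψχ]
    exact hχ.hasPrimeDets
  exact hdet.false_of_faithful h2 (hG.hasPiChain.map hf) hψ hfaith
    (h.isPiIndecomposable.of_map hf fun g _ => hψχ g)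
    (by rw [← hn, ← hψχ 1, map_one]) hmπ h1n
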